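/- arXiv:math/0506564 — 2 statements merged into one kernel-verified Lean document; each statement's English description precedes it below -/
import Mathlib

section
/- If αP and βP are any two triangulations of an n-polyhedron P, then αP and βP are equivalent by finitely many elementary moves. -/
open Set MeasureTheory
open scoped Classical
noncomputable section

/-- Ambient Euclidean space `ℝ^N`. -/
abbrev Euc (N : ℕ) := EuclideanSpace ℝ (Fin N)

/-- `s` is an `n`-simplex: the convex hull of `n+1` affinely independent points. -/
def IsSimplex {N : ℕ} (n : ℕ) (s : Set (Euc N)) : Prop :=
  ∃ v : Fin (n + 1) → Euc N, AffineIndependent ℝ v ∧ s = convexHull ℝ (Set.range v)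

/-- The (affine) dimension of a set: the rank of its vector span. -/
def sdim {N : ℕ} (s : Set (Euc N)) : ℕ := Module.finrank ℝ (vectorSpan ℝ s)

/-- A polytope: the compact convex hull of finitely many points (nonempty). -/
def IsPolytope {N : ℕ} (s : Set (Euc N)) : Prop :=
  ∃ t : Finset (Euc N), t.Nonempty ∧ s = convexHull ℝ (t : Set (Euc N))

/-- An `n`-polyhedron: a finite union of `n`-dimensional polytopes. -/
def IsPolyhedron {N : ℕ} (n : ℕ) (P : Set (Euc N)) : Prop :=
  ∃ F : Finset (Set (Euc N)), F.Nonempty ∧ (∀ Q ∈ F, IsPolytope Q ∧ sdim Q = n) ∧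
    (⋃ Q ∈ F, Q) = P

/-- A triangulation of the `n`-dimensional set `P`: a finite set of `n`-simplices with
union `P`, any two distinct ones intersecting in a set of dimension less than `n`. -/
def IsTriangulation {N : ℕ} (n : ℕ) (P : Set (Euc N)) (F : Finset (Set (Euc N))) : Prop :=
  (∀ T ∈ F, IsSimplex n T) ∧ (⋃ T ∈ F, T) = P ∧
    ∀ S ∈ F, ∀ T ∈ F, S ≠ T → sdim (S ∩ T) < n

/-- A starring of `P` at `a`: a triangulation all of whose simplices have a vertex at `a`. -/
def IsStarring {N : ℕ} (n : ℕ) (P : Set (Euc N)) (a : Euc N) (F : Finset (Set (Euc N))) : Prop :=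
  IsTriangulation n P F ∧
    ∀ T ∈ F, ∃ v : Fin (n + 1) → Euc N, AffineIndependent ℝ v ∧
      T = convexHull ℝ (Set.range v) ∧ a ∈ Set.range v

/-- `T` is dissected into the two `n`-simplices `T₁, T₂` by a hyperplane containing an
`(n-2)`-dimensional face of `T`. -/
def IsDissection {N : ℕ} (n : ℕ) (T T₁ T₂ : Set (Euc N)) : Prop :=
  IsSimplex n T₁ ∧ IsSimplex n T₂ ∧ T₁ ∪ T₂ = T ∧ T₁ ≠ T₂ ∧
  ∃ (f : Euc N →ₗ[ℝ] ℝ) (c : ℝ), f ≠ 0 ∧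
    T₁ = T ∩ {x | f x ≤ c} ∧ T₂ = T ∩ {x | c ≤ f x} ∧
    ∃ v : Fin (n + 1) → Euc N, AffineIndependent ℝ v ∧ T = convexHull ℝ (Set.range v) ∧
      ∃ s : Finset (Fin (n + 1)), s.card = n - 1 ∧ ∀ i ∈ s, f (v i) = c

/-- An elementary move: dissect one simplex of the triangulation into two `n`-simplices by a
hyperplane containing an `(n-2)`-face, or merge two simplices whose union is again a simplex. -/
def ElemMove {N : ℕ} (n : ℕ) (F G : Finset (Set (Euc N))) : Prop :=
  (∃ T ∈ F, ∃ T₁ T₂, IsDissection n T T₁ T₂ ∧ G = insert T₁ (insert T₂ (F.erase T))) ∨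
  (∃ T₁ ∈ F, ∃ T₂ ∈ F, T₁ ≠ T₂ ∧ IsSimplex n (T₁ ∪ T₂) ∧
    G = insert (T₁ ∪ T₂) ((F.erase T₁).erase T₂))

/-- Equivalence by finitely many elementary moves. -/
def MoveEquiv {N : ℕ} (n : ℕ) (F G : Finset (Set (Euc N))) : Prop :=
  Relation.ReflTransGen (ElemMove n) F G

/-- `μ` is a valuation on the class `S` of sets. -/
def IsValuation {N : ℕ} (S : Set (Set (Euc N))) (μ : Set (Euc N) → ℝ) : Prop :=
  μ ∅ = 0 ∧ ∀ A ∈ S, ∀ B ∈ S, A ∪ B ∈ S → A ∩ B ∈ S →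
    μ A + μ B = μ (A ∪ B) + μ (A ∩ B)

/-- `𝒯ⁿ`: simplices of dimension at most `n` (together with `∅`). -/
def simplexClass (N n : ℕ) : Set (Set (Euc N)) :=
  {s | s = ∅ ∨ ∃ k ≤ n, IsSimplex k s}

/-- `𝒫ⁿ`: polytopes of dimension at most `n` (together with `∅`). -/
def polytopeClass (N n : ℕ) : Set (Set (Euc N)) :=
  {s | s = ∅ ∨ (IsPolytope s ∧ sdim s ≤ n)}

/-- `𝒬ⁿ`: polyhedra (finite unions of polytopes) of dimension at most `n` (with `∅`). -/
def polyhedronClass (N n : ℕ) : Set (Set (Euc N)) :=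
  {s | s = ∅ ∨ ((∃ F : Finset (Set (Euc N)), F.Nonempty ∧ (∀ Q ∈ F, IsPolytope Q) ∧
      (⋃ Q ∈ F, Q) = s) ∧ sdim s ≤ n)}


namespace TriEq

set_option linter.unusedSectionVars false
set_option linter.unusedSimpArgs false

variable {E : Type*} [AddCommGroup E] [Module ℝ E]

/-- Lift of a point to height one. -/
def ell (x : E) : E × ℝ := (x, 1)

/-- Linear rank of the lift of a set (affine dimension plus one). -/
def rk (D : Set E) : ℕ := Module.finrank ℝ (Submodule.span ℝ (ell '' D))

/-- Generating relation: cutting an edge, and dropping degenerate simplices. -/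
inductive Gen : Multiset (Multiset E) → Multiset (Multiset E) → Prop
  | cut (x y p : E) (s : Multiset E) (h : p ∈ segment ℝ x y) :
      Gen {x ::ₘ y ::ₘ s} ({x ::ₘ p ::ₘ s} + {p ::ₘ y ::ₘ s})
  | deg (s : Multiset E) (h : rk {x | x ∈ s} < s.card) : Gen {s} 0

/-- The monoid of formal sums of simplices modulo elementary moves. -/
abbrev Mon (E : Type*) [AddCommGroup E] [Module ℝ E] := (addConGen (Gen (E := E))).Quotient

/-- Class of a simplex given by its vertices. -/
def br (s : Multiset E) : Mon E := (addConGen (Gen (E := E))).mk' {s}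

/-- Class of a simplex given by a family of vertices. -/
def brf {ι : Type*} [Fintype ι] (v : ι → E) : Mon E := br (Finset.univ.val.map v)

theorem br_cut (x y p : E) (s : Multiset E) (h : p ∈ segment ℝ x y) :
    br (x ::ₘ y ::ₘ s) = br (x ::ₘ p ::ₘ s) + br (p ::ₘ y ::ₘ s) := by
  unfold br
  rw [← map_add]
  exact (AddCon.eq _).2 (AddConGen.Rel.of _ _ (Gen.cut x y p s h))

theorem br_deg (s : Multiset E) (h : rk {x | x ∈ s} < s.card) : br s = 0 := by
  unfold br
  rw [← map_zero (addConGen (Gen (E := E))).mk']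
  exact (AddCon.eq _).2 (AddConGen.Rel.of _ _ (Gen.deg s h))

theorem univ_map_update {ι : Type*} [Fintype ι] (v : ι → E) (i : ι) (a : E) :
    Finset.univ.val.map (Function.update v i a) = a ::ₘ (Finset.univ.erase i).val.map v := by
  have h : (Finset.univ : Finset ι) = insert i (Finset.univ.erase i) := by simp
  conv_lhs => rw [h]
  rw [Finset.insert_val_of_notMem (by simp)]
  rw [Multiset.map_cons]
  simp only [Function.update_self]
  congr 1
  apply Multiset.map_congr rfl
  intro x hx
  have : x ≠ i := by
    rintro rfl
    exact Finset.notMem_erase x _ hx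
  simp [this]

theorem univ_map_eq {ι : Type*} [Fintype ι] (v : ι → E) (i : ι) :
    Finset.univ.val.map v = v i ::ₘ (Finset.univ.erase i).val.map v := by
  have := univ_map_update v i (v i)
  rwa [Function.update_eq_self] at this

theorem univ_map_eq₂ {ι : Type*} [Fintype ι] (v : ι → E) {i j : ι} (hij : i ≠ j) :
    Finset.univ.val.map v = v i ::ₘ v j ::ₘ ((Finset.univ.erase i).erase j).val.map v := by
  rw [univ_map_eq v i]
  congr 1
  have h : (Finset.univ.erase i : Finset ι) = insert j ((Finset.univ.erase i).erase j) := by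
    rw [Finset.insert_erase]; simp [hij.symm]
  conv_lhs => rw [h]
  rw [Finset.insert_val_of_notMem (by simp), Multiset.map_cons]

theorem map_rest_update {ι : Type*} [Fintype ι] (v : ι → E) (i j l : ι) (h : l = i ∨ l = j) (a : E) :
    ((Finset.univ.erase i).erase j).val.map (Function.update v l a)
      = ((Finset.univ.erase i).erase j).val.map v := by
  apply Multiset.map_congr rfl
  intro x hx
  have hx' : x ∈ ((Finset.univ.erase i).erase j) := hx
  simp only [Finset.mem_erase] at hx'
  have : x ≠ l := by rcases h with rfl | rfl <;> tauto
  simp [this]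

theorem brf_cut {ι : Type*} [Fintype ι] (v : ι → E) {i j : ι} (hij : i ≠ j) (p : E)
    (h : p ∈ segment ℝ (v i) (v j)) :
    brf v = brf (Function.update v j p) + brf (Function.update v i p) := by
  unfold brf
  rw [univ_map_eq₂ v hij, univ_map_eq₂ (Function.update v j p) hij,
    univ_map_eq₂ (Function.update v i p) hij, map_rest_update _ _ _ _ (Or.inr rfl),
    map_rest_update _ _ _ _ (Or.inl rfl)]
  simp only [Function.update_self, Function.update_of_ne hij, Function.update_of_ne hij.symm]
  exact br_cut _ _ _ _ h

theorem rk_cons_lt [FiniteDimensional ℝ E] (a : E) (s : Multiset E) (h : rk {x | x ∈ s} < s.card) :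
    rk {x | x ∈ a ::ₘ s} < (a ::ₘ s).card := by
  have h1 : {x | x ∈ a ::ₘ s} = insert a {x | x ∈ s} := by
    ext x; simp
  rw [h1, Multiset.card_cons]
  refine lt_of_le_of_lt ?_ (Nat.succ_lt_succ h)
  unfold rk
  rw [image_insert_eq, Submodule.span_insert]
  refine (Submodule.finrank_add_le_finrank_add_finrank _ _).trans ?_
  have := finrank_span_le_card (R := ℝ) ({ell a} : Set (E × ℝ))
  simp only [toFinset_singleton, Finset.card_singleton] at this
  omega

/-- Coning from the point `a`. -/
def cone [FiniteDimensional ℝ E] (a : E) : Mon E →+ Mon E :=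
  AddCon.lift _ ((addConGen (Gen (E := E))).mk'.comp
    (Multiset.mapAddMonoidHom (fun s => a ::ₘ s))) (by
    rw [AddCon.addConGen_le]
    intro x y h
    rw [AddCon.ker_rel]
    cases h with
    | cut x y p s h =>
      have := br_cut x y p (a ::ₘ s) h
      simp only [AddMonoidHom.comp_apply, Multiset.mapAddMonoidHom_apply, map_add,
        Multiset.map_singleton, Multiset.map_add]
      rw [Multiset.cons_swap a x, Multiset.cons_swap a y, Multiset.cons_swap a x,
        Multiset.cons_swap a p, Multiset.cons_swap a p, Multiset.cons_swap a y]
      exact this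
    | deg s h =>
      have := br_deg (a ::ₘ s) (rk_cons_lt a s h)
      simpa [br] using this)

theorem cone_br [FiniteDimensional ℝ E] (a : E) (s : Multiset E) : cone a (br s) = br (a ::ₘ s) := by
  unfold cone br
  rw [AddCon.lift_mk']
  simp

theorem flip_term {ι : Type*} [Fintype ι] (P : ℝ → Prop) (hP0 : ¬ P 0) (v : ι → E) (lam : ι → ℝ)
    (a w : E) {i j : ι} (hij : i ≠ j) (hw : w ∈ segment ℝ (v i) (v j))
    (hi : P (lam i) ↔ P (lam i + lam j)) (hj : P (lam j) ↔ P (lam i + lam j)) :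
    ∑ l, (if P (lam l) then brf (Function.update v l a) else 0)
      = ∑ l, (if P (Function.update (Function.update lam j 0) i (lam i + lam j) l) then
          brf (Function.update (Function.update v i w) l a) else 0)
      + ∑ l, (if P (Function.update (Function.update lam i 0) j (lam i + lam j) l) then
          brf (Function.update (Function.update v j w) l a) else 0) := by
  rw [← Finset.sum_add_distrib]
  apply Finset.sum_congr rfl
  intro l _
  by_cases h1 : l = i
  · subst h1
    simp [hij, hP0, hi]
  by_cases h2 : l = j
  · subst h2
    simp [h1, hP0, hj]
  simp only [Function.update_of_ne h1, Function.update_of_ne h2]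
  split_ifs with h
  · rw [Function.update_comm (Ne.symm h1), Function.update_comm (Ne.symm h2), add_comm]
    apply brf_cut _ hij
    simpa [Function.update_of_ne (Ne.symm h1), Function.update_of_ne (Ne.symm h2)] using hw
  · simp

theorem sum_update₂ {ι M : Type*} [Fintype ι] [AddCommMonoid M] (g g' : ι → M) {i j : ι}
    (hij : i ≠ j) (h : ∀ l, l ≠ i → l ≠ j → g l = g' l) (h2 : g i + g j = g' i + g' j) :
    ∑ l, g l = ∑ l, g' l := by
  have key : ∀ f : ι → M, ∑ l, f l = f i + f j + ∑ l ∈ (Finset.univ.erase i).erase j, f l := by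
    intro f
    rw [← Finset.add_sum_erase _ f (Finset.mem_univ i),
      ← Finset.add_sum_erase _ f (show j ∈ Finset.univ.erase i by simp [hij.symm]), add_assoc]
  rw [key g, key g', h2]
  congr 1
  apply Finset.sum_congr rfl
  intro l hl
  simp only [Finset.mem_erase] at hl
  exact h l hl.2.1 hl.1

/-- The flip lemma. -/
theorem flip {ι : Type*} [Fintype ι] : ∀ (m : ℕ) (v : ι → E) (lam : ι → ℝ) (a : E),
    (Finset.univ.filter (fun i => lam i ≠ 0)).card ≤ m → ∑ i, lam i = 1 → a = ∑ i, lam i • v i →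
    brf v + ∑ i, (if lam i < 0 then brf (Function.update v i a) else 0)
      = ∑ i, (if 0 < lam i then brf (Function.update v i a) else 0) := by
  intro m
  induction m with
  | zero =>
    intro v lam a hm hs ha
    exfalso
    have h0 : ∀ i, lam i = 0 := by
      intro i
      by_contra h
      have : i ∈ Finset.univ.filter (fun i => lam i ≠ 0) := by simp [h]
      rw [Finset.card_eq_zero.1 (Nat.le_zero.1 hm)] at this
      simp at this
    simp [h0] at hs
  | succ m ih =>
    intro v lam a hm hs ha
    by_cases hA : ∃ i j, i ≠ j ∧ 0 < lam i * lam j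
    · obtain ⟨i, j, hij, hpos⟩ := hA
      have hsum : lam i + lam j ≠ 0 := by
        intro h
        have : lam j = - lam i := by linarith
        rw [this] at hpos
        nlinarith [sq_nonneg (lam i)]
      have hi0 : lam i ≠ 0 := by rintro h; simp [h] at hpos
      have hj0 : lam j ≠ 0 := by rintro h; simp [h] at hpos
      have hsigns : (0 < lam i ∧ 0 < lam j) ∨ (lam i < 0 ∧ lam j < 0) := mul_pos_iff.1 hpos
      obtain ⟨w, hwdef⟩ : ∃ w, w = (lam i / (lam i + lam j)) • v i + (lam j / (lam i + lam j)) • v j :=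
        ⟨_, rfl⟩
      have hws : (lam i + lam j) • w = lam i • v i + lam j • v j := by
        rw [hwdef, smul_add, smul_smul, smul_smul, mul_div_cancel₀ _ hsum, mul_div_cancel₀ _ hsum]
      have hw : w ∈ segment ℝ (v i) (v j) := by
        refine ⟨lam i / (lam i + lam j), lam j / (lam i + lam j), ?_, ?_, ?_, hwdef.symm⟩
        · rcases hsigns with h | h
          · exact div_nonneg h.1.le (by linarith)
          · exact div_nonneg_of_nonpos h.1.le (by linarith)
        · rcases hsigns with h | h
          · exact div_nonneg h.2.le (by linarith)
          · exact div_nonneg_of_nonpos h.2.le (by linarith)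
        · rw [← add_div, div_self hsum]
      have hcard : ∀ i j : ι, i ≠ j → lam i ≠ 0 → lam j ≠ 0 → (Finset.univ.filter (fun l =>
          Function.update (Function.update lam j 0) i (lam i + lam j) l ≠ 0)).card ≤ m := by
        intro i j hij hi0 hj0
        have : (Finset.univ.filter (fun l =>
          Function.update (Function.update lam j 0) i (lam i + lam j) l ≠ 0)) ⊆
          (Finset.univ.filter (fun l => lam l ≠ 0)).erase j := by
          intro l hl
          simp only [Finset.mem_filter, Finset.mem_univ, true_and, Finset.mem_erase] at hl ⊢
          by_cases h1 : l = i
          · subst h1; exact ⟨hij, hi0⟩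
          by_cases h2 : l = j
          · subst h2; simp [h1] at hl
          · simp [h1, h2] at hl; exact ⟨h2, hl⟩
        refine (Finset.card_le_card this).trans ?_
        rw [Finset.card_erase_of_mem (by simp [hj0])]
        omega
      have IH1 := ih (Function.update v i w) (Function.update (Function.update lam j 0) i (lam i + lam j))
        a (hcard i j hij hi0 hj0)
        (by
          rw [← hs]
          refine sum_update₂ _ _ hij ?_ ?_
          · intro l h1 h2; simp [h1, h2]
          · simp [hij.symm])
        (by
          rw [ha]
          refine sum_update₂ _ _ hij ?_ ?_
          · intro l h1 h2; simp [h1, h2]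
          · simp [hij.symm, hws])
      have IH2 := ih (Function.update v j w) (Function.update (Function.update lam i 0) j (lam i + lam j))
        a (by rw [add_comm]; exact hcard j i hij.symm hj0 hi0)
        (by
          rw [← hs]
          refine sum_update₂ _ _ hij ?_ ?_
          · intro l h1 h2; simp [h1, h2]
          · simp [hij])
        (by
          rw [ha]
          refine sum_update₂ _ _ hij ?_ ?_
          · intro l h1 h2; simp [h1, h2]
          · simp [hij, hws])
      rw [flip_term (fun t => t < 0) (by simp) v lam a w hij hw, flip_term (fun t => 0 < t) (by simp) v lam a w hij hw,
        ← IH1, ← IH2, brf_cut v hij w hw]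
      · abel
      all_goals
        rcases hsigns with ⟨h1, h2⟩ | ⟨h1, h2⟩ <;> constructor <;> intro h <;> linarith
    · push Not at hA
      obtain ⟨i, hi⟩ : ∃ i, 0 < lam i := by
        by_contra h
        push Not at h
        have := Finset.sum_nonpos (fun i (_ : i ∈ Finset.univ) => h i)
        linarith
      have hothers : ∀ j, j ≠ i → lam j ≤ 0 := by
        intro j hj
        have := hA i j hj.symm
        by_contra h
        push Not at h
        have := mul_pos hi h
        linarith
      by_cases hB : ∃ j, lam j < 0
      · obtain ⟨j, hj⟩ := hB
        have hij : i ≠ j := by rintro rfl; linarith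
        have hz : ∀ l, l ≠ i → l ≠ j → lam l = 0 := by
          intro l h1 h2
          have h3 := hothers l h1
          rcases h3.lt_or_eq with h4 | h4
          · have := hA l j h2
            nlinarith [mul_pos_of_neg_of_neg h4 hj]
          · exact h4
        have hsum2 : ∀ (g : ι → Mon E), (∀ l, l ≠ i → g l = 0) → ∑ l, g l = g i := by
          intro g hg
          exact Finset.sum_eq_single i (fun l _ hl => hg l hl) (by simp)
        have hsum3 : ∀ (g : ι → Mon E), (∀ l, l ≠ j → g l = 0) → ∑ l, g l = g j := by
          intro g hg
          exact Finset.sum_eq_single j (fun l _ hl => hg l hl) (by simp)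
        rw [hsum3 _ (by
          intro l hl
          by_cases h1 : l = i
          · subst h1; simp [hi.le]
          · simp [hz l h1 hl]), hsum2 _ (by
          intro l hl
          simp [hothers l hl])]
        simp only [hi, hj, if_true]
        have e1 : lam i + lam j = 1 := by
          rw [← hs]
          rw [sum_update₂ lam (fun l => if l = i then lam i + lam j else 0) hij]
          · simp
          · intro l h1 h2; simp [hz l h1 h2, h1]
          · simp [hij.symm]
        have e2 : a = lam i • v i + lam j • v j := by
          rw [ha, sum_update₂ _ (fun l => if l = i then lam i • v i + lam j • v j else 0) hij]
          · simp
          · intro l h1 h2; simp [hz l h1 h2, h1]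
          · simp [hij.symm]
        rw [brf_cut (Function.update v i a) hij (v i)]
        · rw [Function.update_comm hij, Function.update_idem, Function.update_eq_self]
          rw [add_comm]
          congr 1
          -- both sides are the simplex with `v j` replaced by `a`
          unfold brf
          rw [univ_map_eq₂ _ hij, univ_map_eq₂ (Function.update _ _ _) hij]
          rw [map_rest_update _ i j j (Or.inr rfl), map_rest_update _ i j i (Or.inl rfl),
            map_rest_update _ i j j (Or.inr rfl)]
          simp only [Function.update_self, Function.update_of_ne hij, Function.update_of_ne hij.symm]
          rw [Multiset.cons_swap]
        · simp only [Function.update_self, Function.update_of_ne hij.symm]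
          refine ⟨1 / lam i, - lam j / lam i, by positivity, div_nonneg (by linarith) hi.le, ?_, ?_⟩
          · rw [← add_div, div_eq_one_iff_eq hi.ne']; linarith
          · rw [e2, smul_add, smul_smul, smul_smul, add_assoc, ← add_smul]
            have : 1 / lam i * lam j + -lam j / lam i = 0 := by ring
            rw [this, one_div, inv_mul_cancel₀ hi.ne']; simp
      · push Not at hB
        have hz : ∀ l, l ≠ i → lam l = 0 := fun l hl => le_antisymm (hothers l hl) (hB l)
        have e1 : lam i = 1 := by
          rw [← hs, Finset.sum_eq_single i (fun l _ hl => hz l hl) (by simp)]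
        have e2 : a = v i := by
          rw [ha, Finset.sum_eq_single i (fun l _ hl => by simp [hz l hl]) (by simp), e1, one_smul]
        rw [Finset.sum_eq_zero, Finset.sum_eq_single i]
        · simp [hi, e2]
        · intro l _ hl
          simp [hz l hl]
        · simp
        · intro l _
          simp [hB l]

end TriEq

namespace TriEq

set_option linter.unusedSectionVars false

variable {E : Type*} [AddCommGroup E] [Module ℝ E]

/-- Convex hull of a family. -/
def hull {ι : Type*} (v : ι → E) : Set E := convexHull ℝ (range v)

theorem ell_comb {x y : E} {a b : ℝ} (h : a + b = 1) :
    ell (a • x + b • y) = a • ell x + b • ell y := by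
  simp [ell, h]

theorem ell_sum {ι : Type*} [Fintype ι] (v : ι → E) (w : ι → ℝ) (h : ∑ i, w i = 1) :
    ell (∑ i, w i • v i) = ∑ i, w i • ell (v i) := by
  apply Prod.ext
  · simp [ell, Prod.fst_sum]
  · simp [ell, Prod.snd_sum, h]

theorem of_ell_sum {ι : Type*} [Fintype ι] {v : ι → E} {w : ι → ℝ} {x : E}
    (h : ell x = ∑ i, w i • ell (v i)) : ∑ i, w i = 1 ∧ x = ∑ i, w i • v i := by
  constructor
  · have := congrArg Prod.snd h
    simp [ell, Prod.snd_sum] at this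
    exact this.symm
  · have := congrArg Prod.fst h
    simpa [ell, Prod.fst_sum] using this

theorem ell_injective : Function.Injective (ell : E → E × ℝ) := fun _ _ h => congrArg Prod.fst h

theorem mem_hull {ι : Type*} [Fintype ι] {v : ι → E} {x : E} :
    x ∈ hull v ↔ ∃ w : ι → ℝ, (∀ i, 0 ≤ w i) ∧ ell x = ∑ i, w i • ell (v i) := by
  constructor
  · intro hx
    have : hull v ⊆ {x | ∃ w : ι → ℝ, (∀ i, 0 ≤ w i) ∧ ell x = ∑ i, w i • ell (v i)} := by
      apply convexHull_min
      · rintro _ ⟨i, rfl⟩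
        refine ⟨fun j => if j = i then 1 else 0, ?_, ?_⟩
        · intro j; dsimp only; split_ifs <;> norm_num
        · simp
      · rintro x ⟨w, hw, hx⟩ y ⟨w', hw', hy⟩ a b ha hb hab
        refine ⟨fun i => a * w i + b * w' i, ?_, ?_⟩
        · intro i
          have := hw i; have := hw' i
          positivity
        · rw [ell_comb hab, hx, hy, Finset.smul_sum, Finset.smul_sum, ← Finset.sum_add_distrib]
          apply Finset.sum_congr rfl
          intro i _
          rw [smul_smul, smul_smul, add_smul]
    exact this hx
  · rintro ⟨w, hw, hx⟩
    obtain ⟨h1, h2⟩ := of_ell_sum hx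
    rw [h2]
    exact (convex_convexHull ℝ (range v)).sum_mem (fun i _ => hw i) h1
      (fun i _ => subset_convexHull ℝ _ ⟨i, rfl⟩)

theorem mem_hull_self {ι : Type*} (v : ι → E) (i : ι) : v i ∈ hull v :=
  subset_convexHull ℝ _ ⟨i, rfl⟩

theorem hull_convex {ι : Type*} (v : ι → E) : Convex ℝ (hull v) := convex_convexHull ℝ _

/-- Half space. -/
def hs (f : (E × ℝ) →ₗ[ℝ] ℝ) : Set E := {x | 0 ≤ f (ell x)}

/-- Zero set. -/
def zs (f : (E × ℝ) →ₗ[ℝ] ℝ) : Set E := {x | f (ell x) = 0}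

theorem mem_hs {f : (E × ℝ) →ₗ[ℝ] ℝ} {x : E} : x ∈ hs f ↔ 0 ≤ f (ell x) := Iff.rfl

theorem mem_hs_neg {f : (E × ℝ) →ₗ[ℝ] ℝ} {x : E} : x ∈ hs (-f) ↔ f (ell x) ≤ 0 := by
  simp [hs]

theorem mem_zs {f : (E × ℝ) →ₗ[ℝ] ℝ} {x : E} : x ∈ zs f ↔ f (ell x) = 0 := Iff.rfl

theorem zs_neg (f : (E × ℝ) →ₗ[ℝ] ℝ) : zs (-f) = zs f := by
  ext x; simp [zs]

theorem hs_convex (f : (E × ℝ) →ₗ[ℝ] ℝ) : Convex ℝ (hs f) := by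
  intro x hx y hy a b ha hb hab
  rw [mem_hs] at *
  rw [ell_comb hab, map_add, map_smul, map_smul, smul_eq_mul, smul_eq_mul]
  positivity

theorem hs_inter_neg (f : (E × ℝ) →ₗ[ℝ] ℝ) : hs f ∩ hs (-f) = zs f := by
  ext x
  rw [mem_inter_iff, mem_hs, mem_hs_neg, mem_zs]
  constructor
  · rintro ⟨h1, h2⟩; exact le_antisymm h2 h1
  · intro h; exact ⟨h.ge, h.le⟩

theorem hull_subset_hs {ι : Type*} {v : ι → E} {f : (E × ℝ) →ₗ[ℝ] ℝ}
    (h : ∀ i, 0 ≤ f (ell (v i))) : hull v ⊆ hs f := by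
  apply convexHull_min _ (hs_convex f)
  rintro _ ⟨i, rfl⟩
  exact h i

theorem hull_lin {ι : Type*} {v : ι → E} {W : Submodule ℝ (E × ℝ)}
    (h : ∀ i, ell (v i) ∈ W) : ∀ x ∈ hull v, ell x ∈ W := by
  have : hull v ⊆ {x | ell x ∈ W} := by
    apply convexHull_min
    · rintro _ ⟨i, rfl⟩
      exact h i
    · intro x hx y hy a b ha hb hab
      show ell _ ∈ W
      rw [ell_comb hab]
      exact W.add_mem (W.smul_mem _ hx) (W.smul_mem _ hy)
  exact this

/-- Cutting a simplex along a hyperplane through a codimension two face. -/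
theorem cut_hull {ι : Type*} [Fintype ι] (v : ι → E) {i j : ι} (hij : i ≠ j) {t : ℝ}
    (ht0 : 0 < t) (g : (E × ℝ) →ₗ[ℝ] ℝ) (hi : g (ell (v i)) = - t) (hj : g (ell (v j)) = 1 - t)
    (ht1 : t < 1) (hl : ∀ l, l ≠ i → l ≠ j → g (ell (v l)) = 0) :
    hull v ∩ hs (-g) = hull (Function.update v j ((1 - t) • v i + t • v j)) := by
  have hp : ell ((1 - t) • v i + t • v j) = (1 - t) • ell (v i) + t • ell (v j) :=
    ell_comb (by ring)
  have hgp : g (ell ((1 - t) • v i + t • v j)) = 0 := by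
    rw [hp, map_add, map_smul, map_smul, hi, hj, smul_eq_mul, smul_eq_mul]; ring
  apply Subset.antisymm
  · rintro x ⟨hx, hx2⟩
    rw [mem_hs_neg] at hx2
    obtain ⟨w, hw, hxw⟩ := mem_hull.1 hx
    have key : g (ell x) = w i * (-t) + w j * (1 - t) := by
      rw [hxw, map_sum, sum_update₂ _ (fun l => if l = i then w i * (-t) + w j * (1 - t) else 0) hij]
      · simp
      · intro l h1 h2; simp [hl l h1 h2, h1]
      · simp [hij.symm, hi, hj]
    rw [key] at hx2
    refine mem_hull.2 ⟨Function.update (Function.update w i (w i - w j * (1 - t) / t)) j (w j / t), ?_, ?_⟩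
    · intro l
      by_cases h2 : l = j
      · subst h2; simp; exact div_nonneg (hw _) ht0.le
      by_cases h1 : l = i
      · subst h1; simp [h2]
        rw [div_le_iff₀ ht0]; linarith
      · simp [h1, h2, hw]
    · rw [hxw]
      refine sum_update₂ _ _ hij ?_ ?_
      · intro l h1 h2; simp [h1, h2]
      · simp only [Function.update_self, Function.update_of_ne hij, hp, smul_add, smul_smul]
        rw [← add_assoc, ← add_smul, div_mul_cancel₀ _ ht0.ne']
        congr 2
        field_simp
        ring
  · apply subset_inter
    · apply convexHull_min _ (hull_convex v)
      rintro _ ⟨l, rfl⟩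
      by_cases h2 : l = j
      · subst h2
        simp only [Function.update_self]
        exact hull_convex v (mem_hull_self v i) (mem_hull_self v l) (by linarith) ht0.le (by ring)
      · rw [Function.update_of_ne h2]; exact mem_hull_self v l
    · apply hull_subset_hs
      intro l
      by_cases h2 : l = j
      · subst h2
        simp [Function.update_self, hgp]
      · rw [Function.update_of_ne h2]
        by_cases h1 : l = i
        · subst h1; simp [hi, ht0.le]
        · simp [hl l h1 h2]

theorem exists_dual {V ι : Type*} [AddCommGroup V] [Module ℝ V] {u : ι → V}
    (h : LinearIndependent ℝ u) (c : ι → ℝ) : ∃ f : V →ₗ[ℝ] ℝ, ∀ i, f (u i) = c i := by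
  obtain ⟨g, hg⟩ := LinearMap.exists_extend ((Module.Basis.span h).constr ℝ c)
  refine ⟨g, fun i => ?_⟩
  have h1 := LinearMap.congr_fun hg (Module.Basis.span h i)
  rw [Module.Basis.constr_basis] at h1
  rw [← h1]
  simp [Module.Basis.span_apply]

section fin
variable [FiniteDimensional ℝ E]

theorem rk_le {D : Set E} {W : Submodule ℝ (E × ℝ)} (h : ∀ x ∈ D, ell x ∈ W) :
    rk D ≤ Module.finrank ℝ W := by
  apply Submodule.finrank_mono
  rw [Submodule.span_le]
  rintro _ ⟨x, hx, rfl⟩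
  exact h x hx

theorem mem_span_ell {D : Set E} {x : E} (hx : x ∈ D) : ell x ∈ Submodule.span ℝ (ell '' D) :=
  Submodule.subset_span ⟨x, hx, rfl⟩

theorem rk_mono {D D' : Set E} (h : D ⊆ D') : rk D ≤ rk D' :=
  rk_le (fun _ hx => mem_span_ell (h hx))

theorem rk_empty : rk (∅ : Set E) = 0 := by
  simp [rk]

theorem span_eq_of_rk {D : Set E} {W : Submodule ℝ (E × ℝ)} (h : ∀ x ∈ D, ell x ∈ W)
    (h2 : Module.finrank ℝ W ≤ rk D) : Submodule.span ℝ (ell '' D) = W := by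
  apply Submodule.eq_of_le_of_finrank_le _ h2
  rw [Submodule.span_le]
  rintro _ ⟨x, hx, rfl⟩
  exact h x hx

/-- If the zero set has full rank, the functional vanishes on the set. -/
theorem zero_of_rk {X : Set E} {k : ℕ} (hX : rk X ≤ k) {f : (E × ℝ) →ₗ[ℝ] ℝ}
    (h : ¬ rk (X ∩ zs f) < k) : X ⊆ zs f := by
  have h1 : Submodule.span ℝ (ell '' (X ∩ zs f)) = Submodule.span ℝ (ell '' X) :=
    span_eq_of_rk (fun x hx => mem_span_ell hx.1) (hX.trans (not_lt.1 h))
  intro x hx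
  have h2 : ell x ∈ Submodule.span ℝ (ell '' (X ∩ zs f)) := h1 ▸ mem_span_ell hx
  have h3 : Submodule.span ℝ (ell '' (X ∩ zs f)) ≤ LinearMap.ker f := by
    rw [Submodule.span_le]
    rintro _ ⟨y, hy, rfl⟩
    exact hy.2
  exact h3 h2

theorem rk_range {ι : Type*} (v : ι → E) : rk (range v) = Set.finrank ℝ (range (fun i => ell (v i))) := by
  unfold rk Set.finrank
  rw [← range_comp]; rfl

theorem rk_hull {ι : Type*} (v : ι → E) : rk (hull v) = rk (range v) := by
  apply le_antisymm
  · exact rk_le (hull_lin (fun i => mem_span_ell ⟨i, rfl⟩))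
  · exact rk_mono (subset_convexHull ℝ _)

theorem rk_hull_of_li {ι : Type*} [Fintype ι] {v : ι → E} (h : LinearIndependent ℝ (fun i => ell (v i))) :
    rk (hull v) = Fintype.card ι := by
  rw [rk_hull, rk_range, linearIndependent_iff_card_eq_finrank_span.1 h]

theorem rk_range_le {ι : Type*} [Fintype ι] (v : ι → E) : rk (range v) ≤ Fintype.card ι := by
  rw [rk_range]; exact finrank_range_le_card _

theorem li_iff {ι : Type*} [Fintype ι] {v : ι → E} :
    LinearIndependent ℝ (fun i => ell (v i)) ↔ Fintype.card ι ≤ rk (range v) := by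
  rw [rk_range, linearIndependent_iff_card_le_finrank_span]

theorem mem_univ_map {ι : Type*} [Fintype ι] (v : ι → E) :
    {x | x ∈ (Finset.univ.val.map v)} = range v := by
  ext x; simp

theorem brf_deg {ι : Type*} [Fintype ι] {v : ι → E} (h : rk (range v) < Fintype.card ι) :
    brf v = 0 := by
  apply br_deg
  rw [mem_univ_map]
  simpa using h

theorem li_update {ι : Type*} [Fintype ι] {v : ι → E} (h : LinearIndependent ℝ (fun i => ell (v i)))
    {i j : ι} (hij : i ≠ j) {t : ℝ} (ht : t ≠ 0) :
    LinearIndependent ℝ (fun l => ell (Function.update v j ((1 - t) • v i + t • v j) l)) := by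
  rw [li_iff] at h ⊢
  refine h.trans (rk_le ?_)
  have hi : ell (v i) ∈ Submodule.span ℝ (ell '' (range (Function.update v j ((1 - t) • v i + t • v j)))) :=
    mem_span_ell ⟨i, by simp [hij]⟩
  have hp : ell ((1 - t) • v i + t • v j) ∈
      Submodule.span ℝ (ell '' (range (Function.update v j ((1 - t) • v i + t • v j)))) :=
    mem_span_ell ⟨j, by simp⟩
  rintro _ ⟨l, rfl⟩
  by_cases hl : l = j
  · subst hl
    have : ell (v l) = t⁻¹ • (ell ((1 - t) • v i + t • v l) - (1 - t) • ell (v i)) := by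
      rw [ell_comb (by ring), add_sub_cancel_left, smul_smul, inv_mul_cancel₀ ht, one_smul]
    rw [this]
    exact Submodule.smul_mem _ _ (Submodule.sub_mem _ hp (Submodule.smul_mem _ _ hi))
  · exact mem_span_ell ⟨l, by simp [hl]⟩

/-- Binary space partition trees with their values. -/
inductive Tree (k : ℕ) : Set E → Mon E → Prop
  | null (D : Set E) (h : rk D < k) : Tree k D 0
  | leaf (v : Fin k → E) : Tree k (hull v) (brf v)
  | node (D : Set E) (f : (E × ℝ) →ₗ[ℝ] ℝ) (m₁ m₂ : Mon E) (h : rk (D ∩ zs f) < k)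
      (h₁ : Tree k (D ∩ hs f) m₁) (h₂ : Tree k (D ∩ hs (-f)) m₂) : Tree k D (m₁ + m₂)

theorem null_val {k : ℕ} {D : Set E} {m : Mon E} (h : Tree k D m) (hD : rk D < k) : m = 0 := by
  induction h with
  | null D h => rfl
  | leaf v =>
    apply brf_deg
    rw [rk_hull] at hD
    simpa using hD
  | node D f m₁ m₂ h h₁ h₂ ih₁ ih₂ =>
    rw [ih₁ ((rk_mono inter_subset_left).trans_lt hD), ih₂ ((rk_mono inter_subset_left).trans_lt hD),
      add_zero]

theorem cone_zero {k : ℕ} {D : Set E} {m : Mon E} (h : Tree k D m) {W : Submodule ℝ (E × ℝ)} {a : E}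
    (hW : Module.finrank ℝ W ≤ k) (hD : ∀ x ∈ D, ell x ∈ W) (ha : ell a ∈ W) : cone a m = 0 := by
  induction h with
  | null D h => simp
  | leaf v =>
    unfold brf
    rw [cone_br]
    apply br_deg
    simp only [Multiset.card_cons, Multiset.card_map, Finset.card_val, Finset.card_univ, Fintype.card_fin]
    refine Nat.lt_succ_of_le ((rk_le ?_).trans hW)
    intro x hx
    simp only [Multiset.mem_cons, mem_ofPred_eq] at hx
    rcases hx with rfl | hx
    · exact ha
    · obtain ⟨i, _, rfl⟩ := Multiset.mem_map.1 hx
      exact hD _ (mem_hull_self v i)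
  | node D f m₁ m₂ h h₁ h₂ ih₁ ih₂ =>
    rw [map_add, ih₁ (fun x hx => hD x hx.1), ih₂ (fun x hx => hD x hx.1), add_zero]

theorem ex_node {k : ℕ} {X : Set E} (hX : rk X ≤ k) (f : (E × ℝ) →ₗ[ℝ] ℝ)
    (h₁ : ∃ m, Tree k (X ∩ hs f) m) (h₂ : ∃ m, Tree k (X ∩ hs (-f)) m) : ∃ m, Tree k X m := by
  by_cases h : rk (X ∩ zs f) < k
  · obtain ⟨m₁, h₁⟩ := h₁
    obtain ⟨m₂, h₂⟩ := h₂
    exact ⟨_, Tree.node X f m₁ m₂ h h₁ h₂⟩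
  · have := zero_of_rk hX h
    have e : X ∩ hs f = X := inter_eq_left.2 (fun x hx => (this hx).ge)
    rwa [e] at h₁

/-- Intersection of half spaces. -/
def hsL (L : Finset ((E × ℝ) →ₗ[ℝ] ℝ)) : Set E := {x | ∀ f ∈ L, 0 ≤ f (ell x)}

theorem hsL_insert (f : (E × ℝ) →ₗ[ℝ] ℝ) (L : Finset ((E × ℝ) →ₗ[ℝ] ℝ)) :
    hsL (insert f L) = hs f ∩ hsL L := by
  ext x; simp [hsL, hs]

theorem hsL_convex (L : Finset ((E × ℝ) →ₗ[ℝ] ℝ)) : Convex ℝ (hsL L) := by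
  intro x hx y hy a b ha hb hab f hf
  exact hs_convex f (hx f hf) (hy f hf) ha hb hab

theorem ex_tree (k : ℕ) (L : Finset ((E × ℝ) →ₗ[ℝ] ℝ)) : ∀ (ι : Type) [Fintype ι] (v : ι → E),
    LinearIndependent ℝ (fun i => ell (v i)) → rk (hull v ∩ hsL L) ≤ k →
    ∃ m, Tree k (hull v ∩ hsL L) m := by
  induction L using Finset.induction with
  | empty =>
    intro ι _ v hv hk
    have e : hull v ∩ hsL ∅ = hull v := by ext; simp [hsL]
    rw [e] at hk ⊢
    rw [rk_hull_of_li hv] at hk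
    rcases hk.lt_or_eq with h | h
    · exact ⟨0, Tree.null _ (by rwa [rk_hull_of_li hv])⟩
    · let e := Fintype.equivFinOfCardEq h
      have : hull v = hull (v ∘ e.symm) := by
        unfold hull
        rw [e.symm.surjective.range_comp]
      rw [this]
      exact ⟨_, Tree.leaf _⟩
  | insert f L hf ih =>
    intro ι _ v hv hk
    obtain ⟨c, hc⟩ : ∃ c, (Finset.univ.filter (fun i => f (ell (v i)) ≠ 0)).card ≤ c := ⟨_, le_rfl⟩
    induction c generalizing v with
    | zero =>
      have h0 : ∀ i, f (ell (v i)) = 0 := by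
        intro i
        by_contra h
        have : i ∈ Finset.univ.filter (fun i => f (ell (v i)) ≠ 0) := by simp [h]
        rw [Finset.card_eq_zero.1 (Nat.le_zero.1 hc)] at this
        simp at this
      have e : hull v ∩ hsL (insert f L) = hull v ∩ hsL L := by
        rw [hsL_insert, ← inter_assoc, inter_eq_left.2 (hull_subset_hs (fun i => (h0 i).ge))]
      rw [e] at hk ⊢
      exact ih ι v hv hk
    | succ c ihc =>
      by_cases hA : ∃ i j, f (ell (v i)) < 0 ∧ 0 < f (ell (v j))
      · obtain ⟨i, j, hi, hj⟩ := hA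
        have hij : i ≠ j := by rintro rfl; linarith
        obtain ⟨t, ht⟩ : ∃ t, t = (- f (ell (v i))) / (f (ell (v j)) - f (ell (v i))) := ⟨_, rfl⟩
        have hden : 0 < f (ell (v j)) - f (ell (v i)) := by linarith
        have ht0 : 0 < t := by rw [ht]; exact div_pos (by linarith) hden
        have ht1 : t < 1 := by rw [ht, div_lt_one hden]; linarith
        have hfp : f (ell ((1 - t) • v i + t • v j)) = 0 := by
          rw [ell_comb (by ring), map_add, map_smul, map_smul, smul_eq_mul, smul_eq_mul, ht]
          field_simp
          ring
        have hpc : (1 - t) • v i + t • v j = (1 - (1 - t)) • v j + (1 - t) • v i := by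
          rw [add_comm, sub_sub_cancel]
        obtain ⟨g, hg⟩ := exists_dual hv (fun l => if l = i then -t else if l = j then 1 - t else 0)
        have gi : g (ell (v i)) = -t := by simpa using hg i
        have gj : g (ell (v j)) = 1 - t := by simpa [hij.symm] using hg j
        have gl : ∀ l, l ≠ i → l ≠ j → g (ell (v l)) = 0 := by
          intro l h1 h2; simpa [h1, h2] using hg l
        have c1 := cut_hull v hij ht0 g gi gj ht1 gl
        have c2 := cut_hull v hij.symm (t := 1 - t) (by linarith) (-g) (by simp [gj])
          (by simp [gi]) (by linarith) (by intro l h1 h2; simp [gl l h2 h1])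
        rw [neg_neg, ← hpc] at c2
        have hcard : ∀ l, f (ell (v l)) ≠ 0 → (Finset.univ.filter (fun q => f (ell
            (Function.update v l ((1 - t) • v i + t • v j) q)) ≠ 0)).card ≤ c := by
          intro l hl
          have : (Finset.univ.filter (fun q => f (ell
            (Function.update v l ((1 - t) • v i + t • v j) q)) ≠ 0)) ⊆
            (Finset.univ.filter (fun q => f (ell (v q)) ≠ 0)).erase l := by
            intro q hq
            rw [Finset.mem_filter] at hq
            have hq2 := hq.2
            by_cases hql : q = l
            · subst hql
              rw [Function.update_self] at hq2
              exact absurd hfp hq2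
            · rw [Function.update_of_ne hql] at hq2
              simp [hql, hq2]
          refine (Finset.card_le_card this).trans ?_
          rw [Finset.card_erase_of_mem (by simp [hl])]
          omega
        have r1 : hull v ∩ hsL (insert f L) ∩ hs (-g) =
            hull (Function.update v j ((1 - t) • v i + t • v j)) ∩ hsL (insert f L) := by
          rw [← c1, inter_right_comm]
        have r2 : hull v ∩ hsL (insert f L) ∩ hs g =
            hull (Function.update v i ((1 - t) • v i + t • v j)) ∩ hsL (insert f L) := by
          rw [← c2, inter_right_comm]
        apply ex_node hk g
        · have hk2 : rk (hull v ∩ hsL (insert f L) ∩ hs g) ≤ k :=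
            (rk_mono inter_subset_left).trans hk
          rw [r2] at hk2 ⊢
          refine ihc _ ?_ hk2 (hcard i hi.ne)
          rw [hpc]
          exact li_update hv hij.symm (by linarith)
        · have hk2 : rk (hull v ∩ hsL (insert f L) ∩ hs (-g)) ≤ k :=
            (rk_mono inter_subset_left).trans hk
          rw [r1] at hk2 ⊢
          exact ihc _ (li_update hv hij ht0.ne') hk2 (hcard j hj.ne')
      · by_cases hB : ∀ i, 0 ≤ f (ell (v i))
        · have e : hull v ∩ hsL (insert f L) = hull v ∩ hsL L := by
            rw [hsL_insert, ← inter_assoc, inter_eq_left.2 (hull_subset_hs hB)]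
          rw [e] at hk ⊢
          exact ih ι v hv hk
        · have hneg : ∀ j, f (ell (v j)) ≤ 0 := by
            intro j
            by_contra hj
            apply hB
            intro i
            by_contra hi
            exact hA ⟨i, j, not_le.1 hi, not_le.1 hj⟩
          have e1 : hull v ∩ hs f = hull (fun q : {i // f (ell (v i)) = 0} => v q.1) := by
            apply Subset.antisymm
            · rintro x ⟨hx, hx2⟩
              rw [mem_hs] at hx2
              obtain ⟨w, hw, hxw⟩ := mem_hull.1 hx
              have h1 : ∀ i, w i * f (ell (v i)) ≤ 0 := fun i =>
                mul_nonpos_of_nonneg_of_nonpos (hw i) (hneg i)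
              have h2 : f (ell x) = ∑ i, w i * f (ell (v i)) := by
                rw [hxw, map_sum]; simp
              have h3 : ∑ i, w i * f (ell (v i)) = 0 :=
                le_antisymm (Finset.sum_nonpos fun i _ => h1 i) (h2 ▸ hx2)
              have h4 := (Finset.sum_eq_zero_iff_of_nonpos (fun i _ => h1 i)).1 h3
              refine mem_hull.2 ⟨fun q => w q.1, fun q => hw _, ?_⟩
              rw [hxw]
              rw [← Finset.sum_subtype (p := fun i => f (ell (v i)) = 0)
                (Finset.univ.filter (fun i => f (ell (v i)) = 0)) (by simp)
                (fun i => w i • ell (v i))]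
              · symm
                rw [Finset.sum_filter_of_ne]
                intro i hi hne
                by_contra hfi
                have := h4 i hi
                rw [mul_eq_zero, or_iff_left hfi] at this
                simp [this] at hne
            · apply subset_inter
              · exact convexHull_mono (by rintro _ ⟨q, rfl⟩; exact ⟨q.1, rfl⟩)
              · exact hull_subset_hs (fun q => q.2.ge)
          have e : hull v ∩ hsL (insert f L) =
              hull (fun q : {i // f (ell (v i)) = 0} => v q.1) ∩ hsL L := by
            rw [hsL_insert, ← inter_assoc, e1]
          rw [e] at hk ⊢
          exact ih _ _ (hv.comp _ Subtype.val_injective) hk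

end fin

/-- A convex set covered by finitely many subspaces lies in one of them. -/
theorem exists_avoid {ι : Type*} {C : Set E} (hC : Convex ℝ C) (hne : C.Nonempty) (s : Finset ι)
    (W : ι → Submodule ℝ (E × ℝ)) (h : ∀ i ∈ s, ∃ x ∈ C, ell x ∉ W i) :
    ∃ x ∈ C, ∀ i ∈ s, ell x ∉ W i := by
  induction s using Finset.induction with
  | empty => exact ⟨hne.some, hne.some_mem, by simp⟩
  | insert i s hi ih =>
    obtain ⟨x, hx, hxs⟩ := ih (fun j hj => h j (Finset.mem_insert_of_mem hj))
    obtain ⟨y, hy, hyi⟩ := h i (Finset.mem_insert_self _ _)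
    by_cases hxi : ell x ∈ W i
    · have hfin : (⋃ j ∈ s, {t : ℝ | (1 - t) • ell x + t • ell y ∈ W j}).Finite := by
        apply Set.Finite.biUnion s.finite_toSet
        intro j hj
        apply Set.Subsingleton.finite
        intro t ht t' ht'
        by_contra hne
        apply hxs j hj
        have h1 : (t' - t) • ell x = t' • ((1 - t) • ell x + t • ell y) - t • ((1 - t') • ell x + t' • ell y) := by
          module
        have h2 : (t' - t) • ell x ∈ W j := by
          rw [h1]; exact (W j).sub_mem ((W j).smul_mem _ ht) ((W j).smul_mem _ ht')
        exact ((W j).smul_mem_iff (sub_ne_zero.2 (Ne.symm hne))).1 h2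
      obtain ⟨t, ht, htn⟩ := (Set.Ioo_infinite (zero_lt_one (α := ℝ))).exists_notMem_finite hfin
      refine ⟨(1 - t) • x + t • y, hC hx hy (by linarith [ht.2]) ht.1.le (by ring), ?_⟩
      intro j hj
      rw [ell_comb (by ring)]
      rcases Finset.mem_insert.1 hj with rfl | hj
      · intro hmem
        apply hyi
        have := (W j).sub_mem hmem ((W j).smul_mem (1 - t) hxi)
        rw [add_sub_cancel_left] at this
        exact ((W j).smul_mem_iff ht.1.ne').1 this
      · intro hmem
        apply htn
        simp only [mem_iUnion]
        exact ⟨j, hj, hmem⟩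
    · refine ⟨x, hx, ?_⟩
      intro j hj
      rcases Finset.mem_insert.1 hj with rfl | hj
      · exact hxi
      · exact hxs j hj

end TriEq

namespace TriEq

set_option linter.unusedSectionVars false

variable {E : Type*} [AddCommGroup E] [Module ℝ E] [FiniteDimensional ℝ E]

/-- Simplices cut by finitely many half spaces. -/
def Pol (D : Set E) : Prop := ∃ (ι : Type) (_ : Fintype ι) (v : ι → E)
  (L : Finset ((E × ℝ) →ₗ[ℝ] ℝ)), LinearIndependent ℝ (fun i => ell (v i)) ∧ D = hull v ∩ hsL L

theorem Pol.inter_hs {D : Set E} (h : Pol D) (f : (E × ℝ) →ₗ[ℝ] ℝ) : Pol (D ∩ hs f) := by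
  obtain ⟨ι, i, v, L, hv, rfl⟩ := h
  exact ⟨ι, i, v, insert f L, hv, by rw [hsL_insert, inter_assoc, inter_comm (hsL L)]⟩

theorem Pol.inter_zs {D : Set E} (h : Pol D) (f : (E × ℝ) →ₗ[ℝ] ℝ) : Pol (D ∩ zs f) := by
  rw [← hs_inter_neg, ← inter_assoc]
  exact (h.inter_hs f).inter_hs (-f)

theorem Pol.convex {D : Set E} (h : Pol D) : Convex ℝ D := by
  obtain ⟨ι, i, v, L, hv, rfl⟩ := h
  exact (hull_convex v).inter (hsL_convex L)

theorem Pol.ex_tree {D : Set E} (h : Pol D) {k : ℕ} (hk : rk D ≤ k) : ∃ m, Tree k D m := by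
  obtain ⟨ι, i, v, L, hv, rfl⟩ := h
  exact TriEq.ex_tree k L ι v hv hk

/-- Uniqueness of tree values in rank `k`. -/
def Uq (E : Type*) [AddCommGroup E] [Module ℝ E] (k : ℕ) : Prop :=
  ∀ (D : Set E) (m m' : Mon E), Pol D → rk D ≤ k → Tree k D m → Tree k D m' → m = m'

/-- The class of a set. -/
def cls (k : ℕ) (X : Set E) : Mon E := if h : ∃ m, Tree k X m then h.choose else 0

theorem cls_tree {k : ℕ} {X : Set E} (hP : Pol X) (hk : rk X ≤ k) : Tree k X (cls k X) := by
  have h := hP.ex_tree hk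
  unfold cls
  rw [dif_pos h]
  exact h.choose_spec

theorem cls_eq {k : ℕ} (U : Uq E k) {X : Set E} (hP : Pol X) (hk : rk X ≤ k) {m : Mon E}
    (h : Tree k X m) : cls k X = m :=
  U X _ _ hP hk (cls_tree hP hk) h

theorem cls_null {k : ℕ} {X : Set E} (hk : rk X < k) : cls k X = 0 := by
  have h : ∃ m, Tree k X m := ⟨0, Tree.null X hk⟩
  unfold cls
  rw [dif_pos h]
  exact null_val h.choose_spec hk

theorem cls_add {k : ℕ} (U : Uq E k) {X : Set E} (hP : Pol X) (hk : rk X ≤ k)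
    (f : (E × ℝ) →ₗ[ℝ] ℝ) (h : rk (X ∩ zs f) < k) :
    cls k X = cls k (X ∩ hs f) + cls k (X ∩ hs (-f)) :=
  cls_eq U hP hk (Tree.node X f _ _ h
    (cls_tree (hP.inter_hs f) ((rk_mono inter_subset_left).trans hk))
    (cls_tree (hP.inter_hs (-f)) ((rk_mono inter_subset_left).trans hk)))

theorem tree_zero {D : Set E} {m : Mon E} (h : Tree 0 D m) : m = brf (Fin.elim0 : Fin 0 → E) := by
  cases h with
  | null D h => exact absurd h (Nat.not_lt_zero _)
  | leaf v => rw [Subsingleton.elim v Fin.elim0]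
  | node D f m₁ m₂ h h₁ h₂ => exact absurd h (Nat.not_lt_zero _)

theorem uq_zero : Uq E 0 := fun _ _ _ _ _ h h' => (tree_zero h).trans (tree_zero h').symm

/-- Points whose lift lies in a subspace. -/
def pre (Hp : Submodule ℝ (E × ℝ)) : Set E := {x | ell x ∈ Hp}

/-- Supporting hyperplane, with `a` on a prescribed side. -/
def sd (W : Submodule ℝ (E × ℝ)) (a : E) (σ : ℝ) (D : Set E) (Hp : Submodule ℝ (E × ℝ)) : Prop :=
  ∃ f : (E × ℝ) →ₗ[ℝ] ℝ, Hp = W ⊓ LinearMap.ker f ∧ 0 < σ * f (ell a) ∧ D ⊆ hs f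

/-- The cone over a supported face. -/
def term (k : ℕ) (W : Submodule ℝ (E × ℝ)) (a : E) (σ : ℝ) (D : Set E) (Hp : Submodule ℝ (E × ℝ)) :
    Mon E :=
  if sd W a σ D Hp then cone a (cls k (D ∩ pre Hp)) else 0

theorem sd.mono {W : Submodule ℝ (E × ℝ)} {a : E} {σ : ℝ} {D D' : Set E} {Hp : Submodule ℝ (E × ℝ)}
    (h : sd W a σ D Hp) (hD : D' ⊆ D) : sd W a σ D' Hp := by
  obtain ⟨f, h1, h2, h3⟩ := h
  exact ⟨f, h1, h2, hD.trans h3⟩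

theorem inter_pre {W : Submodule ℝ (E × ℝ)} {D : Set E} (hD : ∀ x ∈ D, ell x ∈ W)
    (f : (E × ℝ) →ₗ[ℝ] ℝ) : D ∩ pre (W ⊓ LinearMap.ker f) = D ∩ zs f := by
  ext x
  simp only [pre, zs, mem_inter_iff, mem_ofPred_eq, Submodule.mem_inf, LinearMap.mem_ker]
  constructor
  · rintro ⟨h1, h2, h3⟩; exact ⟨h1, h3⟩
  · rintro ⟨h1, h3⟩; exact ⟨h1, hD x h1, h3⟩

theorem rk_pre_le {D : Set E} {Hp : Submodule ℝ (E × ℝ)} : rk (D ∩ pre Hp) ≤ Module.finrank ℝ Hp :=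
  rk_le (fun _ hx => hx.2)

theorem term_zero {k : ℕ} {W : Submodule ℝ (E × ℝ)} {a : E} {σ : ℝ} {D : Set E}
    {Hp : Submodule ℝ (E × ℝ)} (h : rk (D ∩ pre Hp) < k) : term k W a σ D Hp = 0 := by
  unfold term
  rw [cls_null h]; simp

theorem term_not {k : ℕ} {W : Submodule ℝ (E × ℝ)} {a : E} {σ : ℝ} {D : Set E}
    {Hp : Submodule ℝ (E × ℝ)} (h : ¬ sd W a σ D Hp) : term k W a σ D Hp = 0 := if_neg h

theorem term_pos {k : ℕ} {W : Submodule ℝ (E × ℝ)} {a : E} {σ : ℝ} {D : Set E}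
    {Hp : Submodule ℝ (E × ℝ)} (h : sd W a σ D Hp) :
    term k W a σ D Hp = cone a (cls k (D ∩ pre Hp)) := if_pos h

section step

variable {k : ℕ} {W : Submodule ℝ (E × ℝ)} {a : E}

theorem sd.notMem {σ : ℝ} {D : Set E} {Hp : Submodule ℝ (E × ℝ)} (h : sd W a σ D Hp) :
    ell a ∉ Hp := by
  obtain ⟨f, h1, h2, h3⟩ := h
  rw [h1]
  intro h
  rw [LinearMap.mem_ker.1 h.2, mul_zero] at h2
  exact h2.false

theorem sd.finrank (hW : Module.finrank ℝ W ≤ k + 1) (ha : ell a ∈ W) {σ : ℝ} {D : Set E}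
    {Hp : Submodule ℝ (E × ℝ)} (h : sd W a σ D Hp) : Module.finrank ℝ Hp ≤ k := by
  have h0 := h.notMem
  obtain ⟨f, h1, h2, h3⟩ := h
  have : Hp < W := lt_of_le_of_ne (h1 ▸ inf_le_left) (by rintro rfl; exact h0 ha)
  have := Submodule.finrank_lt_finrank_of_lt this
  omega

theorem sd_swap {σ : ℝ} {D : Set E} {Hp : Submodule ℝ (E × ℝ)} (hD : ∀ x ∈ D, ell x ∈ W)
    (hk : rk D ≤ k) (hr : ¬ rk (D ∩ pre Hp) < k) (h : sd W a σ D Hp) : sd W a (-σ) D Hp := by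
  obtain ⟨f, h1, h2, h3⟩ := h
  subst h1
  rw [inter_pre hD] at hr
  have h4 := zero_of_rk hk hr
  refine ⟨-f, ?_, by simpa using h2, ?_⟩
  · congr 1; ext x; simp
  · intro x hx; rw [mem_hs_neg]; exact (h4 hx).le

theorem term_null {D : Set E} (hD : ∀ x ∈ D, ell x ∈ W) (hk : rk D ≤ k)
    (Hp : Submodule ℝ (E × ℝ)) : term k W a (-1) D Hp = term k W a 1 D Hp := by
  by_cases hr : rk (D ∩ pre Hp) < k
  · rw [term_zero hr, term_zero hr]
  · have : sd W a (-1) D Hp ↔ sd W a 1 D Hp :=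
      ⟨fun h => by simpa using sd_swap hD hk hr h, fun h => sd_swap hD hk hr h⟩
    unfold term
    rw [this]

theorem face_eq {ι : Type*} [Fintype ι] {v : ι → E} {f : (E × ℝ) →ₗ[ℝ] ℝ}
    (hpos : ∀ j, 0 ≤ f (ell (v j))) {x : E} {w : ι → ℝ} (hw : ∀ i, 0 ≤ w i)
    (hxw : ell x = ∑ i, w i • ell (v i)) (hx : f (ell x) = 0) :
    ∀ i, f (ell (v i)) ≠ 0 → w i = 0 := by
  have h1 : ∀ i, 0 ≤ w i * f (ell (v i)) := fun i => mul_nonneg (hw i) (hpos i)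
  have h2 : ∑ i, w i * f (ell (v i)) = 0 := by
    rw [← hx, hxw, map_sum]; simp
  have h4 := (Finset.sum_eq_zero_iff_of_nonneg (fun i _ => h1 i)).1 h2
  intro i hi
  have := h4 i (Finset.mem_univ i)
  rwa [mul_eq_zero, or_iff_left hi] at this

theorem map_erase_succAbove (v : Fin (k + 1) → E) (i : Fin (k + 1)) :
    (Finset.univ.erase i).val.map v = Finset.univ.val.map (fun j => v (i.succAbove j)) := by
  have : (Finset.univ.erase i : Finset (Fin (k + 1))) = Finset.univ.map (Fin.succAboveEmb i) := by
    ext j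
    simp only [Finset.mem_erase, Finset.mem_univ, and_true, Finset.mem_map, true_and,
      Fin.coe_succAboveEmb]
    constructor
    · intro h; exact Fin.exists_succAbove_eq h
    · rintro ⟨l, rfl⟩; exact Fin.succAbove_ne i l
  rw [this, Finset.map_val, Multiset.map_map]
  rfl

theorem face_hull {v : Fin (k + 1) → E} {f : (E × ℝ) →ₗ[ℝ] ℝ} (i : Fin (k + 1))
    (hi : 0 < f (ell (v i))) (hj : ∀ j, j ≠ i → f (ell (v j)) = 0) :
    hull v ∩ zs f = hull (fun j => v (i.succAbove j)) := by
  apply Subset.antisymm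
  · rintro x ⟨hx, hx0⟩
    obtain ⟨w, hw, hxw⟩ := mem_hull.1 hx
    have hpos : ∀ j, 0 ≤ f (ell (v j)) := by
      intro j
      by_cases h : j = i
      · subst h; exact hi.le
      · exact (hj j h).ge
    have h0 := face_eq hpos hw hxw hx0 i hi.ne'
    refine mem_hull.2 ⟨fun j => w (i.succAbove j), fun j => hw _, ?_⟩
    rw [hxw, Fin.sum_univ_succAbove _ i, h0, zero_smul, zero_add]
  · apply subset_inter
    · exact convexHull_mono (by rintro _ ⟨q, rfl⟩; exact ⟨_, rfl⟩)
    · have : ∀ x ∈ hull (fun j => v (i.succAbove j)), ell x ∈ LinearMap.ker f :=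
        hull_lin (fun j => hj _ (Fin.succAbove_ne i j))
      exact this

/-- The visibility identity. -/
def Vis (k : ℕ) (W : Submodule ℝ (E × ℝ)) (a : E) (D : Set E) (m : Mon E) : Prop :=
  ∀ᶠ F : Finset (Submodule ℝ (E × ℝ)) in Filter.atTop,
    m + ∑ Hp ∈ F, term k W a (-1) D Hp = ∑ Hp ∈ F, term k W a 1 D Hp

theorem vis_null {D : Set E} (hD : ∀ x ∈ D, ell x ∈ W) (hk : rk D ≤ k) : Vis k W a D 0 := by
  apply Filter.Eventually.of_forall
  intro F
  rw [zero_add]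
  exact Finset.sum_congr rfl (fun Hp _ => term_null hD hk Hp)

theorem vis_leaf (U : Uq E k) (hW : Module.finrank ℝ W ≤ k + 1) (ha : ell a ∈ W)
    (v : Fin (k + 1) → E) (hD : ∀ x ∈ hull v, ell x ∈ W) : Vis k W a (hull v) (brf v) := by
  by_cases hr : rk (range v) ≤ k
  · rw [brf_deg (by simpa using Nat.lt_succ_of_le hr)]
    exact vis_null hD (by rwa [rk_hull])
  have hv : LinearIndependent ℝ (fun i => ell (v i)) := by
    rw [li_iff]; simp; omega
  have hsp : Submodule.span ℝ (range (fun i => ell (v i))) = W := by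
    have := span_eq_of_rk hD (by rw [rk_hull]; omega)
    rw [← this]
    apply le_antisymm
    · rw [Submodule.span_le]
      rintro _ ⟨i, rfl⟩
      exact mem_span_ell (mem_hull_self v i)
    · rw [Submodule.span_le]
      rintro _ ⟨x, hx, rfl⟩
      exact hull_lin (fun i => Submodule.subset_span (mem_range_self i)) x hx
  have hrep : ∀ x ∈ W, ∃ c : Fin (k + 1) → ℝ, ∑ i, c i • ell (v i) = x := by
    intro x hx
    rw [← hsp] at hx
    exact (Submodule.mem_span_range_iff_exists_fun ℝ).1 hx
  obtain ⟨lam, hlam⟩ := hrep _ ha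
  choose f hf using fun i : Fin (k + 1) => exists_dual hv (fun j => if j = i then (1 : ℝ) else 0)
  have hfc : ∀ i (c : Fin (k + 1) → ℝ), f i (∑ j, c j • ell (v j)) = c i := by
    intro i c
    rw [map_sum]
    simp [hf]
  have hfa : ∀ i, f i (ell a) = lam i := fun i => by rw [← hlam, hfc]
  have hfi : ∀ i, f i (ell (v i)) = 1 := fun i => by simp [hf]
  have hfj : ∀ i j, j ≠ i → f i (ell (v j)) = 0 := fun i j h => by simp [hf, h]
  have hvW : ∀ i, ell (v i) ∈ W := fun i => hD _ (mem_hull_self v i)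
  let Q : Fin (k + 1) → Submodule ℝ (E × ℝ) := fun i => W ⊓ LinearMap.ker (f i)
  have hQ : ∀ i j, j ≠ i → ell (v j) ∈ Q i := fun i j h => ⟨hvW j, hfj i j h⟩
  have hQinj : Function.Injective Q := by
    intro i j hij
    by_contra hne
    have h1 := hQ j i hne
    rw [← hij] at h1
    have : f i (ell (v i)) = 0 := h1.2
    rw [hfi] at this
    exact one_ne_zero this
  have hsd : ∀ σ i, sd W a σ (hull v) (Q i) ↔ 0 < σ * lam i := by
    intro σ i
    constructor
    · rintro ⟨g, h1, h2, h3⟩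
      have hg0 : ∀ j, j ≠ i → g (ell (v j)) = 0 := by
        intro j hj
        have := hQ i j hj
        rw [h1] at this
        exact this.2
      have hga : g (ell a) = lam i * g (ell (v i)) := by
        rw [← hlam, map_sum, Finset.sum_eq_single i]
        · simp
        · intro j _ hj; simp [hg0 j hj]
        · simp
      rw [hga, ← mul_assoc] at h2
      exact pos_of_mul_pos_left h2 (h3 (mem_hull_self v i))
    · intro h
      refine ⟨f i, rfl, by rwa [hfa], hull_subset_hs ?_⟩
      intro j
      by_cases hj : j = i
      · subst hj; rw [hfi]; exact zero_le_one
      · rw [hfj i j hj]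
  have hterm : ∀ σ i, term k W a σ (hull v) (Q i) =
      if 0 < σ * lam i then brf (Function.update v i a) else 0 := by
    intro σ i
    unfold term
    rw [hsd]
    congr 1
    have e : hull v ∩ pre (Q i) = hull (fun j => v (i.succAbove j)) := by
      show hull v ∩ pre (W ⊓ LinearMap.ker (f i)) = _
      rw [inter_pre hD, face_hull i (by rw [hfi]; exact one_pos) (hfj i)]
    have hli : LinearIndependent ℝ (fun j => ell (v (i.succAbove j))) :=
      hv.comp _ Fin.succAbove_right_injective
    have hP : Pol (hull (fun j => v (i.succAbove j))) :=
      ⟨Fin k, inferInstance, _, ∅, hli, by ext; simp [hsL]⟩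
    rw [e, cls_eq U hP (by rw [rk_hull_of_li hli]; simp) (Tree.leaf _)]
    unfold brf
    rw [cone_br, ← map_erase_succAbove]
    congr 1
    convert (univ_map_update v i a).symm
  have hother : ∀ σ Hp, Hp ∉ Finset.univ.image Q → term k W a σ (hull v) Hp = 0 := by
    intro σ Hp hHp
    by_cases hs : sd W a σ (hull v) Hp
    swap
    · exact term_not hs
    apply term_zero
    obtain ⟨g, h1, h2, h3⟩ := hs
    have hpos : ∀ j, 0 ≤ g (ell (v j)) := fun j => h3 (mem_hull_self v j)
    by_contra hlt
    have hle : rk (hull v ∩ pre Hp) ≤ (Finset.univ.filter (fun j => g (ell (v j)) = 0)).card := by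
      rw [h1, inter_pre hD]
      have h5 : rk (hull v ∩ zs g) ≤ Module.finrank ℝ (Submodule.span ℝ
          (((Finset.univ.filter (fun j => g (ell (v j)) = 0)).image (fun j => ell (v j)) :
            Finset (E × ℝ)) : Set (E × ℝ))) := by
        apply rk_le
        rintro x ⟨hx, hx0⟩
        obtain ⟨w, hw, hxw⟩ := mem_hull.1 hx
        rw [hxw]
        apply Submodule.sum_mem
        intro j _
        by_cases hj : g (ell (v j)) = 0
        · apply Submodule.smul_mem
          apply Submodule.subset_span
          simp only [Finset.coe_image]
          exact ⟨j, by simp [hj], rfl⟩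
        · rw [face_eq hpos hw hxw hx0 j hj, zero_smul]
          exact Submodule.zero_mem _
      exact h5.trans ((finrank_span_finset_le_card _).trans Finset.card_image_le)
    have hcard := Finset.card_filter_add_card_filter_not (s := (Finset.univ : Finset (Fin (k + 1))))
      (fun j => g (ell (v j)) = 0)
    rw [Finset.card_univ, Fintype.card_fin] at hcard
    have h1' : (Finset.univ.filter (fun j => ¬ g (ell (v j)) = 0)).card ≤ 1 := by omega
    obtain ⟨i, hi⟩ : ∃ i, g (ell (v i)) ≠ 0 := by
      by_contra hcon
      push Not at hcon
      have : g (ell a) = 0 := by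
        rw [← hlam, map_sum]; simp [hcon]
      rw [this, mul_zero] at h2
      exact h2.false
    have hg0 : ∀ j, j ≠ i → g (ell (v j)) = 0 := by
      intro j hj
      by_contra hne
      exact hj (Finset.card_le_one.1 h1' j (by simp [hne]) i (by simp [hi]))
    apply hHp
    rw [Finset.mem_image]
    refine ⟨i, Finset.mem_univ i, ?_⟩
    rw [h1]
    have hgc : ∀ x ∈ W, g x = f i x * g (ell (v i)) := by
      intro x hx
      obtain ⟨c, rfl⟩ := hrep x hx
      rw [hfc, map_sum, Finset.sum_eq_single i]
      · simp
      · intro j _ hj; simp [hg0 j hj]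
      · simp
    ext x
    simp only [Q, Submodule.mem_inf, LinearMap.mem_ker]
    constructor
    · rintro ⟨hx, h⟩; exact ⟨hx, by rw [hgc x hx, h, zero_mul]⟩
    · rintro ⟨hx, h⟩
      refine ⟨hx, ?_⟩
      rw [hgc x hx] at h
      exact (mul_eq_zero.1 h).resolve_right hi
  unfold Vis
  filter_upwards [Filter.eventually_ge_atTop (Finset.univ.image Q)] with F hF
  have hsum : ∀ σ, ∑ Hp ∈ F, term k W a σ (hull v) Hp =
      ∑ i, if 0 < σ * lam i then brf (Function.update v i a) else 0 := by
    intro σ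
    rw [← Finset.sum_subset hF (fun Hp _ h => hother σ Hp h),
      Finset.sum_image (fun i _ j _ h => hQinj h)]
    exact Finset.sum_congr rfl (fun i _ => hterm σ i)
  rw [hsum, hsum]
  obtain ⟨hl1, hl2⟩ := of_ell_sum hlam.symm
  have := flip _ v lam a le_rfl hl1 hl2
  simp only [neg_mul, one_mul, Left.neg_pos_iff]
  convert this

end step

end TriEq

namespace TriEq

set_option linter.unusedSectionVars false

variable {E : Type*} [AddCommGroup E] [Module ℝ E] [FiniteDimensional ℝ E]
variable {k : ℕ} {W : Submodule ℝ (E × ℝ)} {a : E}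

theorem sd_extend {σ : ℝ} {D : Set E} {Hp : Submodule ℝ (E × ℝ)} (hC : Convex ℝ D)
    {f : (E × ℝ) →ₗ[ℝ] ℝ} {y : E} (hy : y ∈ D) (hyH : ell y ∈ Hp) (hfy : 0 < f (ell y))
    (h : sd W a σ (D ∩ hs f) Hp) : sd W a σ D Hp := by
  obtain ⟨g, h1, h2, h3⟩ := h
  refine ⟨g, h1, h2, ?_⟩
  have hgy : g (ell y) = 0 := by rw [h1] at hyH; exact hyH.2
  intro x hx
  by_cases hfx : 0 ≤ f (ell x)
  · exact h3 ⟨hx, hfx⟩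
  push Not at hfx
  have hden : 0 < f (ell y) - f (ell x) := by linarith
  obtain ⟨t, ht⟩ : ∃ t, t = f (ell y) / (f (ell y) - f (ell x)) := ⟨_, rfl⟩
  have ht0 : 0 < t := by rw [ht]; exact div_pos hfy hden
  have ht1 : t < 1 := by rw [ht, div_lt_one hden]; linarith
  have hz : (1 - t) • y + t • x ∈ D := hC hy hx (by linarith) ht0.le (by ring)
  have hfz : f (ell ((1 - t) • y + t • x)) = 0 := by
    rw [ell_comb (by ring), map_add, map_smul, map_smul, smul_eq_mul, smul_eq_mul, ht]
    field_simp
    ring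
  have hgz := h3 ⟨hz, hfz.ge⟩
  rw [mem_hs, ell_comb (by ring), map_add, map_smul, map_smul, smul_eq_mul, smul_eq_mul, hgy,
    mul_zero, zero_add] at hgz
  exact nonneg_of_mul_nonneg_right hgz ht0

theorem finrank_inf_ker (hW : Module.finrank ℝ W ≤ k + 1) (ha : ell a ∈ W) {σ : ℝ} {D : Set E}
    {Hp : Submodule ℝ (E × ℝ)} (h : sd W a σ D Hp) {f : (E × ℝ) →ₗ[ℝ] ℝ} {x : E × ℝ} (hx : x ∈ W)
    (hfx : f x ≠ 0) (hne : Hp ≠ W ⊓ LinearMap.ker f) :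
    Module.finrank ℝ (Hp ⊓ LinearMap.ker f : Submodule ℝ (E × ℝ)) < k := by
  have hk := h.finrank hW ha
  refine lt_of_lt_of_le (Submodule.finrank_lt_finrank_of_lt ?_) hk
  refine lt_of_le_of_ne inf_le_left ?_
  intro heq
  apply hne
  obtain ⟨g, h1, h2, h3⟩ := h
  have hle : Hp ≤ LinearMap.ker f := inf_eq_left.1 heq
  subst h1
  have hga : g (ell a) ≠ 0 := by
    intro h0; rw [h0, mul_zero] at h2; exact h2.false
  -- every `z ∈ W` satisfies `f z * g a = g z * f a`
  have key : ∀ z ∈ W, f z * g (ell a) = g z * f (ell a) := by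
    intro z hz
    have hm : z - (g z / g (ell a)) • ell a ∈ W ⊓ LinearMap.ker g := by
      refine ⟨W.sub_mem hz (W.smul_mem _ ha), ?_⟩
      show g _ = 0
      rw [map_sub, map_smul, smul_eq_mul, div_mul_cancel₀ _ hga, sub_self]
    have h5 : f (z - (g z / g (ell a)) • ell a) = 0 := hle hm
    rw [map_sub, map_smul, smul_eq_mul, sub_eq_zero] at h5
    rw [h5]
    field_simp
  have hfa : f (ell a) ≠ 0 := by
    intro h0
    have := key x hx
    rw [h0, mul_zero] at this
    exact (mul_ne_zero hfx hga) this
  apply le_antisymm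
  · exact le_inf inf_le_left hle
  · rintro z ⟨hz, hz0⟩
    refine ⟨hz, ?_⟩
    have := key z hz
    rw [show f z = 0 from hz0, zero_mul] at this
    exact (mul_eq_zero.1 this.symm).resolve_right hfa

theorem term_split_aux (hW : Module.finrank ℝ W ≤ k + 1) (ha : ell a ∈ W) {D : Set E} (hP : Pol D)
    {f : (E × ℝ) →ₗ[ℝ] ℝ} {x : E × ℝ} (hx : x ∈ W)
    (hfx : f x ≠ 0) {Hp : Submodule ℝ (E × ℝ)} (hne : Hp ≠ W ⊓ LinearMap.ker f) (σ : ℝ)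
    (hs0 : ¬ sd W a σ D Hp) : term k W a σ (D ∩ hs f) Hp = 0 := by
  by_cases h1 : sd W a σ (D ∩ hs f) Hp
  swap
  · exact term_not h1
  apply term_zero
  refine (rk_le ?_).trans_lt (finrank_inf_ker hW ha h1 hx hfx hne)
  rintro y ⟨⟨hy, hfy⟩, hyH⟩
  refine ⟨hyH, ?_⟩
  by_contra h0
  exact hs0 (sd_extend hP.convex hy hyH (lt_of_le_of_ne hfy (Ne.symm h0)) h1)

theorem term_split (U : Uq E k) (hW : Module.finrank ℝ W ≤ k + 1) (ha : ell a ∈ W) {D : Set E}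
    (hP : Pol D) (hD : ∀ x ∈ D, ell x ∈ W) {f : (E × ℝ) →ₗ[ℝ] ℝ} {x : E × ℝ} (hx : x ∈ W)
    (hfx : f x ≠ 0) {Hp : Submodule ℝ (E × ℝ)} (hne : Hp ≠ W ⊓ LinearMap.ker f) (σ : ℝ) :
    term k W a σ D Hp = term k W a σ (D ∩ hs f) Hp + term k W a σ (D ∩ hs (-f)) Hp := by
  have hker : LinearMap.ker (-f) = LinearMap.ker f := by ext; simp
  by_cases hs0 : sd W a σ D Hp
  · rw [term_pos hs0, term_pos (hs0.mono inter_subset_left), term_pos (hs0.mono inter_subset_left),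
      ← map_add]
    congr 1
    have hPH : Pol (D ∩ pre Hp) := by
      obtain ⟨g, h1, h2, h3⟩ := hs0
      rw [h1, inter_pre hD]
      exact hP.inter_zs g
    have hrk : rk (D ∩ pre Hp) ≤ k := rk_pre_le.trans (hs0.finrank hW ha)
    rw [inter_right_comm D (hs f), inter_right_comm D (hs (-f))]
    apply cls_add U hPH hrk
    exact (rk_le (W := Hp ⊓ LinearMap.ker f) (fun z hz => ⟨hz.1.2, hz.2⟩)).trans_lt (finrank_inf_ker hW ha hs0 hx hfx hne)
  · rw [term_not hs0, term_split_aux hW ha hP hx hfx hne σ hs0,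
      term_split_aux hW ha hP hx (f := -f) (by simpa using hfx) (by rwa [hker]) σ hs0, add_zero]

theorem vis_node (U : Uq E k) (hW : Module.finrank ℝ W ≤ k + 1) (ha : ell a ∈ W) {D : Set E}
    (hP : Pol D) (hD : ∀ x ∈ D, ell x ∈ W) {f : (E × ℝ) →ₗ[ℝ] ℝ} (hfa : 0 ≤ f (ell a))
    (hr : rk (D ∩ zs f) < k + 1) {m₁ m₂ : Mon E} (t₁ : Tree (k + 1) (D ∩ hs f) m₁)
    (t₂ : Tree (k + 1) (D ∩ hs (-f)) m₂) (h₁ : Vis k W a (D ∩ hs f) m₁)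
    (h₂ : Vis k W a (D ∩ hs (-f)) m₂) : Vis k W a D (m₁ + m₂) := by
  by_cases hD1 : D ⊆ hs f
  · have e1 : D ∩ hs f = D := inter_eq_left.2 hD1
    have e2 : D ∩ hs (-f) = D ∩ zs f := by rw [← hs_inter_neg, ← inter_assoc, e1]
    rw [e2] at t₂
    rw [null_val t₂ hr, add_zero]
    rwa [e1] at h₁
  by_cases hD2 : D ⊆ hs (-f)
  · have e1 : D ∩ hs (-f) = D := inter_eq_left.2 hD2
    have e2 : D ∩ hs f = D ∩ zs f := by rw [← hs_inter_neg, inter_comm (hs f), ← inter_assoc, e1]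
    rw [e2] at t₁
    rw [null_val t₁ hr, zero_add]
    rwa [e1] at h₂
  obtain ⟨xm, hxm, hxm0⟩ := not_subset.1 hD1
  obtain ⟨xp, hxp, hxp0⟩ := not_subset.1 hD2
  rw [mem_hs, not_le] at hxm0
  rw [mem_hs_neg, not_le] at hxp0
  have hsp : ∀ σ Hp, Hp ≠ W ⊓ LinearMap.ker f →
      term k W a σ D Hp = term k W a σ (D ∩ hs f) Hp + term k W a σ (D ∩ hs (-f)) Hp :=
    fun σ Hp hne => term_split U hW ha hP hD (hD xp hxp) hxp0.ne' hne σ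
  unfold Vis at *
  filter_upwards [h₁, h₂, Filter.eventually_ge_atTop {W ⊓ LinearMap.ker f}] with F e₁ e₂ hF
  have hG : W ⊓ LinearMap.ker f ∈ F := hF (Finset.mem_singleton_self _)
  have hsum : ∀ σ, ∑ Hp ∈ F.erase (W ⊓ LinearMap.ker f), term k W a σ D Hp =
      ∑ Hp ∈ F.erase (W ⊓ LinearMap.ker f), term k W a σ (D ∩ hs f) Hp +
      ∑ Hp ∈ F.erase (W ⊓ LinearMap.ker f), term k W a σ (D ∩ hs (-f)) Hp := by
    intro σ
    rw [← Finset.sum_add_distrib]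
    exact Finset.sum_congr rfl (fun Hp h => hsp σ Hp (Finset.ne_of_mem_erase h))
  simp only [← Finset.add_sum_erase F _ hG] at e₁ e₂ ⊢
  rw [hsum, hsum]
  rcases hfa.eq_or_lt with h0 | hpos
  · have hz : ∀ σ X, term k W a σ X (W ⊓ LinearMap.ker f) = 0 := by
      intro σ X
      apply term_not
      intro h
      exact h.notMem ⟨ha, h0.symm⟩
    simp only [hz, zero_add] at e₁ e₂ ⊢
    rw [← e₁, ← e₂]
    abel
  · have hcol : ∀ g : (E × ℝ) →ₗ[ℝ] ℝ, W ⊓ LinearMap.ker f = W ⊓ LinearMap.ker g → ∀ x ∈ D,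
        g (ell x) = f (ell x) / f (ell a) * g (ell a) := by
      intro g hg x hx
      have hm : ell x - (f (ell x) / f (ell a)) • ell a ∈ W ⊓ LinearMap.ker f := by
        refine ⟨W.sub_mem (hD x hx) (W.smul_mem _ ha), ?_⟩
        show f _ = 0
        rw [map_sub, map_smul, smul_eq_mul, div_mul_cancel₀ _ hpos.ne', sub_self]
      rw [hg] at hm
      have h5 : g (ell x - (f (ell x) / f (ell a)) • ell a) = 0 := hm.2
      rw [map_sub, map_smul, smul_eq_mul, sub_eq_zero] at h5
      exact h5
    have s1 : sd W a 1 (D ∩ hs f) (W ⊓ LinearMap.ker f) :=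
      ⟨f, rfl, by rwa [one_mul], inter_subset_right⟩
    have s2 : sd W a (-1) (D ∩ hs (-f)) (W ⊓ LinearMap.ker f) :=
      ⟨-f, by congr 1; ext; simp, by simpa using hpos, inter_subset_right⟩
    have n1 : ¬ sd W a (-1) (D ∩ hs f) (W ⊓ LinearMap.ker f) := by
      rintro ⟨g, g1, g2, g3⟩
      have h6 := g3 ⟨hxp, hxp0.le⟩
      rw [mem_hs, hcol g g1 xp hxp] at h6
      have : 0 < f (ell xp) / f (ell a) := div_pos hxp0 hpos
      nlinarith
    have n2 : ¬ sd W a 1 (D ∩ hs (-f)) (W ⊓ LinearMap.ker f) := by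
      rintro ⟨g, g1, g2, g3⟩
      have h6 := g3 ⟨hxm, mem_hs_neg.2 hxm0.le⟩
      rw [mem_hs, hcol g g1 xm hxm] at h6
      have : f (ell xm) / f (ell a) < 0 := div_neg_of_neg_of_pos hxm0 hpos
      nlinarith
    have n3 : ¬ sd W a (-1) D (W ⊓ LinearMap.ker f) := fun h => n1 (h.mono inter_subset_left)
    have n4 : ¬ sd W a 1 D (W ⊓ LinearMap.ker f) := fun h => n2 (h.mono inter_subset_left)
    have q1 : D ∩ hs f ∩ pre (W ⊓ LinearMap.ker f) = D ∩ zs f := by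
      rw [inter_pre (fun x hx => hD x hx.1), ← hs_inter_neg]
      ext x; simp only [mem_inter_iff]; tauto
    have q2 : D ∩ hs (-f) ∩ pre (W ⊓ LinearMap.ker f) = D ∩ zs f := by
      rw [inter_pre (fun x hx => hD x hx.1), ← hs_inter_neg]
      ext x; simp only [mem_inter_iff]; tauto
    rw [term_not n1, term_pos s1, zero_add, q1] at e₁
    rw [term_not n2, term_pos s2, zero_add, q2] at e₂
    rw [term_not n3, term_not n4, zero_add, zero_add]
    rw [← e₂]
    have : ∀ p q r s t u : Mon E, p + r = t + u → p + q + (r + s) = u + (q + (t + s)) := by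
      intro p q r s t u h
      calc p + q + (r + s) = (p + r) + (q + s) := by abel
        _ = (t + u) + (q + s) := by rw [h]
        _ = _ := by abel
    exact this _ _ _ _ _ _ e₁

theorem vis_tree (U : Uq E k) (hW : Module.finrank ℝ W ≤ k + 1) (ha : ell a ∈ W) {D : Set E}
    {m : Mon E} (h : Tree (k + 1) D m) (hP : Pol D) (hD : ∀ x ∈ D, ell x ∈ W) : Vis k W a D m := by
  induction h with
  | null D h => exact vis_null hD (Nat.le_of_lt_succ h)
  | leaf v => exact vis_leaf U hW ha v hD
  | node D f m₁ m₂ h h₁ h₂ ih₁ ih₂ =>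
    have i₁ := ih₁ (hP.inter_hs f) (fun x hx => hD x hx.1)
    have i₂ := ih₂ (hP.inter_hs (-f)) (fun x hx => hD x hx.1)
    rcases le_total 0 (f (ell a)) with h0 | h0
    · exact vis_node U hW ha hP hD h0 h h₁ h₂ i₁ i₂
    · rw [add_comm]
      have e : f = - -f := (neg_neg f).symm
      refine vis_node U hW ha hP hD (f := -f) (by simpa using h0) (by rwa [zs_neg]) h₂ ?_ i₂ ?_
      · rwa [← e]
      · rwa [← e]

theorem uq_succ (U : Uq E k) : Uq E (k + 1) := by
  intro D m m' hP hk h h'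
  rcases D.eq_empty_or_nonempty with rfl | ⟨a, haD⟩
  · rw [null_val h (by rw [rk_empty]; omega), null_val h' (by rw [rk_empty]; omega)]
  have hW : Module.finrank ℝ (Submodule.span ℝ (ell '' D)) ≤ k + 1 := hk
  have hn : ∀ Hp, term k (Submodule.span ℝ (ell '' D)) a (-1) D Hp = 0 := by
    intro Hp
    apply term_not
    rintro ⟨f, h1, h2, h3⟩
    have := h3 haD
    rw [mem_hs] at this
    linarith
  have v := vis_tree U hW (mem_span_ell haD) h hP (fun x hx => mem_span_ell hx)
  have v' := vis_tree U hW (mem_span_ell haD) h' hP (fun x hx => mem_span_ell hx)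
  obtain ⟨F, e, e'⟩ := (Filter.Eventually.and v v').exists
  simp only [hn, Finset.sum_const_zero, add_zero] at e e'
  rw [e, e']

theorem uq (k : ℕ) : Uq E k := by
  induction k with
  | zero => exact uq_zero
  | succ k ih => exact uq_succ ih

end TriEq

namespace TriEq

set_option linter.unusedSectionVars false

variable {E : Type*} [AddCommGroup E] [Module ℝ E] [FiniteDimensional ℝ E]

theorem hull_eq_hsL {ι : Type*} [Fintype ι] {v : ι → E}
    (hv : LinearIndependent ℝ (fun i => ell (v i))) :
    ∃ M : Finset ((E × ℝ) →ₗ[ℝ] ℝ), hull v = hsL M := by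
  have hf : Fintype (Module.Basis.sumExtendIndex hv) := by
    have := Module.Finite.finite_basis (Module.Basis.sumExtend hv)
    have := Finite.sum_right (α := ι) (β := Module.Basis.sumExtendIndex hv)
    exact Fintype.ofFinite _
  let b := Module.Basis.sumExtend hv
  have hb : ∀ i, b (Sum.inl i) = ell (v i) := fun i => by
    simp [b, Module.Basis.sumExtend]
    try rfl
  refine ⟨Finset.univ.image (fun i => b.coord i) ∪
    Finset.univ.image (fun j => - b.coord (Sum.inr j)), ?_⟩
  apply Subset.antisymm
  · intro x hx
    obtain ⟨w, hw, hxw⟩ := mem_hull.1 hx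
    have hl : ∀ i, b.coord (Sum.inl i) (ell x) = w i := by
      intro i
      rw [hxw, map_sum]
      simp [← hb, Finsupp.single_apply]
    have hr : ∀ j, b.coord (Sum.inr j) (ell x) = 0 := by
      intro i
      rw [hxw, map_sum]
      simp [← hb]
    intro g hg
    rcases Finset.mem_union.1 hg with hg | hg
    · obtain ⟨i, _, rfl⟩ := Finset.mem_image.1 hg
      rcases i with i | j
      · rw [hl]; exact hw i
      · rw [hr]
    · obtain ⟨j, _, rfl⟩ := Finset.mem_image.1 hg
      rw [LinearMap.neg_apply, hr, neg_zero]
  · intro x hx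
    have h1 : ∀ i, 0 ≤ b.coord i (ell x) := fun i =>
      hx _ (Finset.mem_union_left _ (Finset.mem_image_of_mem _ (Finset.mem_univ i)))
    have h2 : ∀ j, b.coord (Sum.inr j) (ell x) = 0 := fun j => by
      have := hx _ (Finset.mem_union_right _ (Finset.mem_image_of_mem _ (Finset.mem_univ j)))
      rw [LinearMap.neg_apply] at this
      exact le_antisymm (by linarith) (h1 _)
    refine mem_hull.2 ⟨fun i => b.coord (Sum.inl i) (ell x), fun i => h1 _, ?_⟩
    conv_lhs => rw [← b.sum_repr (ell x)]
    rw [Fintype.sum_sum_type]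
    have h3 : ∀ j, b.repr (ell x) (Sum.inr j) = 0 := h2
    simp [h3, hb]

theorem FA {ι : Type*} {k : ℕ} (hk0 : 0 < k) (I : Finset ι) (Lc : Finset ((E × ℝ) →ₗ[ℝ] ℝ)) :
    ∀ (X : Set E) (Y : ι → Set E), Pol X → rk X ≤ k → (∀ i ∈ I, Pol (Y i)) → (∀ i ∈ I, Y i ⊆ X) →
    (∀ x ∈ X, ∃ i ∈ I, x ∈ Y i) → (∀ i ∈ I, ∀ j ∈ I, i ≠ j → rk (Y i ∩ Y j) < k) →
    (∀ i ∈ I, rk (Y i) < k ∨ ∃ M ⊆ Lc, Y i = X ∩ hsL M) → cls k X = ∑ i ∈ I, cls k (Y i) := by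
  induction Lc using Finset.induction with
  | empty =>
    intro X Y hX hk hY hsub hcov hpair hM
    by_cases hr : rk X < k
    · rw [cls_null hr, Finset.sum_eq_zero]
      intro i hi
      exact cls_null ((rk_mono (hsub i hi)).trans_lt hr)
    have hne : X.Nonempty := by
      rw [nonempty_iff_ne_empty]
      rintro rfl
      rw [rk_empty] at hr
      exact hr hk0
    obtain ⟨i, hi, hri⟩ : ∃ i ∈ I, ¬ rk (Y i) < k := by
      by_contra hcon
      push Not at hcon
      obtain ⟨x, hx, hxn⟩ := exists_avoid hX.convex hne I (fun i => Submodule.span ℝ (ell '' Y i)) (by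
        intro i hi
        by_contra hc
        push Not at hc
        have : rk X ≤ rk (Y i) := rk_le hc
        have := hcon i hi
        omega)
      obtain ⟨i, hi, hxi⟩ := hcov x hx
      exact hxn i hi (mem_span_ell hxi)
    have hYi : Y i = X := by
      rcases hM i hi with h | ⟨M, h1, h2⟩
      · exact absurd h hri
      · rw [h2, Finset.subset_empty.1 h1]; ext; simp [hsL]
    rw [Finset.sum_eq_single_of_mem i hi, hYi]
    intro j hj hji
    apply cls_null
    have := hpair i hi j hj hji.symm
    rwa [hYi, inter_eq_right.2 (hsub j hj)] at this
  | insert f Lc hf ih =>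
    intro X Y hX hk hY hsub hcov hpair hM
    by_cases hr : rk (X ∩ zs f) < k
    · have hYz : ∀ i ∈ I, rk (Y i ∩ zs f) < k := fun i hi =>
        (rk_mono (inter_subset_inter_left _ (hsub i hi))).trans_lt hr
      have hYk : ∀ i ∈ I, rk (Y i) ≤ k := fun i hi => (rk_mono (hsub i hi)).trans hk
      have pw : ∀ g : (E × ℝ) →ₗ[ℝ] ℝ, ∀ i ∈ I, ∀ j ∈ I, i ≠ j →
          rk (Y i ∩ hs g ∩ (Y j ∩ hs g)) < k := fun g i hi j hj hij =>
        (rk_mono (inter_subset_inter inter_subset_left inter_subset_left)).trans_lt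
          (hpair i hi j hj hij)
      have cv : ∀ g : (E × ℝ) →ₗ[ℝ] ℝ, ∀ x ∈ X ∩ hs g, ∃ i ∈ I, x ∈ Y i ∩ hs g := by
        rintro g x ⟨hx, hxg⟩
        obtain ⟨i, hi, hxi⟩ := hcov x hx
        exact ⟨i, hi, hxi, hxg⟩
      have e1 := ih (X ∩ hs f) (fun i => Y i ∩ hs f) (hX.inter_hs f)
        ((rk_mono inter_subset_left).trans hk) (fun i hi => (hY i hi).inter_hs f)
        (fun i hi => inter_subset_inter_left _ (hsub i hi)) (cv f) (pw f) (by
          intro i hi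
          rcases hM i hi with h | ⟨M, h1, h2⟩
          · exact Or.inl ((rk_mono inter_subset_left).trans_lt h)
          · refine Or.inr ⟨M.erase f, ?_, ?_⟩
            · intro g hg
              exact (Finset.mem_insert.1 (h1 (Finset.mem_of_mem_erase hg))).resolve_left
                (Finset.ne_of_mem_erase hg)
            · rw [h2]
              ext x
              simp only [hsL, mem_inter_iff, mem_ofPred_eq, Finset.mem_erase]
              constructor
              · rintro ⟨⟨h3, h4⟩, h5⟩
                exact ⟨⟨h3, h5⟩, fun g hg => h4 g hg.2⟩
              · rintro ⟨⟨h3, h5⟩, h4⟩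
                refine ⟨⟨h3, fun g hg => ?_⟩, h5⟩
                by_cases hgf : g = f
                · rw [hgf]; exact h5
                · exact h4 g ⟨hgf, hg⟩)
      have e2 := ih (X ∩ hs (-f)) (fun i => Y i ∩ hs (-f)) (hX.inter_hs (-f))
        ((rk_mono inter_subset_left).trans hk) (fun i hi => (hY i hi).inter_hs (-f))
        (fun i hi => inter_subset_inter_left _ (hsub i hi)) (cv (-f)) (pw (-f)) (by
          intro i hi
          rcases hM i hi with h | ⟨M, h1, h2⟩
          · exact Or.inl ((rk_mono inter_subset_left).trans_lt h)
          · by_cases hfM : f ∈ M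
            · left
              refine (rk_mono ?_).trans_lt hr
              rw [← hs_inter_neg, h2]
              rintro x ⟨⟨h3, h4⟩, h5⟩
              exact ⟨h3, h4 f hfM, h5⟩
            · refine Or.inr ⟨M, ?_, ?_⟩
              · intro g hg
                exact (Finset.mem_insert.1 (h1 hg)).resolve_left (by rintro rfl; exact hfM hg)
              · rw [h2, inter_right_comm])
      rw [cls_add (uq k) hX hk f hr, e1, e2, ← Finset.sum_add_distrib]
      apply Finset.sum_congr rfl
      intro i hi
      rw [cls_add (uq k) (hY i hi) (hYk i hi) f (hYz i hi)]
    · have hz := zero_of_rk hk hr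
      refine ih X Y hX hk hY hsub hcov hpair ?_
      intro i hi
      rcases hM i hi with h | ⟨M, h1, h2⟩
      · exact Or.inl h
      · refine Or.inr ⟨M.erase f, ?_, ?_⟩
        · intro g hg
          exact (Finset.mem_insert.1 (h1 (Finset.mem_of_mem_erase hg))).resolve_left
            (Finset.ne_of_mem_erase hg)
        · rw [h2]
          ext x
          simp only [hsL, mem_inter_iff, mem_ofPred_eq, Finset.mem_erase]
          constructor
          · rintro ⟨h3, h4⟩
            exact ⟨h3, fun g hg => h4 g hg.2⟩
          · rintro ⟨h3, h4⟩
            refine ⟨h3, fun g hg => ?_⟩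
            by_cases hgf : g = f
            · rw [hgf]; exact (hz h3).ge
            · exact h4 g ⟨hgf, hg⟩

/-- Nondegenerate simplices with `k` vertices. -/
def Simp (k : ℕ) (T : Set E) : Prop :=
  ∃ v : Fin k → E, LinearIndependent ℝ (fun i => ell (v i)) ∧ T = hull v

theorem Simp.pol_inter {k : ℕ} {S T : Set E} (hS : Simp k S) (hT : Simp k T) : Pol (T ∩ S) := by
  obtain ⟨v, hv, rfl⟩ := hT
  obtain ⟨w, hw, rfl⟩ := hS
  obtain ⟨M, hM⟩ := hull_eq_hsL hw
  exact ⟨Fin k, inferInstance, v, M, hv, by rw [hM]⟩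

theorem Simp.pol {k : ℕ} {T : Set E} (hT : Simp k T) : Pol T := by
  have := Simp.pol_inter hT hT
  rwa [inter_self] at this

theorem Simp.rk {k : ℕ} {T : Set E} (hT : Simp k T) : rk T = k := by
  obtain ⟨v, hv, rfl⟩ := hT
  rw [rk_hull_of_li hv, Fintype.card_fin]

theorem cls_simp_sum {k : ℕ} (hk0 : 0 < k) {T : Set E} (hT : Simp k T) (G : Finset (Set E))
    (hG : ∀ S ∈ G, Simp k S) (hpair : ∀ S ∈ G, ∀ S' ∈ G, S ≠ S' → rk (S ∩ S') < k)
    (hcov : ∀ x ∈ T, ∃ S ∈ G, x ∈ S) : cls k T = ∑ S ∈ G, cls k (T ∩ S) := by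
  have : ∀ S : Set E, ∃ M : Finset ((E × ℝ) →ₗ[ℝ] ℝ), S ∈ G → S = hsL M := by
    intro S
    by_cases hS : S ∈ G
    · obtain ⟨w, hw, hSw⟩ := hG S hS
      obtain ⟨M, hM⟩ := hull_eq_hsL hw
      exact ⟨M, fun _ => by rw [hSw, hM]⟩
    · exact ⟨∅, fun h => absurd h hS⟩
  choose M hM using this
  refine FA hk0 G (G.biUnion M) T (fun S => T ∩ S) hT.pol hT.rk.le
    (fun S hS => (hG S hS).pol_inter hT) (fun S hS => inter_subset_left) ?_ ?_ ?_
  · intro x hx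
    obtain ⟨S, hS, hxS⟩ := hcov x hx
    exact ⟨S, hS, hx, hxS⟩
  · intro S hS S' hS' hne
    exact (rk_mono (inter_subset_inter inter_subset_right inter_subset_right)).trans_lt
      (hpair S hS S' hS' hne)
  · intro S hS
    exact Or.inr ⟨M S, Finset.subset_biUnion_of_mem M hS, by rw [← hM S hS]⟩

theorem cls_sum_eq {k : ℕ} (hk0 : 0 < k) (F G : Finset (Set E))
    (hF : ∀ S ∈ F, Simp k S) (hFp : ∀ S ∈ F, ∀ S' ∈ F, S ≠ S' → rk (S ∩ S') < k)
    (hG : ∀ S ∈ G, Simp k S) (hGp : ∀ S ∈ G, ∀ S' ∈ G, S ≠ S' → rk (S ∩ S') < k)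
    (hFG : (⋃ T ∈ F, T) = ⋃ T ∈ G, T) : ∑ T ∈ F, cls k T = ∑ S ∈ G, cls k S := by
  have mem : ∀ (F : Finset (Set E)) x, x ∈ (⋃ T ∈ F, T) ↔ ∃ T ∈ F, x ∈ T := by
    intro F x; simp
  have h1 : ∀ T ∈ F, cls k T = ∑ S ∈ G, cls k (T ∩ S) := fun T hT =>
    cls_simp_sum hk0 (hF T hT) G hG hGp (fun x hx => by
      rw [← mem, ← hFG, mem]; exact ⟨T, hT, hx⟩)
  have h2 : ∀ S ∈ G, cls k S = ∑ T ∈ F, cls k (S ∩ T) := fun T hT =>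
    cls_simp_sum hk0 (hG T hT) F hF hFp (fun x hx => by
      rw [← mem, hFG, mem]; exact ⟨T, hT, hx⟩)
  rw [Finset.sum_congr rfl h1, Finset.sum_congr rfl h2, Finset.sum_comm]
  simp only [inter_comm]

end TriEq

namespace TriEq

set_option linter.unusedSectionVars false

variable {E : Type*} [AddCommGroup E] [Module ℝ E] [FiniteDimensional ℝ E]

theorem li_iff_aff {ι : Type*} {v : ι → E} :
    AffineIndependent ℝ v ↔ LinearIndependent ℝ (fun i => ell (v i)) := by
  rw [affineIndependent_iff, linearIndependent_iff']
  have key : ∀ (s : Finset ι) (w : ι → ℝ), ∑ i ∈ s, w i • ell (v i) = 0 ↔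
      (∑ i ∈ s, w i = 0 ∧ ∑ i ∈ s, w i • v i = 0) := by
    intro s w
    rw [Prod.ext_iff]
    simp [ell, Prod.fst_sum, Prod.snd_sum, and_comm]
  constructor
  · intro h s w h0
    rw [key] at h0
    exact h s w h0.1 h0.2
  · intro h s w h1 h2
    exact h s w ((key s w).2 ⟨h1, h2⟩)

/-- Pairwise overlaps are of smaller rank. -/
def Good (k : ℕ) (A : Multiset (Set E)) : Prop := A.Pairwise (fun S T => rk (S ∩ T) < k)

theorem good_coe {k : ℕ} (l : List (Set E)) :
    Good k (l : Multiset (Set E)) ↔ l.Pairwise (fun S T => rk (S ∩ T) < k) := by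
  have : Std.Symm (fun S T : Set E => rk (S ∩ T) < k) := ⟨fun S T h => by rwa [inter_comm]⟩
  exact Multiset.pairwise_coe_iff_pairwise

theorem good_cons {k : ℕ} (S : Set E) (A : Multiset (Set E)) :
    Good k (S ::ₘ A) ↔ (∀ T ∈ A, rk (S ∩ T) < k) ∧ Good k A := by
  induction A using Quot.inductionOn with
  | h l =>
    show Good k (S ::ₘ (l : Multiset (Set E))) ↔ (∀ T ∈ (l : Multiset (Set E)), _) ∧
      Good k (l : Multiset (Set E))
    rw [Multiset.cons_coe, good_coe, good_coe, List.pairwise_cons]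
    simp

theorem rk_union_lt {k : ℕ} (hk : 0 < k) {C A B : Set E} (hC : Convex ℝ C) (h : C ⊆ A ∪ B)
    (hA : rk A < k) (hB : rk B < k) : rk C < k := by
  by_contra hcon
  have hne : C.Nonempty := by
    rw [nonempty_iff_ne_empty]
    rintro rfl
    rw [rk_empty] at hcon
    exact hcon hk
  have key : ∀ X : Set E, rk X < k → ∃ x ∈ C, ell x ∉ Submodule.span ℝ (ell '' X) := by
    intro X hX
    by_contra hc
    push Not at hc
    have : rk C ≤ rk X := rk_le hc
    omega
  obtain ⟨x, hx, hxn⟩ := exists_avoid hC hne (Finset.univ : Finset Bool)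
    (fun b => Submodule.span ℝ (ell '' (if b then A else B))) (by
      intro b _
      cases b
      · exact key B hB
      · exact key A hA)
  rcases h hx with h | h
  · exact hxn true (Finset.mem_univ _) (mem_span_ell h)
  · exact hxn false (Finset.mem_univ _) (mem_span_ell h)

theorem good_split {k : ℕ} (hk : 0 < k) {T T₁ T₂ : Set E} (hT : Convex ℝ T) (hU : T₁ ∪ T₂ = T)
    (h12 : rk (T₁ ∩ T₂) < k) {B : Multiset (Set E)} (hB : ∀ S ∈ B, Convex ℝ S) :
    Good k (T ::ₘ B) ↔ Good k (T₁ ::ₘ T₂ ::ₘ B) := by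
  have s1 : T₁ ⊆ T := hU ▸ subset_union_left
  have s2 : T₂ ⊆ T := hU ▸ subset_union_right
  rw [good_cons, good_cons, good_cons]
  constructor
  · rintro ⟨h1, h2⟩
    refine ⟨?_, fun S hS => (rk_mono (inter_subset_inter_left _ s2)).trans_lt (h1 S hS), h2⟩
    intro S hS
    rcases Multiset.mem_cons.1 hS with rfl | hS
    · exact h12
    · exact (rk_mono (inter_subset_inter_left _ s1)).trans_lt (h1 S hS)
  · rintro ⟨h1, h2, h3⟩
    refine ⟨fun S hS => ?_, h3⟩
    refine rk_union_lt hk (hT.inter (hB S hS)) (A := T₁ ∩ S) (B := T₂ ∩ S) ?_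
      (h1 S (Multiset.mem_cons_of_mem hS)) (h2 S hS)
    rw [← union_inter_distrib_right, hU]

variable {N n : ℕ}

theorem isSimplex_iff {T : Set (Euc N)} : IsSimplex n T ↔ Simp (n + 1) T := by
  unfold IsSimplex Simp
  simp only [li_iff_aff]
  rfl

theorem rk_le_sdim (D : Set (Euc N)) : rk D ≤ sdim D + 1 := by
  rcases D.eq_empty_or_nonempty with rfl | ⟨a, ha⟩
  · rw [rk_empty]; omega
  have h1 : rk D ≤ Module.finrank ℝ ((Submodule.map (LinearMap.inl ℝ (Euc N) ℝ) (vectorSpan ℝ D) ⊔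
      Submodule.span ℝ {ell a} : Submodule ℝ (Euc N × ℝ))) := by
    apply rk_le
    intro x hx
    have : ell x = LinearMap.inl ℝ (Euc N) ℝ (x - a) + ell a := by
      simp [ell]
    rw [this]
    exact Submodule.add_mem_sup (Submodule.mem_map_of_mem (vsub_mem_vectorSpan ℝ hx ha))
      (Submodule.mem_span_singleton_self _)
  refine h1.trans ((Submodule.finrank_add_le_finrank_add_finrank _ _).trans ?_)
  have h2 := finrank_span_le_card (R := ℝ) ({ell a} : Set (Euc N × ℝ))
  simp only [toFinset_singleton, Finset.card_singleton] at h2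
  have h3 := Submodule.finrank_map_le (LinearMap.inl ℝ (Euc N) ℝ) (vectorSpan ℝ D)
  unfold sdim
  omega

theorem split_move {T T₁ T₂ : Set (Euc N)} (hd : IsDissection n T T₁ T₂) (hT : Simp (n + 1) T)
    (h12 : rk (T₁ ∩ T₂) < n + 1) {B : Multiset (Set (Euc N))} (hB : ∀ S ∈ B, Convex ℝ S)
    (hg : Good (n + 1) (T ::ₘ B)) :
    MoveEquiv n (T ::ₘ B).toFinset (T₁ ::ₘ T₂ ::ₘ B).toFinset ∧
    MoveEquiv n (T₁ ::ₘ T₂ ::ₘ B).toFinset (T ::ₘ B).toFinset := by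
  have hU := hd.2.2.1
  have hg' := (good_split (Nat.succ_pos n) hT.pol.convex hU h12 hB).1 hg
  rw [good_cons] at hg
  rw [good_cons, good_cons] at hg'
  have r0 : rk T = n + 1 := hT.rk
  have r1 : rk T₁ = n + 1 := (isSimplex_iff.1 hd.1).rk
  have r2 : rk T₂ = n + 1 := (isSimplex_iff.1 hd.2.1).rk
  have n0 : T ∉ B := fun h => by
    have := hg.1 T h
    rw [inter_self] at this
    omega
  have n1 : T₁ ∉ B := fun h => by
    have := hg'.1 T₁ (Multiset.mem_cons_of_mem h)
    rw [inter_self] at this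
    omega
  have n2 : T₂ ∉ B := fun h => by
    have := hg'.2.1 T₂ h
    rw [inter_self] at this
    omega
  have hne := hd.2.2.2.1
  simp only [Multiset.toFinset_cons]
  constructor
  · apply Relation.ReflTransGen.single
    left
    refine ⟨T, Finset.mem_insert_self _ _, T₁, T₂, hd, ?_⟩
    rw [Finset.erase_insert (by simpa using n0)]
  · apply Relation.ReflTransGen.single
    right
    refine ⟨T₁, Finset.mem_insert_self _ _, T₂,
      Finset.mem_insert_of_mem (Finset.mem_insert_self _ _), hne, ?_, ?_⟩
    · rw [hU]; exact isSimplex_iff.2 hT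
    · rw [Finset.erase_insert (by simp [n1, hne]), Finset.erase_insert (by simpa using n2), hU]

/-- Nondegenerate vertex multisets. -/
def nd (n : ℕ) (s : Multiset E) : Prop := s.card = n + 1 ∧ ¬ rk {x | x ∈ s} < n + 1

/-- Hull of a multiset. -/
def hullm (s : Multiset E) : Set E := convexHull ℝ {x | x ∈ s}

/-- Realization of formal sums of simplices. -/
def R (n : ℕ) (M : Multiset (Multiset E)) : Multiset (Set E) := (M.filter (nd n)).map hullm

theorem R_add (M M' : Multiset (Multiset E)) : R n (M + M') = R n M + R n M' := by
  simp [R]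

theorem R_single {s : Multiset E} (h : nd n s) : R n {s} = {hullm s} := by
  simp [R, Multiset.filter_singleton, h]

theorem R_single_not {s : Multiset E} (h : ¬ nd n s) : R n {s} = 0 := by
  simp [R, Multiset.filter_singleton, h]

theorem R_convex {M : Multiset (Multiset E)} {S : Set E} (h : S ∈ R n M) : Convex ℝ S := by
  obtain ⟨s, _, rfl⟩ := Multiset.mem_map.1 h
  exact convex_convexHull ℝ _

theorem hullm_map {ι : Type*} [Fintype ι] (v : ι → E) : hullm (Finset.univ.val.map v) = hull v := by
  unfold hullm hull
  rw [mem_univ_map]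

theorem nd_map {v : Fin (n + 1) → E} :
    nd n (Finset.univ.val.map v) ↔ LinearIndependent ℝ (fun i => ell (v i)) := by
  unfold nd
  rw [mem_univ_map, li_iff]
  simp

theorem enum {x y : E} {s : Multiset E} (h : (x ::ₘ y ::ₘ s).card = n + 1) :
    ∃ (v : Fin (n + 1) → E) (i j : Fin (n + 1)), i ≠ j ∧ v i = x ∧ v j = y ∧
      Finset.univ.val.map v = x ::ₘ y ::ₘ s := by
  induction s using Quot.inductionOn with
  | h l =>
    have hl : l.length + 1 + 1 = n + 1 := by simpa using h
    obtain rfl : n = l.length + 1 := by omega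
    refine ⟨(x :: y :: l).get, ⟨0, by simp⟩, ⟨1, by simp⟩, ?_, rfl, rfl, ?_⟩
    · simp
    · show _ = x ::ₘ y ::ₘ (l : Multiset E)
      rw [Fin.univ_val_map, Multiset.cons_coe, Multiset.cons_coe]
      congr 1
      exact List.ofFn_get _

/-- The induction predicate on formal sums. -/
def Eqv (n : ℕ) (M M' : Multiset (Multiset (Euc N))) : Prop :=
  ∀ K, (Good (n + 1) (R n (M + K)) ↔ Good (n + 1) (R n (M' + K))) ∧
    (Good (n + 1) (R n (M + K)) →
      MoveEquiv n (R n (M + K)).toFinset (R n (M' + K)).toFinset ∧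
      MoveEquiv n (R n (M' + K)).toFinset (R n (M + K)).toFinset)

theorem Eqv.of_eq {M M' : Multiset (Multiset (Euc N))} (h : R n M = R n M') : Eqv n M M' := by
  intro K
  rw [R_add, R_add, h]
  exact ⟨Iff.rfl, fun _ => ⟨Relation.ReflTransGen.refl, Relation.ReflTransGen.refl⟩⟩

theorem Eqv.symm {M M' : Multiset (Multiset (Euc N))} (h : Eqv n M M') : Eqv n M' M := by
  intro K
  obtain ⟨h1, h2⟩ := h K
  exact ⟨h1.symm, fun g => (h2 (h1.2 g)).symm⟩

theorem Eqv.trans {M M' M'' : Multiset (Multiset (Euc N))} (h : Eqv n M M') (h' : Eqv n M' M'') :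
    Eqv n M M'' := by
  intro K
  obtain ⟨h1, h2⟩ := h K
  obtain ⟨h3, h4⟩ := h' K
  refine ⟨h1.trans h3, fun g => ?_⟩
  obtain ⟨a, b⟩ := h2 g
  obtain ⟨c, d⟩ := h4 (h1.1 g)
  exact ⟨Relation.ReflTransGen.trans a c, Relation.ReflTransGen.trans d b⟩

theorem Eqv.add_right {M M' : Multiset (Multiset (Euc N))} (h : Eqv n M M')
    (L : Multiset (Multiset (Euc N))) : Eqv n (M + L) (M' + L) := by
  intro K
  rw [add_assoc, add_assoc]
  exact h (L + K)

theorem rk_dup {a : E} {s : Multiset E} : rk {x | x ∈ a ::ₘ a ::ₘ s} < (a ::ₘ a ::ₘ s).card := by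
  have h1 : {x | x ∈ a ::ₘ a ::ₘ s} = {x | x ∈ a ::ₘ s} := by ext; simp
  rw [h1]
  have h2 : rk {x | x ∈ a ::ₘ s} ≤ (a ::ₘ s).card := by
    unfold rk
    have : (ell '' {x | x ∈ a ::ₘ s}) = (((a ::ₘ s).toFinset.image ell : Finset (E × ℝ)) : Set (E × ℝ)) := by
      ext x; simp [eq_comm]
    rw [this]
    exact (finrank_span_finset_le_card _).trans (Finset.card_image_le.trans (Multiset.toFinset_card_le _))
  refine h2.trans_lt ?_
  simp

theorem upd_maps {ι : Type*} [Fintype ι] (v : ι → E) {i j : ι} (hij : i ≠ j) {s : Multiset E}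
    (hv : Finset.univ.val.map v = v i ::ₘ v j ::ₘ s) (p : E) :
    v i ::ₘ p ::ₘ s = Finset.univ.val.map (Function.update v j p) ∧
    p ::ₘ v j ::ₘ s = Finset.univ.val.map (Function.update v i p) := by
  rw [univ_map_eq₂ v hij] at hv
  have h2 := (Multiset.cons_inj_right _).1 ((Multiset.cons_inj_right _).1 hv)
  rw [univ_map_eq₂ (Function.update v j p) hij,
    univ_map_eq₂ (Function.update v i p) hij, map_rest_update _ _ _ _ (Or.inr rfl),
    map_rest_update _ _ _ _ (Or.inl rfl), h2]
  simp only [Function.update_self, Function.update_of_ne hij, Function.update_of_ne hij.symm,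
    and_self]

theorem eqv_cut (hn : 1 ≤ n) {x y p : Euc N} {s : Multiset (Euc N)} (hp : p ∈ segment ℝ x y) :
    Eqv n {x ::ₘ y ::ₘ s} ({x ::ₘ p ::ₘ s} + {p ::ₘ y ::ₘ s}) := by
  have c1 : (x ::ₘ p ::ₘ s).card = (x ::ₘ y ::ₘ s).card := by simp
  have c2 : (p ::ₘ y ::ₘ s).card = (x ::ₘ y ::ₘ s).card := by simp
  have hpsp : ell p ∈ Submodule.span ℝ (ell '' {z | z ∈ x ::ₘ y ::ₘ s}) := by
    obtain ⟨a, b, ha, hb, hab, rfl⟩ := hp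
    rw [ell_comb hab]
    exact Submodule.add_mem _ (Submodule.smul_mem _ _ (mem_span_ell (by simp)))
      (Submodule.smul_mem _ _ (mem_span_ell (by simp)))
  by_cases h0 : nd n (x ::ₘ y ::ₘ s)
  swap
  · have g1 : ¬ nd n (x ::ₘ p ::ₘ s) := by
      intro h
      apply h0
      refine ⟨c1 ▸ h.1, fun h3 => h.2 (lt_of_le_of_lt (rk_le ?_) h3)⟩
      intro z hz
      simp only [Multiset.mem_cons, mem_ofPred_eq] at hz
      rcases hz with rfl | rfl | hz
      · exact mem_span_ell (by simp)
      · exact hpsp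
      · exact mem_span_ell (by simp [hz])
    have g2 : ¬ nd n (p ::ₘ y ::ₘ s) := by
      intro h
      apply h0
      refine ⟨c2 ▸ h.1, fun h3 => h.2 (lt_of_le_of_lt (rk_le ?_) h3)⟩
      intro z hz
      simp only [Multiset.mem_cons, mem_ofPred_eq] at hz
      rcases hz with rfl | rfl | hz
      · exact hpsp
      · exact mem_span_ell (by simp)
      · exact mem_span_ell (by simp [hz])
    apply Eqv.of_eq
    rw [R_add, R_single_not h0, R_single_not g1, R_single_not g2, add_zero]
  rw [segment_eq_image] at hp
  obtain ⟨t, ⟨ht0, ht1⟩, rfl⟩ := hp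
  dsimp only at *
  rcases ht0.eq_or_lt with rfl | ht0
  · have e : (1 - (0 : ℝ)) • x + (0 : ℝ) • y = x := by simp
    rw [e] at *
    apply Eqv.of_eq
    rw [R_add, R_single_not (s := x ::ₘ x ::ₘ s), zero_add]
    intro h
    exact h.2 (h.1 ▸ rk_dup)
  rcases ht1.eq_or_lt with rfl | ht1
  · have e : (1 - (1 : ℝ)) • x + (1 : ℝ) • y = y := by simp
    rw [e] at *
    apply Eqv.of_eq
    rw [R_add, R_single_not (s := y ::ₘ y ::ₘ s), add_zero]
    intro h
    exact h.2 (h.1 ▸ rk_dup)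
  obtain ⟨v, i, j, hij, rfl, rfl, hv⟩ := enum h0.1
  have hm1 : v i ::ₘ ((1 - t) • v i + t • v j) ::ₘ s =
      Finset.univ.val.map (Function.update v j ((1 - t) • v i + t • v j)) := by
    convert (upd_maps v hij hv _).1
  have hm2 : ((1 - t) • v i + t • v j) ::ₘ v j ::ₘ s =
      Finset.univ.val.map (Function.update v i ((1 - t) • v i + t • v j)) := by
    convert (upd_maps v hij hv _).2
  rw [hm1, hm2, ← hv]
  rw [← hv] at h0
  have hli := nd_map.1 h0
  have hpc : (1 - t) • v i + t • v j = (1 - (1 - t)) • v j + (1 - t) • v i := by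
    rw [add_comm, sub_sub_cancel]
  have l1 : LinearIndependent ℝ (fun l => ell (Function.update v j ((1 - t) • v i + t • v j) l)) := by
    convert li_update hli hij ht0.ne'
  have l2 : LinearIndependent ℝ (fun l => ell (Function.update v i ((1 - t) • v i + t • v j) l)) := by
    rw [hpc]
    convert li_update hli hij.symm (t := 1 - t) (by linarith)
  obtain ⟨g, hg⟩ := exists_dual hli (fun l => if l = i then -t else if l = j then 1 - t else 0)
  have gi : g (ell (v i)) = -t := by simpa using hg i
  have gj : g (ell (v j)) = 1 - t := by simpa [hij.symm] using hg j
  have gl : ∀ l, l ≠ i → l ≠ j → g (ell (v l)) = 0 := by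
    intro l h1 h2; simpa [h1, h2] using hg l
  have k1 : hull v ∩ hs (-g) = hull (Function.update v j ((1 - t) • v i + t • v j)) := by
    convert cut_hull v hij ht0 g gi gj ht1 gl
  have k2 : hull v ∩ hs g = hull (Function.update v i ((1 - t) • v i + t • v j)) := by
    have c2 := cut_hull v hij.symm (t := 1 - t) (by linarith) (-g) (by simp [gj])
          (by simp [gi]) (by linarith) (by intro l h1 h2; simp [gl l h2 h1])
    rw [neg_neg, ← hpc] at c2
    convert c2
  have sT : Simp (n + 1) (hull v) := ⟨v, hli, rfl⟩
  have s1 : Simp (n + 1) (hull v ∩ hs (-g)) := ⟨_, l1, k1⟩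
  have s2 : Simp (n + 1) (hull v ∩ hs g) := ⟨_, l2, k2⟩
  have hU : hull v ∩ hs (-g) ∪ hull v ∩ hs g = hull v := by
    rw [← inter_union_distrib_left, inter_eq_left]
    intro z _
    rcases le_total 0 (g (ell z)) with h | h
    · exact Or.inr h
    · exact Or.inl (mem_hs_neg.2 h)
  have hI : rk (hull v ∩ hs (-g) ∩ (hull v ∩ hs g)) < n + 1 := by
    rw [← inter_inter_distrib_left, inter_comm (hs (-g)), hs_inter_neg]
    by_contra hcon
    have := zero_of_rk sT.rk.le hcon (mem_hull_self v i)
    rw [mem_zs, gi] at this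
    linarith
  have hgl : ∀ z : Euc N, g (ell z) = g.comp (LinearMap.inl ℝ (Euc N) ℝ) z + g (0, 1) := by
    intro z
    rw [LinearMap.comp_apply, ← map_add]
    simp [ell]
  have hd : IsDissection n (hull v) (hull v ∩ hs (-g)) (hull v ∩ hs g) := by
    refine ⟨isSimplex_iff.2 s1, isSimplex_iff.2 s2, hU, ?_, g.comp (LinearMap.inl ℝ (Euc N) ℝ),
      - g (0, 1), ?_, ?_, ?_, v, li_iff_aff.2 hli, rfl, (Finset.univ.erase i).erase j, ?_, ?_⟩
    · intro he
      rw [← he, inter_self, s1.rk] at hI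
      exact hI.false
    · intro hz
      have e1 := hgl (v i)
      have e2 := hgl (v j)
      rw [hz, gi] at e1
      rw [hz, gj] at e2
      simp at e1 e2
      linarith
    · congr 1
      ext z
      rw [mem_hs_neg, hgl, mem_ofPred_eq]
      constructor <;> intro h <;> linarith
    · congr 1
      ext z
      rw [mem_hs, hgl, mem_ofPred_eq]
      constructor <;> intro h <;> linarith
    · rw [Finset.card_erase_of_mem (by simp [hij.symm]), Finset.card_erase_of_mem (by simp)]
      simp
    · intro l hl
      simp only [Finset.mem_erase, Finset.mem_univ, and_true] at hl
      have := hgl (v l)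
      rw [gl l hl.2 hl.1] at this
      linarith
  intro K
  have eK1 : R n ({Finset.univ.val.map v} + K) = hull v ::ₘ R n K := by
    rw [R_add, R_single h0, hullm_map, Multiset.singleton_add]
  have eK2 : R n ({Finset.univ.val.map (Function.update v j ((1 - t) • v i + t • v j))} +
      {Finset.univ.val.map (Function.update v i ((1 - t) • v i + t • v j))} + K) =
      (hull v ∩ hs (-g)) ::ₘ (hull v ∩ hs g) ::ₘ R n K := by
    rw [R_add, R_add, R_single (nd_map.2 l1), R_single (nd_map.2 l2), hullm_map, hullm_map, k1, k2,
      add_assoc, Multiset.singleton_add, Multiset.singleton_add]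
  rw [eK1, eK2]
  exact ⟨good_split (Nat.succ_pos n) (hull_convex v) hU hI (fun S hS => R_convex hS),
    fun hgood => split_move hd sT hI (fun S hS => R_convex hS) hgood⟩

theorem eqv_rel (hn : 1 ≤ n) {M M' : Multiset (Multiset (Euc N))}
    (h : AddConGen.Rel (Gen (E := Euc N)) M M') : Eqv n M M' := by
  induction h with
  | of M M' h =>
    cases h with
    | cut x y p s h => exact eqv_cut hn h
    | deg s h =>
      apply Eqv.of_eq
      rw [R_single_not]
      · simp [R]
      · intro h2
        exact h2.2 (h2.1 ▸ h)
  | refl M => exact Eqv.of_eq rfl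
  | symm _ ih => exact ih.symm
  | trans _ _ ih ih' => exact ih.trans ih'
  | @add w x y z _ _ ih ih' =>
    refine (ih.add_right _).trans ?_
    rw [add_comm x y, add_comm x z]
    exact ih'.add_right x

theorem exists_multi (F : Finset (Set (Euc N))) (hF : ∀ T ∈ F, IsSimplex n T) :
    ∃ M : Multiset (Multiset (Euc N)), R n M = F.val ∧
      (addConGen (Gen (E := Euc N))).mk' M = ∑ T ∈ F, cls (n + 1) T := by
  have : ∀ T : Set (Euc N), ∃ s : Multiset (Euc N), T ∈ F →
      nd n s ∧ hullm s = T ∧ br s = cls (n + 1) T := by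
    intro T
    by_cases hT : T ∈ F
    · obtain hS := isSimplex_iff.1 (hF T hT)
      have hrk := hS.rk
      have hpol := hS.pol
      obtain ⟨v, hv, rfl⟩ := hS
      exact ⟨Finset.univ.val.map v, fun _ => ⟨nd_map.2 hv, hullm_map v,
        (cls_eq (uq _) hpol hrk.le (Tree.leaf v)).symm⟩⟩
    · exact ⟨0, fun h => absurd h hT⟩
  choose vt hvt using this
  refine ⟨F.val.map vt, ?_, ?_⟩
  · unfold R
    rw [Multiset.filter_eq_self.2, Multiset.map_map]
    · conv_rhs => rw [← Multiset.map_id F.val]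
      exact Multiset.map_congr rfl (fun T hT => (hvt T hT).2.1)
    · intro s hs
      obtain ⟨T, hT, rfl⟩ := Multiset.mem_map.1 hs
      exact (hvt T hT).1
  · have h1 : F.val.map vt = ∑ T ∈ F, {vt T} := by
      rw [Finset.sum_eq_multiset_sum]
      conv_lhs => rw [← Multiset.sum_map_singleton (F.val.map vt), Multiset.map_map]
      rfl
    rw [h1, map_sum]
    exact Finset.sum_congr rfl (fun T hT => (hvt T hT).2.2)

end TriEq


/-- Main Theorem: any two triangulations of an `n`-polyhedron are equivalent
by finitely many elementary moves. -/
theorem triangulations_equiv {N n : ℕ} (hn : 1 ≤ n) (hnN : n ≤ N)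
    (P : Set (Euc N)) (hP : IsPolyhedron n P)
    (F G : Finset (Set (Euc N))) (hF : IsTriangulation n P F) (hG : IsTriangulation n P G) :
    MoveEquiv n F G := by
  have pw : ∀ F : Finset (Set (Euc N)), IsTriangulation n P F →
      ∀ S ∈ F, ∀ T ∈ F, S ≠ T → TriEq.rk (S ∩ T) < n + 1 := by
    intro F hF S hS T hT hne
    have h1 := hF.2.2 S hS T hT hne
    have h2 := TriEq.rk_le_sdim (S ∩ T)
    omega
  obtain ⟨M, hM, eM⟩ := TriEq.exists_multi F hF.1
  obtain ⟨M', hM', eM'⟩ := TriEq.exists_multi G hG.1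
  have hs := TriEq.cls_sum_eq (Nat.succ_pos n) F G
    (fun S hS => TriEq.isSimplex_iff.1 (hF.1 S hS)) (pw F hF)
    (fun S hS => TriEq.isSimplex_iff.1 (hG.1 S hS)) (pw G hG) (hF.2.1.trans hG.2.1.symm)
  have hMM := eM.trans (hs.trans eM'.symm)
  have hrel : AddConGen.Rel (TriEq.Gen (E := Euc N)) M M' := (AddCon.eq _).1 hMM
  have key := TriEq.eqv_rel hn hrel 0
  rw [add_zero, add_zero, hM, hM', Finset.val_toFinset, Finset.val_toFinset] at key
  refine (key.2 ?_).1
  exact Multiset.Nodup.pairwise (pw F hF) F.nodup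
end
end

section
/- Every valuation on the set T^n of simplices of dimension at most n in R^N has a unique extension to a valuation on the set P^n of polytopes of dimension at most n in R^N. -/
open Set MeasureTheory
open scoped Classical
noncomputable section

theorem ve_sign_div {c d : ℝ} (hd : d ≠ 0) : Real.sign d * Real.sign (c / d) = Real.sign c := by
  rcases lt_or_gt_of_ne hd with h | h
  · rcases lt_trichotomy c 0 with h' | h' | h'
    · rw [Real.sign_of_neg h, Real.sign_of_pos (div_pos_of_neg_of_neg h' h), Real.sign_of_neg h']; norm_num
    · subst h'; simp
    · rw [Real.sign_of_neg h, Real.sign_of_neg (div_neg_of_pos_of_neg h' h), Real.sign_of_pos h']; norm_num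
  · rcases lt_trichotomy c 0 with h' | h' | h'
    · rw [Real.sign_of_pos h, Real.sign_of_neg (div_neg_of_neg_of_pos h' h), Real.sign_of_neg h']; norm_num
    · subst h'; simp
    · rw [Real.sign_of_pos h, Real.sign_of_pos (div_pos h' h), Real.sign_of_pos h']; norm_num

/-- Simple additive functions of tuples of points. -/
structure SimpleFun {V : Type} [AddCommGroup V] [Module ℝ V] {ι : Type} [Fintype ι] [DecidableEq ι]
    (φ : (ι → V) → ℝ) : Prop where
  sym : ∀ (v : ι → V) (σ : Equiv.Perm ι), φ (v ∘ σ) = φ v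
  deg : ∀ v : ι → V, ¬ AffineIndependent ℝ v → φ v = 0
  cut : ∀ (v : ι → V) (i j : ι), i ≠ j → ∀ s t : ℝ, 0 < s → 0 < t → s + t = 1 →
    φ v = φ (Function.update v i (s • v i + t • v j)) + φ (Function.update v j (s • v i + t • v j))

section
variable {V : Type} [AddCommGroup V] [Module ℝ V] {ι : Type} [Fintype ι] [DecidableEq ι] {φ : (ι → V) → ℝ}

theorem SimpleFun.cut_neg (h : SimpleFun φ) (v : ι → V) (i j : ι) (hij : i ≠ j) (s t : ℝ)
    (hs : s < 0) (hst : s + t = 1) :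
    φ v = - φ (Function.update v i (s • v i + t • v j))
      + φ (Function.update v j (s • v i + t • v j)) := by
  have ht : 0 < t := by linarith
  set p := s • v i + t • v j with hp
  have hvj : (-s/t) • v i + (1/t) • p = v j := by
    rw [hp, smul_add, smul_smul, smul_smul, ← add_assoc, ← add_smul]
    have h1 : -s / t + 1 / t * s = 0 := by ring
    have h2 : 1 / t * t = 1 := by field_simp
    rw [h1, h2]; simp
  have := h.cut (Function.update v j p) i j hij (-s/t) (1/t) (div_pos (by linarith) ht)
    (by positivity) (by rw [← add_div, div_eq_one_iff_eq ht.ne']; linarith)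
  simp only [Function.update_self, Function.update_of_ne hij, hvj, Function.update_idem,
    Function.update_eq_self] at this
  have e : Function.update (Function.update v j p) i (v j) =
      (Function.update v i p) ∘ (Equiv.swap i j) := by
    funext k
    by_cases hki : k = i
    · subst hki; simp [hij.symm]
    · by_cases hkj : k = j
      · subst hkj; simp [hki]
      · simp [hki, hkj, Equiv.swap_apply_of_ne_of_ne hki hkj]
  rw [e, h.sym] at this
  linarith

theorem SimpleFun.cut_line (h : SimpleFun φ) (v : ι → V) (i j : ι) (hij : i ≠ j) (s t : ℝ)
    (hst : s + t = 1) :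
    φ v = Real.sign s * φ (Function.update v i (s • v i + t • v j))
      + Real.sign t * φ (Function.update v j (s • v i + t • v j)) := by
  rcases lt_trichotomy s 0 with hs | hs | hs
  · have ht : 0 < t := by linarith
    rw [Real.sign_of_neg hs, Real.sign_of_pos ht, h.cut_neg v i j hij s t hs hst]; ring
  · obtain rfl : t = 1 := by linarith
    subst hs; simp
  · rcases lt_trichotomy t 0 with ht | ht | ht
    · rw [Real.sign_of_pos hs, Real.sign_of_neg ht, h.cut_neg v j i hij.symm t s ht (by linarith),
        add_comm (t • v j)]; ring
    · obtain rfl : s = 1 := by linarith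
      subst ht; simp
    · rw [Real.sign_of_pos hs, Real.sign_of_pos ht, h.cut v i j hij s t hs ht hst]; ring

theorem SimpleFun.cocycle (h : SimpleFun φ) (n : ℕ) : ∀ (A : Finset ι), A.card = n →
    ∀ (c : ι → ℝ), ∑ i ∈ A, c i = 1 → ∀ v : ι → V,
    φ v = ∑ i ∈ A, Real.sign (c i) * φ (Function.update v i (∑ j ∈ A, c j • v j)) := by
  induction n with
  | zero =>
    intro A hA c hc v
    rw [Finset.card_eq_zero] at hA; subst hA; simp at hc
  | succ n ih =>
    intro A hA c hc v
    by_cases hall : ∀ i ∈ A, c i = 1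
    · rw [Finset.sum_congr rfl hall] at hc
      simp at hc
      obtain ⟨i, rfl⟩ := Finset.card_eq_one.mp hc
      have := hall i (by simp)
      simp [this]
    · push Not at hall
      obtain ⟨i, hi, hci⟩ := hall
      have hd : 1 - c i ≠ 0 := sub_ne_zero.mpr (Ne.symm hci)
      have hcard : (A.erase i).card = n := by rw [Finset.card_erase_of_mem hi, hA]; rfl
      set a := ∑ j ∈ A, c j • v j with ha
      set B := A.erase i with hB
      set b := ∑ j ∈ B, (c j / (1 - c i)) • v j with hb
      have hsum : ∑ j ∈ B, c j / (1 - c i) = 1 := by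
        rw [← Finset.sum_div, div_eq_one_iff_eq hd, ← hc, ← Finset.add_sum_erase A c hi]; ring
      have hab : a = c i • v i + (1 - c i) • b := by
        rw [ha, ← Finset.add_sum_erase A _ hi, hb, Finset.smul_sum]
        congr 1
        refine Finset.sum_congr rfl fun j _ => ?_
        rw [smul_smul, mul_div_cancel₀ _ hd]
      have h1 := ih B hcard (fun j => c j / (1 - c i)) hsum v
      have h2 := ih B hcard (fun j => c j / (1 - c i)) hsum (Function.update v i a)
      have hne : ∀ j ∈ B, j ≠ i := fun j hj => Finset.ne_of_mem_erase hj
      have hb2 : ∑ j ∈ B, (c j / (1 - c i)) • Function.update v i a j = b := by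
        refine Finset.sum_congr rfl fun j hj => ?_
        rw [Function.update_of_ne (hne j hj)]
      rw [hb2] at h2
      rw [← hb] at h1
      rw [← Finset.add_sum_erase A _ hi, h2, h1, Finset.mul_sum, ← Finset.sum_add_distrib]
      refine Finset.sum_congr rfl fun j hj => ?_
      have hji := hne j hj
      have h3 := h.cut_line (Function.update v j b) i j hji.symm (c i) (1 - c i) (by ring)
      simp only [Function.update_self, Function.update_of_ne hji.symm, Function.update_idem,
        ← hab] at h3
      rw [h3, Function.update_comm hji.symm, mul_add]
      have := ve_sign_div (c := c j) hd
      rw [← this]; ring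
end


open Filter Topology in
theorem ve_eventually_ne {p q : ℝ} (h : p ≠ 0 ∨ q ≠ 0) : ∀ᶠ ε : ℝ in 𝓝[>] 0, p + ε * q ≠ 0 := by
  by_cases hp : p = 0
  · have hq : q ≠ 0 := h.resolve_left (not_not.mpr hp)
    filter_upwards [self_mem_nhdsWithin] with ε hε
    rw [hp, zero_add]; exact mul_ne_zero (ne_of_gt hε) hq
  · have : Tendsto (fun ε : ℝ => p + ε * q) (𝓝[>] 0) (𝓝 p) := by
      have h2 : Continuous (fun ε : ℝ => p + ε * q) := by fun_prop
      have := h2.tendsto 0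
      simp only [zero_mul, add_zero] at this
      exact this.mono_left nhdsWithin_le_nhds
    exact this.eventually_ne hp

open Filter Topology in
theorem ve_eventually_sign {p : ℝ} (q : ℝ) (h : p ≠ 0) :
    ∀ᶠ ε : ℝ in 𝓝[>] 0, (0 ≤ p + ε * q ↔ 0 ≤ p) := by
  have : Tendsto (fun ε : ℝ => p + ε * q) (𝓝[>] 0) (𝓝 p) := by
    have h2 : Continuous (fun ε : ℝ => p + ε * q) := by fun_prop
    have := h2.tendsto 0
    simp only [zero_mul, add_zero] at this
    exact this.mono_left nhdsWithin_le_nhds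
  rcases lt_or_gt_of_ne h with h | h
  · filter_upwards [this.eventually_lt_const h] with ε hε
    exact ⟨fun h1 => absurd h1 (not_le.mpr hε), fun h1 => absurd h1 (not_le.mpr h)⟩
  · filter_upwards [this.eventually_const_lt h] with ε hε
    exact ⟨fun _ => h.le, fun _ => hε.le⟩

section
variable {V : Type} [AddCommGroup V] [Module ℝ V]

/-- The facet opposite to `i` lies in the hyperplane `g = 1`. -/
def GoodFacet {n : ℕ} (B : AffineBasis (Fin (n + 2)) ℝ V) (g : Module.Dual ℝ V) (i : Fin (n + 2)) :
    Prop :=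
  B.coord i 0 ≠ 0 ∧ ∀ y, B.coord i y = B.coord i 0 * (1 - g y)

theorem ve_affine_line (f : V →ᵃ[ℝ] ℝ) (x : V) (ε : ℝ) :
    f ((1 + ε) • x) = f x + ε * (f x - f 0) := by
  have h : ∀ y, f y = f.linear y + f 0 := fun y => by
    have := f.map_vadd 0 y
    simpa using this
  rw [h ((1 + ε) • x), h x]; simp; ring

theorem GoodFacet.unique {n : ℕ} {B : AffineBasis (Fin (n + 2)) ℝ V} {g : Module.Dual ℝ V}
    {i j : Fin (n + 2)} (hi : GoodFacet B g i) (hj : GoodFacet B g j) : i = j := by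
  by_contra hij
  have h1 := hi.2 (B j)
  rw [B.coord_apply_ne hij] at h1
  have h2 := hj.2 (B j)
  rw [B.coord_apply_eq] at h2
  have h3 : 1 - g (B j) = 0 := by
    rcases mul_eq_zero.mp h1.symm with h | h
    · exact absurd h hi.1
    · exact h
  rw [h3] at h2; simp at h2

open Filter Topology in
theorem ve_jump {n : ℕ} (B : AffineBasis (Fin (n + 2)) ℝ V) (g : Module.Dual ℝ V) (x : V)
    (hx : g x = 1) (gen : ∀ j, ¬ GoodFacet B g j → B.coord j x ≠ 0) :
    ∀ᶠ ε : ℝ in 𝓝[>] 0,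
      (convexHull ℝ (range B)).indicator (1 : V → ℝ) ((1 + -ε) • x) -
      (convexHull ℝ (range B)).indicator (1 : V → ℝ) ((1 + ε) • x) =
      ∑ i, if GoodFacet B g i then
        Real.sign (B.coord i 0) * (if ∀ j, 0 ≤ B.coord (i.succAbove j) x then 1 else 0) else 0 := by
  have h1 : ∀ᶠ ε : ℝ in 𝓝[>] 0, ∀ j, ¬ GoodFacet B g j →
      ((0 ≤ B.coord j ((1 + -ε) • x) ↔ 0 ≤ B.coord j x) ∧
       (0 ≤ B.coord j ((1 + ε) • x) ↔ 0 ≤ B.coord j x)) := by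
    rw [eventually_all]
    intro j
    by_cases hj : GoodFacet B g j
    · simp [hj]
    · filter_upwards [ve_eventually_sign (B.coord j x - B.coord j 0) (gen j hj),
        ve_eventually_sign (-(B.coord j x - B.coord j 0)) (gen j hj)] with ε e1 e2 _
      rw [ve_affine_line, ve_affine_line]
      refine ⟨?_, e1⟩
      rw [← e2]; ring_nf
  filter_upwards [h1, self_mem_nhdsWithin] with ε hε hpos
  have hpos : 0 < ε := hpos
  rw [B.convexHull_eq_nonneg_coord]
  simp only [indicator_apply, mem_ofPred_eq, Pi.one_apply]
  by_cases hg : ∃ i, GoodFacet B g i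
  · obtain ⟨i, hi⟩ := hg
    have hother : ∀ j, j ≠ i → ¬ GoodFacet B g j := fun j hj h => hj (h.unique hi)
    rw [Finset.sum_eq_single i (fun j _ hj => if_neg (hother j hj)) (by simp), if_pos hi]
    set c := B.coord i 0 with hc
    have hP : ∀ y : V, (∀ j, 0 ≤ B.coord j y) ↔
        (0 ≤ B.coord i y ∧ ∀ j, 0 ≤ B.coord (i.succAbove j) y) := by
      intro y
      constructor
      · exact fun h => ⟨h i, fun j => h _⟩
      · rintro ⟨h1, h2⟩ j
        by_cases hj : j = i
        · rw [hj]; exact h1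
        · obtain ⟨k, rfl⟩ := Fin.exists_succAbove_eq hj
          exact h2 k
    have e1 : B.coord i ((1 + -ε) • x) = c * ε := by
      rw [hi.2, map_smul, hx, ← hc]; simp
    have e2 : B.coord i ((1 + ε) • x) = -(c * ε) := by
      rw [hi.2, map_smul, hx, ← hc]; simp
    have e3 : (∀ j, 0 ≤ B.coord (i.succAbove j) ((1 + -ε) • x)) ↔
        ∀ j, 0 ≤ B.coord (i.succAbove j) x :=
      forall_congr' fun j => (hε _ (hother _ (Fin.succAbove_ne i j))).1
    have e4 : (∀ j, 0 ≤ B.coord (i.succAbove j) ((1 + ε) • x)) ↔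
        ∀ j, 0 ≤ B.coord (i.succAbove j) x :=
      forall_congr' fun j => (hε _ (hother _ (Fin.succAbove_ne i j))).2
    simp only [hP, e1, e2, e3, e4]
    rcases lt_or_gt_of_ne hi.1 with h | h
    · have q1 : c * ε < 0 := mul_neg_of_neg_of_pos h hpos
      have q2 : 0 ≤ -(c * ε) := by linarith
      rw [Real.sign_of_neg h]
      simp only [not_le.mpr q1, q2, false_and, true_and, if_false]
      ring
    · have q1 : 0 < c * ε := mul_pos h hpos
      rw [Real.sign_of_pos h]
      simp [q1, q1.le]
  · push Not at hg
    have e3 : (∀ j, 0 ≤ B.coord j ((1 + -ε) • x)) ↔ ∀ j, 0 ≤ B.coord j x :=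
      forall_congr' fun j => (hε _ (hg j)).1
    have e4 : (∀ j, 0 ≤ B.coord j ((1 + ε) • x)) ↔ ∀ j, 0 ≤ B.coord j x :=
      forall_congr' fun j => (hε _ (hg j)).2
    simp [e3, e4, hg]

/-- Translation inclusion of the kernel. -/
def kerIncl (g : Module.Dual ℝ V) (b : V) : LinearMap.ker g →ᵃ[ℝ] V where
  toFun w := b + w
  linear := (LinearMap.ker g).subtype
  map_vadd' p w := by simp [add_left_comm]

@[simp] theorem kerIncl_apply (g : Module.Dual ℝ V) (b : V) (w : LinearMap.ker g) :
    kerIncl g b w = b + w := rfl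

theorem kerIncl_injective (g : Module.Dual ℝ V) (b : V) : Function.Injective (kerIncl g b) := by
  intro x y h
  simpa using h

theorem ve_facet_basis {n : ℕ} [FiniteDimensional ℝ V] (hV : Module.finrank ℝ V = n + 1)
    (B : AffineBasis (Fin (n + 2)) ℝ V) (g : Module.Dual ℝ V) (b : V) (hb : g b = 1)
    (i : Fin (n + 2)) (hi : GoodFacet B g i) :
    ∃ B' : AffineBasis (Fin (n + 1)) ℝ (LinearMap.ker g),
      (∀ j, b + (B' j : V) = B (i.succAbove j)) ∧
      ∀ w, w ∈ convexHull ℝ (range B') ↔ ∀ j, 0 ≤ B.coord (i.succAbove j) (b + w) := by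
  have hg : ∀ j, g (B (i.succAbove j)) = 1 := by
    intro j
    have h1 := hi.2 (B (i.succAbove j))
    rw [B.coord_apply_ne (Fin.succAbove_ne i j).symm] at h1
    rcases mul_eq_zero.mp h1.symm with h | h
    · exact absurd h hi.1
    · linarith
  let w : Fin (n + 1) → LinearMap.ker g := fun j => ⟨B (i.succAbove j) - b, by
    rw [LinearMap.mem_ker, map_sub, hg, hb, sub_self]⟩
  have hw : kerIncl g b ∘ w = B ∘ i.succAboveEmb := by
    funext j; simp [w]
  have hind : AffineIndependent ℝ w := by
    apply AffineIndependent.of_comp (kerIncl g b)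
    rw [hw]
    exact B.ind.comp_embedding i.succAboveEmb
  have hg0 : g ≠ 0 := by rintro rfl; simp at hb
  have hfr := Module.Dual.finrank_ker_add_one_of_ne_zero hg0
  have htop : affineSpan ℝ (range w) = ⊤ := by
    rw [hind.affineSpan_eq_top_iff_card_eq_finrank_add_one]
    simp; omega
  refine ⟨⟨w, hind, htop⟩, fun j => by change b + (B (i.succAbove j) - b) = _; abel, ?_⟩
  set B' : AffineBasis (Fin (n + 1)) ℝ (LinearMap.ker g) := ⟨w, hind, htop⟩ with hB'
  have hBw : ∀ j, B' j = w j := fun j => rfl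
  have hcoord : ∀ j, B'.coord j = (B.coord (i.succAbove j)).comp (kerIncl g b) := by
    intro j
    apply AffineMap.ext_on htop
    rintro _ ⟨k, rfl⟩
    have : kerIncl g b (w k) = B (i.succAbove k) := congrFun hw k
    rw [AffineMap.comp_apply, this, ← hBw, AffineBasis.coord_apply, AffineBasis.coord_apply]
    simp
  intro x
  rw [B'.convexHull_eq_nonneg_coord]
  simp [hcoord]

theorem SimpleFun.cone {n : ℕ} {φ : (Fin (n + 2) → V) → ℝ} (h : SimpleFun φ)
    (g : Module.Dual ℝ V) (b : V) :
    SimpleFun (fun w : Fin (n + 1) → LinearMap.ker g =>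
      φ (Fin.cons 0 (fun j => b + (w j : V)) : Fin (n + 2) → V)) where
  sym w σ := by
    rw [← h.sym (Fin.cons 0 (fun j => b + (w j : V)) : Fin (n + 2) → V)
      (Equiv.Perm.decomposeFin.symm (0, σ))]
    congr 1
    funext k
    refine Fin.cases ?_ (fun k => ?_) k
    · simp
    · simp
  deg w hw := by
    apply h.deg
    intro hind
    apply hw
    apply AffineIndependent.of_comp (kerIncl g b)
    exact hind.comp_embedding (Fin.succEmb (n + 1))
  cut w i j hij s t hs ht hst := by
    have := h.cut (Fin.cons 0 (fun j => b + (w j : V)) : Fin (n + 2) → V) i.succ j.succ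
      (by simpa using hij) s t hs ht hst
    rw [this]
    have hp : s • (b + (w i : V)) + t • (b + (w j : V)) = b + (s • (w i : V) + t • (w j : V)) := by
      have : b = (s + t) • b := by rw [hst, one_smul]
      nth_rw 3 [this]
      module
    simp only [Fin.cons_succ, hp]
    congr 2
    · funext k
      refine Fin.cases (by exact Function.update_of_ne (Fin.succ_ne_zero i).symm _ _) (fun k => ?_) k
      by_cases hk : k = i
      · subst hk; simp
      · simp [hk]
    · funext k
      refine Fin.cases (by exact Function.update_of_ne (Fin.succ_ne_zero j).symm _ _) (fun k => ?_) k
      by_cases hk : k = j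
      · subst hk; simp
      · simp [hk]

end


theorem ve_affine_decomp {V : Type} [AddCommGroup V] [Module ℝ V] (f : V →ᵃ[ℝ] ℝ) (y : V) :
    f y = f.linear y + f 0 := by
  have := f.map_vadd 0 y
  simpa using this

theorem ve_dual_decomp {V : Type} [AddCommGroup V] [Module ℝ V] (g : Module.Dual ℝ V) (b : V)
    (hb : g b = 1) (h : Module.Dual ℝ V) (h0 : h.comp (LinearMap.ker g).subtype = 0) (y : V) :
    h y = g y * h b := by
  have hm : y - g y • b ∈ LinearMap.ker g := by simp [hb]
  have := LinearMap.congr_fun h0 ⟨_, hm⟩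
  simp at this
  linarith

/-- A function given by finitely many simplices vanishing generically has zero value. -/
theorem simple_main (n : ℕ) : ∀ (V : Type) [AddCommGroup V] [Module ℝ V] [FiniteDimensional ℝ V],
    Module.finrank ℝ V = n → ∀ φ : (Fin (n + 1) → V) → ℝ, SimpleFun φ →
    ∀ (ι : Type) [Fintype ι] (a : ι → ℝ) (B : ι → AffineBasis (Fin (n + 1)) ℝ V)
      (H : Finset (Module.Dual ℝ V × ℝ)), (∀ p ∈ H, p.1 ≠ 0) →
      (∀ x, (∀ p ∈ H, p.1 x ≠ p.2) →
        ∑ k, a k * (convexHull ℝ (range (B k))).indicator (1 : V → ℝ) x = 0) →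
      ∑ k, a k * φ (B k) = 0 := by
  induction n with
  | zero =>
    intro V _ _ _ hV φ _ ι _ a B H hH hx
    have hsub : Subsingleton V := Module.finrank_zero_iff.mp hV
    have h1 := hx 0 (fun p hp => absurd (by ext y; rw [Subsingleton.elim y 0]; simp) (hH p hp))
    have h2 : ∀ k, (convexHull ℝ (range (B k))).indicator (1 : V → ℝ) 0 = 1 := by
      intro k
      rw [indicator_of_mem]
      · rfl
      · apply subset_convexHull
        exact ⟨0, Subsingleton.elim _ _⟩
    have h3 : ∀ k, φ (B k) = φ 0 := fun k => congrArg φ (Subsingleton.elim _ _)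
    simp only [h2, mul_one] at h1
    simp only [h3, ← Finset.sum_mul, h1, zero_mul]
  | succ n ih =>
    intro V _ _ _ hV φ hφ ι _ a B H hH hx
    -- the functional of a facet
    let gf : ι × Fin (n + 2) → Module.Dual ℝ V :=
      fun q => (-((B q.1).coord q.2 0)⁻¹) • ((B q.1).coord q.2).linear
    have hgf : ∀ q, (B q.1).coord q.2 0 ≠ 0 → ∀ g, gf q = g ↔ GoodFacet (B q.1) g q.2 := by
      intro q hq g
      constructor
      · rintro rfl
        refine ⟨hq, fun y => ?_⟩
        rw [ve_affine_decomp _ y]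
        simp only [gf, LinearMap.smul_apply, smul_eq_mul]
        field_simp
        ring
      · intro hg
        ext y
        have := hg.2 y
        rw [ve_affine_decomp _ y] at this
        simp only [gf, LinearMap.smul_apply, smul_eq_mul]
        have e : ((B q.1).coord q.2).linear y = - ((B q.1).coord q.2 0 * g y) := by linarith
        rw [e]; field_simp
    let F : ι × Fin (n + 2) → ℝ := fun q =>
      a q.1 * (Real.sign ((B q.1).coord q.2 0) * φ (Function.update (B q.1) q.2 0))
    have hsum : ∑ k, a k * φ (B k) = ∑ q : ι × Fin (n + 2), F q := by
      rw [Fintype.sum_prod_type]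
      refine Finset.sum_congr rfl fun k _ => ?_
      have := hφ.cocycle _ Finset.univ rfl (fun i => (B k).coord i 0)
        ((B k).sum_coord_apply_eq_one 0) (B k)
      rw [(B k).linear_combination_coord_eq_self] at this
      rw [this, Finset.mul_sum]
    rw [hsum, ← Finset.sum_filter_of_ne (p := fun q => (B q.1).coord q.2 0 ≠ 0)]
    swap
    · intro q _ hq h0
      apply hq
      simp [F, h0]
    rw [← Finset.sum_fiberwise_of_maps_to (g := gf) (t := Finset.univ.image gf)
      (fun q _ => Finset.mem_image_of_mem _ (Finset.mem_univ _))]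
    refine Finset.sum_eq_zero fun g _ => ?_
    rw [Finset.filter_filter]
    have hfilt : (Finset.univ.filter fun q : ι × Fin (n + 2) =>
        (B q.1).coord q.2 0 ≠ 0 ∧ gf q = g) =
        Finset.univ.filter fun q : ι × Fin (n + 2) => GoodFacet (B q.1) g q.2 := by
      ext q
      simp only [Finset.mem_filter, Finset.mem_univ, true_and]
      constructor
      · rintro ⟨h1, h2⟩; exact (hgf q h1 g).mp h2
      · intro h; exact ⟨h.1, (hgf q h.1 g).mpr h⟩
    rw [hfilt]
    by_cases hne : ∃ q : ι × Fin (n + 2), GoodFacet (B q.1) g q.2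
    swap
    · push Not at hne
      rw [Finset.filter_false_of_mem (fun q _ => hne q)]; simp
    -- base point
    obtain ⟨b, hb⟩ : ∃ b, g b = 1 := by
      obtain ⟨q, hq⟩ := hne
      obtain ⟨j, hj⟩ := exists_ne q.2
      refine ⟨B q.1 j, ?_⟩
      have h1 := hq.2 (B q.1 j)
      rw [(B q.1).coord_apply_ne hj.symm] at h1
      rcases mul_eq_zero.mp h1.symm with h | h
      · exact absurd h hq.1
      · linarith
    have hg0 : g ≠ 0 := by rintro rfl; simp at hb
    have hfr : Module.finrank ℝ (LinearMap.ker g) = n := by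
      have := Module.Dual.finrank_ker_add_one_of_ne_zero hg0
      omega
    let ι' := {q : ι × Fin (n + 2) // GoodFacet (B q.1) g q.2}
    have hex := fun q : ι' => ve_facet_basis hV (B q.1.1) g b hb q.1.2 q.2
    choose B' hB'1 hB'2 using hex
    let a' : ι' → ℝ := fun q => a q.1.1 * Real.sign ((B q.1.1).coord q.1.2 0)
    -- the new exceptional hyperplanes
    let res : Module.Dual ℝ V → Module.Dual ℝ (LinearMap.ker g) :=
      fun h => h.comp (LinearMap.ker g).subtype
    let H' : Finset (Module.Dual ℝ (LinearMap.ker g) × ℝ) :=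
      ((H.image fun p => (res p.1, p.2 - p.1 b)) ∪
        (Finset.univ.image fun q : ι × Fin (n + 2) =>
          (res ((B q.1).coord q.2).linear, - (B q.1).coord q.2 b))).filter fun p => p.1 ≠ 0
    have key := ih (LinearMap.ker g) hfr _ (hφ.cone g b) ι' a' B' H'
      (fun p hp => (Finset.mem_filter.mp hp).2) ?_
    · rw [← key, Finset.sum_subtype (p := fun q : ι × Fin (n + 2) => GoodFacet (B q.1) g q.2) _
        (fun q => by simp) F]
      refine Finset.sum_congr rfl fun q _ => ?_
      simp only [F, a', mul_assoc]
      congr 2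
      rw [← hφ.sym (Function.update (B q.1.1) q.1.2 0) q.1.2.cycleRange.symm]
      congr 1
      funext k
      refine Fin.cases ?_ (fun k => ?_) k
      · simp
      · simp [hB'1, Fin.succAbove_ne]
    · intro w hw
      set x : V := b + w with hxdef
      have hgw : g w = 0 := w.2
      have hgx : g x = 1 := by rw [hxdef, map_add, hb, hgw, add_zero]
      have gen : ∀ k j, ¬ GoodFacet (B k) g j → (B k).coord j x ≠ 0 := by
        intro k j hj h0
        by_cases hr : res ((B k).coord j).linear = 0
        · have hd := ve_dual_decomp g b hb _ hr
          have h1 := ve_affine_decomp ((B k).coord j) x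
          rw [hd x, hgx, h0] at h1
          have h2 : ∀ y, (B k).coord j y = (B k).coord j 0 * (1 - g y) := by
            intro y
            rw [ve_affine_decomp ((B k).coord j) y, hd y]
            have : ((B k).coord j).linear b = - (B k).coord j 0 := by linarith
            rw [this]; ring
          apply hj
          refine ⟨fun hc => ?_, h2⟩
          have := h2 (B k j)
          rw [hc, (B k).coord_apply_eq] at this
          simp at this
        · refine hw (res ((B k).coord j).linear, - (B k).coord j b) ?_ ?_
          · refine Finset.mem_filter.mpr ⟨Finset.mem_union_right _ ?_, hr⟩
            exact Finset.mem_image.mpr ⟨(k, j), Finset.mem_univ _, rfl⟩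
          · have h1 := ve_affine_decomp ((B k).coord j) x
            have h2 := ve_affine_decomp ((B k).coord j) b
            rw [h0, hxdef, LinearMap.map_add] at h1
            simp only [res, LinearMap.comp_apply, Submodule.subtype_apply]
            linarith
      have ev1 : ∀ᶠ ε : ℝ in nhdsWithin 0 (Ioi 0), ∀ k,
          (convexHull ℝ (range (B k))).indicator (1 : V → ℝ) ((1 + -ε) • x) -
          (convexHull ℝ (range (B k))).indicator (1 : V → ℝ) ((1 + ε) • x) =
          ∑ i, if GoodFacet (B k) g i then
            Real.sign ((B k).coord i 0) *
              (if ∀ j, 0 ≤ (B k).coord (i.succAbove j) x then 1 else 0) else 0 :=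
        Filter.eventually_all.mpr fun k => ve_jump (B k) g x hgx (gen k)
      have ev2 : ∀ᶠ ε : ℝ in nhdsWithin 0 (Ioi 0), ∀ p ∈ H,
          p.1 ((1 + -ε) • x) ≠ p.2 ∧ p.1 ((1 + ε) • x) ≠ p.2 := by
        rw [Filter.eventually_all_finset]
        intro p hp
        have hp' : p.1 x - p.2 ≠ 0 ∨ p.1 x ≠ 0 := by
          by_cases hr : res p.1 = 0
          · right
            have hd := ve_dual_decomp g b hb _ hr
            intro h0
            rw [hd x, hgx, one_mul] at h0
            apply hH p hp
            ext y
            rw [hd y, h0]; simp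
          · left
            intro h0
            refine hw (res p.1, p.2 - p.1 b) ?_ ?_
            · refine Finset.mem_filter.mpr ⟨Finset.mem_union_left _ ?_, hr⟩
              exact Finset.mem_image.mpr ⟨p, hp, rfl⟩
            · rw [hxdef, map_add] at h0
              simp only [res, LinearMap.comp_apply, Submodule.subtype_apply]
              linarith
        have hp'' : p.1 x - p.2 ≠ 0 ∨ -p.1 x ≠ 0 := hp'.imp id neg_ne_zero.mpr
        filter_upwards [ve_eventually_ne hp', ve_eventually_ne hp''] with ε e1 e2
        simp only [map_smul, smul_eq_mul]
        constructor
        · intro h; apply e2; linarith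
        · intro h; apply e1; linarith
      obtain ⟨ε, h1, h2⟩ := (ev1.and ev2).exists
      have z1 := hx _ (fun p hp => (h2 p hp).1)
      have z2 := hx _ (fun p hp => (h2 p hp).2)
      have z3 : ∑ k, a k * ((convexHull ℝ (range (B k))).indicator (1 : V → ℝ) ((1 + -ε) • x) -
          (convexHull ℝ (range (B k))).indicator (1 : V → ℝ) ((1 + ε) • x)) = 0 := by
        simp only [mul_sub, Finset.sum_sub_distrib, z1, z2, sub_zero]
      simp only [h1, Finset.mul_sum] at z3
      rw [← Fintype.sum_prod_type' (f := fun k i => a k * (if GoodFacet (B k) g i then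
            Real.sign ((B k).coord i 0) *
              (if ∀ j, 0 ≤ (B k).coord (i.succAbove j) x then 1 else 0) else 0))] at z3
      rw [← z3, ← Finset.sum_filter_of_ne
        (p := fun q : ι × Fin (n + 2) => GoodFacet (B q.1) g q.2)]
      swap
      · intro q _ hq
        by_contra hc
        exact hq (by simp [hc])
      rw [Finset.sum_subtype (p := fun q : ι × Fin (n + 2) => GoodFacet (B q.1) g q.2) _
        (fun q => by simp)]
      refine Finset.sum_congr rfl fun q _ => ?_
      rw [if_pos q.2]
      simp only [a', mul_assoc]
      congr 2
      simp only [indicator_apply, hB'2, Pi.one_apply, ← hxdef]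


theorem ve_mem_hull {V : Type} [AddCommGroup V] [Module ℝ V] {ι : Type} [Fintype ι] (v : ι → V)
    (x : V) : x ∈ convexHull ℝ (range v) ↔
      ∃ c : ι → ℝ, (∀ i, 0 ≤ c i) ∧ ∑ i, c i = 1 ∧ ∑ i, c i • v i = x := by
  constructor
  · intro hx
    rw [convexHull_range_eq_exists_affineCombination] at hx
    obtain ⟨s, w, h0, h1, rfl⟩ := hx
    refine ⟨fun i => if i ∈ s then w i else 0, fun i => ?_, ?_, ?_⟩
    · by_cases hi : i ∈ s
      · simp [hi, h0 i hi]
      · simp [hi]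
    · simpa using h1
    · rw [Finset.affineCombination_eq_linear_combination _ _ _ h1]
      simp [ite_smul]
  · rintro ⟨c, h0, h1, rfl⟩
    exact (convex_convexHull ℝ _).sum_mem (fun i _ => h0 i) h1
      (fun i _ => subset_convexHull _ _ ⟨i, rfl⟩)

section
variable {V : Type} [AddCommGroup V] [Module ℝ V] {n : ℕ}

theorem ve_indep_of_le {v u : Fin (n + 1) → V} (hv : AffineIndependent ℝ v)
    (h : range v ⊆ affineSpan ℝ (range u)) : AffineIndependent ℝ u := by
  rw [affineIndependent_iff_le_finrank_vectorSpan ℝ u (n := n) (by simp)]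
  rw [affineIndependent_iff_le_finrank_vectorSpan ℝ v (n := n) (by simp)] at hv
  refine hv.trans (Submodule.finrank_mono ?_)
  rw [← direction_affineSpan, ← direction_affineSpan]
  exact AffineSubspace.direction_le (affineSpan_le.mpr h)

theorem ve_comb_mem (s t : ℝ) (hst : s + t = 1) {x y : V} (D : AffineSubspace ℝ V) (hx : x ∈ D)
    (hy : y ∈ D) : s • x + t • y ∈ D := by
  have := AffineMap.lineMap_mem t hx hy
  rw [AffineMap.lineMap_apply_module] at this
  rwa [show s = 1 - t by linarith]

theorem ve_deg {v : Fin (n + 1) → V} (i j : Fin (n + 1)) (s t : ℝ) (hst : s + t = 1)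
    (k : Fin (n + 1)) (h : AffineIndependent ℝ (Function.update v k (s • v i + t • v j))) :
    AffineIndependent ℝ v := by
  apply ve_indep_of_le h
  rintro _ ⟨l, rfl⟩
  have hm : ∀ l, v l ∈ affineSpan ℝ (range v) := fun l => mem_affineSpan ℝ ⟨l, rfl⟩
  by_cases hl : l = k
  · subst hl; simp only [Function.update_self]
    exact ve_comb_mem s t hst _ (hm i) (hm j)
  · rw [Function.update_of_ne hl]; exact hm l

theorem ve_nondeg {v : Fin (n + 1) → V} (hv : AffineIndependent ℝ v) (i j : Fin (n + 1))
    (hij : i ≠ j) (s t : ℝ) (hs : 0 < s) (hst : s + t = 1) :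
    AffineIndependent ℝ (Function.update v i (s • v i + t • v j)) := by
  apply ve_indep_of_le hv
  set u := Function.update v i (s • v i + t • v j) with hu
  have hm : ∀ l, u l ∈ affineSpan ℝ (range u) := fun l => mem_affineSpan ℝ ⟨l, rfl⟩
  rintro _ ⟨l, rfl⟩
  by_cases hl : l = i
  · subst hl
    have e : v l = (1 / s) • u l + (-t / s) • u j := by
      rw [hu, Function.update_self, Function.update_of_ne hij.symm, smul_add, smul_smul, smul_smul,
        add_assoc, ← add_smul]
      have h1 : 1 / s * s = 1 := by field_simp
      have h2 : 1 / s * t + -t / s = 0 := by ring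
      rw [h1, h2]; simp
    rw [e]
    exact ve_comb_mem _ _ (by rw [← add_div, div_eq_one_iff_eq hs.ne']; linarith) _ (hm l) (hm j)
  · have : v l = u l := by rw [hu, Function.update_of_ne hl]
    rw [this]; exact hm l

end

section
variable {V : Type} [AddCommGroup V] [Module ℝ V] {n : ℕ}

theorem ve_sum_update (v : Fin (n + 1) → V) (i : Fin (n + 1)) (p : V) (c : Fin (n + 1) → ℝ) :
    ∑ k, c k • Function.update v i p k = ∑ k, c k • v k + c i • (p - v i) := by
  have : ∀ k, c k • Function.update v i p k = c k • v k + if k = i then c i • (p - v i) else 0 := by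
    intro k
    by_cases hk : k = i
    · subst hk; simp [smul_sub]
    · simp [hk]
  simp [this, Finset.sum_add_distrib]

theorem ve_half (v : Fin (n + 1) → V) (i j : Fin (n + 1)) (hij : i ≠ j) (s t : ℝ) (hs : 0 < s)
    (hst : s + t = 1) (c : Fin (n + 1) → ℝ) (h0 : ∀ i, 0 ≤ c i) (h1 : ∑ i, c i = 1)
    (hle : t * c i ≤ s * c j) :
    ∑ k, c k • v k ∈ convexHull ℝ (range (Function.update v i (s • v i + t • v j))) := by
  rw [ve_mem_hull]
  refine ⟨fun k => c k + (if k = i then c i / s - c i else 0) - (if k = j then t * c i / s else 0),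
    fun k => ?_, ?_, ?_⟩
  · by_cases hki : k = i
    · subst hki
      simp only [if_true, if_neg hij]
      have := div_nonneg (h0 k) hs.le
      linarith
    · by_cases hkj : k = j
      · subst hkj
        simp only [if_neg hki, if_true]
        have : t * c i / s ≤ c k := by rw [div_le_iff₀ hs]; linarith
        linarith
      · simp [hki, hkj, h0]
  · rw [Finset.sum_sub_distrib, Finset.sum_add_distrib, h1]
    simp
    have : t = 1 - s := by linarith
    subst this
    field_simp; ring
  · rw [ve_sum_update]
    simp only [sub_smul, add_smul, Finset.sum_sub_distrib, Finset.sum_add_distrib, ite_smul,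
      zero_smul, Finset.sum_ite_eq', Finset.mem_univ, if_true, if_neg hij]
    have ht : t = 1 - s := by linarith
    subst ht
    match_scalars <;> field_simp <;> ring

theorem ve_union (v : Fin (n + 1) → V) (i j : Fin (n + 1)) (hij : i ≠ j) (s t : ℝ) (hs : 0 < s)
    (ht : 0 < t) (hst : s + t = 1) :
    convexHull ℝ (range (Function.update v i (s • v i + t • v j))) ∪
      convexHull ℝ (range (Function.update v j (s • v i + t • v j))) = convexHull ℝ (range v) := by
  have hp : s • v i + t • v j ∈ convexHull ℝ (range v) :=
    (convex_convexHull ℝ (range v)) (subset_convexHull ℝ _ (mem_range_self i))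
      (subset_convexHull ℝ _ (mem_range_self j))
      hs.le ht.le hst
  have hsub : ∀ k, convexHull ℝ (range (Function.update v k (s • v i + t • v j))) ⊆
      convexHull ℝ (range v) := by
    intro k
    apply convexHull_min _ (convex_convexHull ℝ _)
    rintro _ ⟨l, rfl⟩
    by_cases hl : l = k
    · subst hl; rwa [Function.update_self]
    · rw [Function.update_of_ne hl]; exact subset_convexHull _ _ ⟨l, rfl⟩
  apply Subset.antisymm (union_subset (hsub i) (hsub j))
  intro x hx
  obtain ⟨c, h0, h1, rfl⟩ := (ve_mem_hull v x).1 hx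
  rcases le_total (t * c i) (s * c j) with h | h
  · left; exact ve_half v i j hij s t hs hst c h0 h1 h
  · right
    have := ve_half v j i hij.symm t s ht (by linarith) c h0 h1 h
    rwa [add_comm (t • v j)] at this

theorem ve_inter (v : Fin (n + 1) → V) (hv : AffineIndependent ℝ v) (i j : Fin (n + 1))
    (hij : i ≠ j) (s t : ℝ) (hs : 0 < s) (ht : 0 < t) (hst : s + t = 1) :
    convexHull ℝ (range (Function.update v i (s • v i + t • v j))) ∩
      convexHull ℝ (range (Function.update v j (s • v i + t • v j))) =
      convexHull ℝ ((Function.update v i (s • v i + t • v j)) '' {j}ᶜ) := by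
  set p := s • v i + t • v j with hp
  apply Subset.antisymm
  · rintro x ⟨hx, hx'⟩
    obtain ⟨α, a0, a1, rfl⟩ := (ve_mem_hull _ x).1 hx
    obtain ⟨β, b0, b1, hb⟩ := (ve_mem_hull _ _).1 hx'
    have haj : α j = 0 := by
      rw [ve_sum_update, ve_sum_update] at hb
      have key := (affineIndependent_iff.1 hv) Finset.univ
        (fun k => α k - β k + (if k = i then α i * (s - 1) - β j * s else 0) +
          (if k = j then α i * t - β j * (t - 1) else 0)) (by
          simp only [Finset.sum_add_distrib, Finset.sum_sub_distrib, Finset.sum_ite_eq',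
            Finset.mem_univ, if_true, a1, b1]
          have : t = 1 - s := by linarith
          subst this; ring) (by
          simp only [sub_smul, add_smul, Finset.sum_sub_distrib, Finset.sum_add_distrib, ite_smul,
            zero_smul, Finset.sum_ite_eq', Finset.mem_univ, if_true]
          rw [← sub_eq_zero] at hb
          rw [← neg_eq_zero, ← hb, hp]
          module)
      have ki := key i (Finset.mem_univ _)
      have kj := key j (Finset.mem_univ _)
      simp only [if_true, if_neg hij, if_neg hij.symm] at ki kj
      have h1 : s * (α i - β j) = β i := by linarith
      have h2 : α j = t * (β j - α i) := by linarith
      have h3 : 0 ≤ α i - β j := by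
        by_contra h
        have := mul_neg_of_pos_of_neg hs (not_le.1 h)
        linarith [b0 i]
      have h4 := mul_nonneg ht.le h3
      have := a0 j
      linarith
    have hs1 : ∑ k ∈ ({j}ᶜ : Finset (Fin (n+1))), α k = 1 := by
      rw [← a1, ← Finset.sum_compl_add_sum {j}]; simp [haj]
    have hs2 : ∑ k ∈ ({j}ᶜ : Finset (Fin (n+1))), α k • Function.update v i p k =
        ∑ k, α k • Function.update v i p k := by
      rw [← Finset.sum_compl_add_sum {j}]; simp [haj]
    rw [← hs2]
    refine (convex_convexHull ℝ _).sum_mem (fun k _ => a0 k) hs1 (fun k hk => ?_)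
    apply subset_convexHull
    exact ⟨k, by simpa using hk, rfl⟩
  · apply subset_inter
    · exact convexHull_mono (image_subset_range _ _)
    · apply convexHull_mono
      rintro _ ⟨k, hk, rfl⟩
      by_cases hki : k = i
      · subst hki; exact ⟨j, by simp⟩
      · refine ⟨k, ?_⟩
        rw [Function.update_of_ne hki, Function.update_of_ne (by simpa using hk)]

end


def phi0 {N n : ℕ} (ψ : Set (Euc N) → ℝ) (v : Fin (n + 1) → Euc N) : ℝ :=
  if AffineIndependent ℝ v then ψ (convexHull ℝ (range v)) else 0

theorem phi0_simple {N n : ℕ} (ψ : Set (Euc N) → ℝ) (hψ : IsValuation (simplexClass N n) ψ)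
    (h0 : ∀ k < n, ∀ S, IsSimplex k S → ψ S = 0) :
    SimpleFun (phi0 ψ : (Fin (n + 1) → Euc N) → ℝ) where
  sym v σ := by
    unfold phi0
    have : AffineIndependent ℝ (v ∘ σ) ↔ AffineIndependent ℝ v := affineIndependent_equiv σ
    rw [σ.surjective.range_comp]
    simp only [this]
  deg v hv := by simp [phi0, hv]
  cut v i j hij s t hs ht hst := by
    unfold phi0
    by_cases hv : AffineIndependent ℝ v
    · have hi := ve_nondeg hv i j hij s t hs hst
      have hj := ve_nondeg hv j i hij.symm t s ht (by linarith)
      rw [add_comm (t • v j)] at hj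
      rw [if_pos hv, if_pos hi, if_pos hj]
      have hU := ve_union v i j hij s t hs ht hst
      have hI := ve_inter v hv i j hij s t hs ht hst
      have hz : IsSimplex (n - 1) (convexHull ℝ
          ((Function.update v i (s • v i + t • v j)) '' {j}ᶜ)) ∧ n - 1 < n := by
        obtain ⟨m, rfl⟩ : ∃ m, n = m + 1 := by
          cases n with
          | zero => exact absurd (Fin.ext (by omega)) hij
          | succ m => exact ⟨m, rfl⟩
        refine ⟨⟨Function.update v i (s • v i + t • v j) ∘ j.succAbove, ?_, ?_⟩, by omega⟩
        · exact hi.comp_embedding j.succAboveEmb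
        · rw [range_comp, Fin.range_succAbove]
      have hval := hψ.2 _ (Or.inr ⟨n, le_rfl, _, hi, rfl⟩) _ (Or.inr ⟨n, le_rfl, _, hj, rfl⟩)
        (by rw [hU]; exact Or.inr ⟨n, le_rfl, _, hv, rfl⟩)
        (by rw [hI]; exact Or.inr ⟨n - 1, by omega, hz.1⟩)
      rw [hU, hI, h0 _ hz.2 _ hz.1] at hval
      linarith
    · have hi : ¬ AffineIndependent ℝ (Function.update v i (s • v i + t • v j)) :=
        fun h => hv (ve_deg i j s t hst i h)
      have hj : ¬ AffineIndependent ℝ (Function.update v j (s • v i + t • v j)) :=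
        fun h => hv (ve_deg i j s t hst j h)
      simp [hv, hi, hj]

theorem SimpleFun.comap {V W : Type} [AddCommGroup V] [Module ℝ V] [AddCommGroup W] [Module ℝ W]
    {ι : Type} [Fintype ι] [DecidableEq ι] {φ : (ι → V) → ℝ} (h : SimpleFun φ) (f : W →ᵃ[ℝ] V)
    (_hf : Function.Injective f) : SimpleFun (fun w : ι → W => φ (f ∘ w)) where
  sym v σ := h.sym (f ∘ v) σ
  deg v hv := h.deg _ (fun h' => hv (AffineIndependent.of_comp f h'))
  cut v i j hij s t hs ht hst := by
    have e := h.cut (f ∘ v) i j hij s t hs ht hst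
    have e2 : f (s • v i + t • v j) = s • f (v i) + t • f (v j) := by
      have := Convex.combo_affine_apply (f := f) (x := v i) (y := v j) hst
      exact this
    simp only [Function.comp_update, e2]
    exact e

theorem ve_hyper {W : Type} [AddCommGroup W] [Module ℝ W] (D : AffineSubspace ℝ W) (hD : D ≠ ⊤) :
    ∃ H : Finset (Module.Dual ℝ W × ℝ), (∀ p ∈ H, p.1 ≠ 0) ∧ ∀ w ∈ D, ∃ p ∈ H, p.1 w = p.2 := by
  by_cases hne : (D : Set W).Nonempty
  · obtain ⟨w0, hw0⟩ := hne
    have hdir : D.direction < ⊤ := by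
      rw [lt_top_iff_ne_top]
      intro h
      exact hD ((AffineSubspace.direction_eq_top_iff_of_nonempty ⟨w0, hw0⟩).1 h)
    obtain ⟨f, hf, hle⟩ := Submodule.exists_le_ker_of_lt_top _ hdir
    refine ⟨{(f, f w0)}, by simpa using hf, fun w hw => ⟨(f, f w0), by simp, ?_⟩⟩
    have := hle (AffineSubspace.vsub_mem_direction hw hw0)
    simp [sub_eq_zero] at this
    exact this
  · exact ⟨∅, by simp, fun w hw => absurd ⟨w, hw⟩ hne⟩

theorem ve_factor {M M' : Type} [AddCommGroup M] [Module ℝ M] [AddCommGroup M'] [Module ℝ M']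
    (A : M →ₗ[ℝ] M') (B : M →ₗ[ℝ] ℝ) (h : ∀ x, A x = 0 → B x = 0) :
    ∃ L : M' →ₗ[ℝ] ℝ, ∀ x, L (A x) = B x := by
  have : B ∈ LinearMap.range A.dualMap := by
    rw [LinearMap.range_dualMap_eq_dualAnnihilator_ker, Submodule.mem_dualAnnihilator]
    intro x hx; exact h x hx
  obtain ⟨L, hL⟩ := this
  exact ⟨L, fun x => by rw [← hL]; rfl⟩

theorem IsSimplex.span {N k : ℕ} {S : Set (Euc N)} (v : Fin (k + 1) → Euc N)
    (hv : AffineIndependent ℝ v) (hS : S = convexHull ℝ (range v)) :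
    Module.finrank ℝ (affineSpan ℝ S).direction = k := by
  rw [hS, affineSpan_convexHull, direction_affineSpan]
  exact hv.finrank_vectorSpan (by simp)


theorem ve_group {N n : ℕ} (ψ : Set (Euc N) → ℝ) (hψ : IsValuation (simplexClass N n) ψ)
    (h0 : ∀ k < n, ∀ S, IsSimplex k S → ψ S = 0) (F : Finset (Set (Euc N)))
    (a : Set (Euc N) → ℝ) (hF : ∀ S ∈ F, S ∈ simplexClass N n)
    (hz : ∀ x, ∑ S ∈ F, a S * S.indicator (1 : Euc N → ℝ) x = 0)
    (E : AffineSubspace ℝ (Euc N)) :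
    ∑ S ∈ F with (IsSimplex n S ∧ affineSpan ℝ S = E), a S * ψ S = 0 := by
  set G := F.filter (fun S => IsSimplex n S ∧ affineSpan ℝ S = E) with hG
  by_cases hGne : G.Nonempty
  swap
  · rw [Finset.not_nonempty_iff_eq_empty.1 hGne]; simp
  obtain ⟨S0, hS0⟩ := hGne
  have hGF : ∀ S ∈ G, S ∈ F ∧ IsSimplex n S ∧ affineSpan ℝ S = E := fun S hS => by
    simpa [hG] using hS
  have hfin : Module.finrank ℝ E.direction = n := by
    obtain ⟨-, ⟨v, hv, hS⟩, hE⟩ := hGF S0 hS0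
    rw [← hE]; exact IsSimplex.span v hv hS
  obtain ⟨b, hb⟩ : ∃ b, b ∈ E := by
    obtain ⟨-, ⟨v, hv, hS⟩, hE⟩ := hGF S0 hS0
    refine ⟨v 0, ?_⟩
    rw [← hE, hS, affineSpan_convexHull]
    exact mem_affineSpan ℝ ⟨0, rfl⟩
  let f : E.direction →ᵃ[ℝ] Euc N := E.direction.subtype.toAffineMap + AffineMap.const ℝ _ b
  have hf : ∀ w, f w = (w : Euc N) + b := fun w => rfl
  have hinj : Function.Injective f := fun x y h => by
    rw [hf, hf] at h; exact Subtype.ext (add_right_cancel h)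
  have hvert : ∀ S : G, ∃ B : AffineBasis (Fin (n + 1)) ℝ E.direction,
      AffineIndependent ℝ (f ∘ B) ∧ (S : Set (Euc N)) = convexHull ℝ (range (f ∘ B)) := by
    rintro ⟨S, hS⟩
    obtain ⟨-, ⟨v, hv, hSv⟩, hE⟩ := hGF S hS
    have hvE : ∀ i, v i ∈ E := fun i => by
      rw [← hE, hSv, affineSpan_convexHull]; exact mem_affineSpan ℝ ⟨i, rfl⟩
    let w : Fin (n + 1) → E.direction := fun i =>
      ⟨v i - b, AffineSubspace.vsub_mem_direction (hvE i) hb⟩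
    have hfw : f ∘ w = v := by
      funext i; simp [hf, w]
    have hw : AffineIndependent ℝ w := AffineIndependent.of_comp f (by rw [hfw]; exact hv)
    refine ⟨⟨w, hw, ?_⟩, ?_, ?_⟩
    · rw [hw.affineSpan_eq_top_iff_card_eq_finrank_add_one, hfin]; simp
    · change AffineIndependent ℝ (f ∘ w); rw [hfw]; exact hv
    · change S = convexHull ℝ (range (f ∘ w)); rw [hfw]; exact hSv
  choose B hB1 hB2 using hvert
  have hcov : ∀ S ∈ F \ G, ∃ H : Finset (Module.Dual ℝ E.direction × ℝ), (∀ p ∈ H, p.1 ≠ 0) ∧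
      ∀ w, f w ∈ S → ∃ p ∈ H, p.1 w = p.2 := by
    intro S hS
    rw [Finset.mem_sdiff] at hS
    have hD : (affineSpan ℝ S).comap f ≠ ⊤ := by
      intro htop
      have hle : E ≤ affineSpan ℝ S := by
        intro x hx
        have : (⟨x - b, AffineSubspace.vsub_mem_direction hx hb⟩ : E.direction) ∈
          (affineSpan ℝ S).comap f := by rw [htop]; trivial
        rw [AffineSubspace.mem_comap, hf] at this
        simpa using this
      rcases hF S hS.1 with rfl | ⟨k, hk, v, hv, hSv⟩
      · have := hle hb
        rw [AffineSubspace.span_empty] at this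
        exact AffineSubspace.notMem_bot ℝ _ b this
      · have hd := IsSimplex.span v hv hSv
        have hle' := AffineSubspace.direction_le hle
        have hfl := Submodule.finrank_mono hle'
        have hkn : k = n := by omega
        subst hkn
        have hde := Submodule.eq_of_le_of_finrank_eq hle' (by omega)
        have heq := AffineSubspace.eq_of_direction_eq_of_nonempty_of_le hde ⟨b, hb⟩ hle
        apply hS.2
        rw [hG, Finset.mem_filter]
        exact ⟨hS.1, ⟨v, hv, hSv⟩, heq.symm⟩
    obtain ⟨H, h1, h2⟩ := ve_hyper _ hD
    exact ⟨H, h1, fun w hw => h2 w (mem_affineSpan ℝ hw)⟩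
  choose! H hH1 hH2 using hcov
  have hmain := simple_main n E.direction hfin _ ((phi0_simple ψ hψ h0).comap f hinj) G
    (fun S => a S) B ((F \ G).biUnion H)
    (fun p hp => by
      obtain ⟨S, hS, hp⟩ := Finset.mem_biUnion.1 hp
      exact hH1 S hS p hp)
    (fun x hx => by
      have e : ∀ S : G, (convexHull ℝ (range (B S))).indicator (1 : E.direction → ℝ) x =
          (S : Set (Euc N)).indicator (1 : Euc N → ℝ) (f x) := by
        intro S
        have : f x ∈ (S : Set (Euc N)) ↔ x ∈ convexHull ℝ (range (B S)) := by
          conv_lhs => rw [hB2 S, range_comp, ← AffineMap.image_convexHull]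
          exact hinj.mem_set_image
        by_cases hm : x ∈ convexHull ℝ (range (B S))
        · rw [indicator_of_mem hm, indicator_of_mem (this.2 hm)]; rfl
        · rw [indicator_of_notMem hm, indicator_of_notMem (fun h => hm (this.1 h))]
      simp only [e]
      rw [Finset.sum_coe_sort G (fun S => a S * S.indicator (1 : Euc N → ℝ) (f x))]
      rw [← hz (f x)]
      apply Finset.sum_subset (fun S hS => (hGF S hS).1)
      intro S hS hSG
      rw [indicator_of_notMem, mul_zero]
      intro hm
      have hSd := Finset.mem_sdiff.2 ⟨hS, hSG⟩
      obtain ⟨p, hp, hpe⟩ := hH2 S hSd x hm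
      exact hx p (Finset.mem_biUnion.2 ⟨S, hSd, hp⟩) hpe)
  rw [← hmain, ← Finset.sum_coe_sort G]
  refine Finset.sum_congr rfl (fun S _ => ?_)
  rw [phi0, if_pos (hB1 S), ← hB2 S]

theorem ve_kernel {N n : ℕ} (ψ : Set (Euc N) → ℝ) (hψ : IsValuation (simplexClass N n) ψ)
    (h0 : ∀ k < n, ∀ S, IsSimplex k S → ψ S = 0) (F : Finset (Set (Euc N)))
    (a : Set (Euc N) → ℝ) (hF : ∀ S ∈ F, S ∈ simplexClass N n)
    (hz : ∀ x, ∑ S ∈ F, a S * S.indicator (1 : Euc N → ℝ) x = 0) :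
    ∑ S ∈ F, a S * ψ S = 0 := by
  have e1 : ∑ S ∈ F, a S * ψ S = ∑ S ∈ F with IsSimplex n S, a S * ψ S := by
    symm
    apply Finset.sum_subset (Finset.filter_subset _ _)
    intro S hS hS'
    have : ψ S = 0 := by
      rcases hF S hS with rfl | ⟨k, hk, hs⟩
      · exact hψ.1
      · rcases hk.lt_or_eq with h | rfl
        · exact h0 k h S hs
        · exact absurd (Finset.mem_filter.2 ⟨hS, hs⟩) hS'
    rw [this, mul_zero]
  rw [e1, ← Finset.sum_fiberwise_of_maps_to (t := F.image (fun S => affineSpan ℝ S))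
    (g := fun S => affineSpan ℝ S)
    (fun S hS => Finset.mem_image_of_mem _ (Finset.mem_filter.1 hS).1)]
  apply Finset.sum_eq_zero
  intro E _
  rw [Finset.filter_filter]
  exact ve_group ψ hψ h0 F a hF hz E

theorem ve_linext {N : ℕ} (X : Set (Set (Euc N))) (ψ : Set (Euc N) → ℝ)
    (h : ∀ (F : Finset (Set (Euc N))) (a : Set (Euc N) → ℝ), (∀ S ∈ F, S ∈ X) →
      (∀ x, ∑ S ∈ F, a S * S.indicator (1 : Euc N → ℝ) x = 0) → ∑ S ∈ F, a S * ψ S = 0) :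
    ∃ L : (Euc N → ℝ) →ₗ[ℝ] ℝ, ∀ S ∈ X, L (S.indicator 1) = ψ S := by
  obtain ⟨L, hL⟩ := ve_factor
    (Finsupp.linearCombination ℝ (fun S : X => (S : Set (Euc N)).indicator (1 : Euc N → ℝ)))
    (Finsupp.linearCombination ℝ (fun S : X => ψ S)) (by
      intro c hc
      rw [Finsupp.linearCombination_apply, Finsupp.sum] at hc ⊢
      let a : Set (Euc N) → ℝ := fun S => if hS : S ∈ X then c ⟨S, hS⟩ else 0
      have ha : ∀ S : X, a S = c S := fun S => by simp [a]
      have := h (c.support.map (Function.Embedding.subtype _)) a (by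
        intro S hS
        obtain ⟨T, -, rfl⟩ := Finset.mem_map.1 hS
        exact T.2) (by
        intro x
        rw [Finset.sum_map]
        have := congrFun hc x
        simp only [Finset.sum_apply, Pi.smul_apply, smul_eq_mul, Pi.zero_apply] at this
        rw [← this]
        refine Finset.sum_congr rfl (fun S _ => ?_)
        simp [ha])
      rw [Finset.sum_map] at this
      rw [← this]
      refine Finset.sum_congr rfl (fun S _ => ?_)
      simp [ha])
  refine ⟨L, fun S hS => ?_⟩
  have := hL (Finsupp.single ⟨S, hS⟩ 1)
  simpa using this

theorem ve_exists_lin {N : ℕ} (n : ℕ) : ∀ (μ : Set (Euc N) → ℝ), IsValuation (simplexClass N n) μ →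
    ∃ L : (Euc N → ℝ) →ₗ[ℝ] ℝ, ∀ S ∈ simplexClass N n, L (S.indicator 1) = μ S := by
  have step : ∀ n (μ : Set (Euc N) → ℝ), IsValuation (simplexClass N n) μ →
      (∃ L : (Euc N → ℝ) →ₗ[ℝ] ℝ, ∀ k < n, ∀ S, IsSimplex k S → L (S.indicator 1) = μ S) →
      ∃ L : (Euc N → ℝ) →ₗ[ℝ] ℝ, ∀ S ∈ simplexClass N n, L (S.indicator 1) = μ S := by
    rintro n μ hμ ⟨L, hL⟩
    have hlin : ∀ A B : Set (Euc N), L (A.indicator 1) + L (B.indicator 1) =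
        L ((A ∪ B).indicator 1) + L ((A ∩ B).indicator 1) := by
      intro A B
      rw [← map_add, ← map_add, indicator_union_add_inter]
    obtain ⟨L2, hL2⟩ := ve_linext (simplexClass N n) (fun S => μ S - L (S.indicator 1))
      (ve_kernel _ ⟨by
        beta_reduce
        rw [hμ.1, indicator_empty]
        exact (sub_eq_zero.2 (map_zero L).symm), fun A hA B hB hU hI => by
        have h1 := hμ.2 A hA B hB hU hI
        have h2 := hlin A B
        linarith⟩ (fun k hk S hS => by rw [hL k hk S hS, sub_self]))
    refine ⟨L + L2, fun S hS => ?_⟩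
    rw [LinearMap.add_apply, hL2 S hS]; ring
  induction n with
  | zero => exact fun μ hμ => step 0 μ hμ ⟨0, fun k hk => absurd hk (by omega)⟩
  | succ m ih =>
    intro μ hμ
    have hsub : ∀ S, S ∈ simplexClass N m → S ∈ simplexClass N (m + 1) := by
      rintro S (h | ⟨k, hk, h⟩)
      · exact Or.inl h
      · exact Or.inr ⟨k, by omega, h⟩
    obtain ⟨L, hL⟩ := ih μ ⟨hμ.1, fun A hA B hB hU hI =>
      hμ.2 A (hsub _ hA) B (hsub _ hB) (hsub _ hU) (hsub _ hI)⟩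
    exact step _ μ hμ ⟨L, fun k hk S hS => hL S (Or.inr ⟨k, by omega, hS⟩)⟩


theorem ve_theta (s t x y : ℝ) (hs : 0 < s) (ht : 0 < t) (hx : 0 ≤ x) (hy : 0 ≤ y) :
    ∃ θ θ' κ : ℝ, 0 ≤ θ ∧ 0 ≤ θ' ∧ 0 ≤ κ ∧ θ + θ' = 1 ∧ θ * x = t * κ ∧ θ' * y = s * κ := by
  have hA : 0 ≤ s * x := by positivity
  have hB : 0 ≤ t * y := by positivity
  by_cases h : s * x + t * y = 0
  · have : x = 0 := by
      have h1 : s * x = 0 := by linarith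
      rcases mul_eq_zero.1 h1 with h2 | h2
      · exact absurd h2 hs.ne'
      · exact h2
    exact ⟨1, 0, 0, by norm_num, le_rfl, le_rfl, by norm_num, by simp [this], by simp⟩
  · refine ⟨t * y / (s * x + t * y), s * x / (s * x + t * y), x * y / (s * x + t * y),
      by positivity, by positivity, by positivity, ?_, ?_, ?_⟩ <;> field_simp
    ring

section
variable {V : Type} [AddCommGroup V] [Module ℝ V] {n : ℕ}

/-- The intersection of the two halves, without any independence assumption. -/
theorem ve_inter_gen (v : Fin (n + 1) → V) (i j : Fin (n + 1))
    (hij : i ≠ j) (s t : ℝ) (hs : 0 < s) (ht : 0 < t) (hst : s + t = 1) :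
    convexHull ℝ (range (Function.update v i (s • v i + t • v j))) ∩
      convexHull ℝ (range (Function.update v j (s • v i + t • v j))) =
      convexHull ℝ ((Function.update v i (s • v i + t • v j)) '' {j}ᶜ) := by
  set q := s • v i + t • v j with hq
  apply Subset.antisymm
  · rintro x ⟨hx, hx'⟩
    obtain ⟨α, a0, a1, ha⟩ := (ve_mem_hull _ x).1 hx
    obtain ⟨β, b0, b1, hb⟩ := (ve_mem_hull _ _).1 hx'
    obtain ⟨θ, θ', κ, h0, h0', hk, h1, e1, e2⟩ := ve_theta s t (α j) (β i) hs ht (a0 j) (b0 i)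
    rw [ve_sum_update] at ha hb
    let γ : Fin (n + 1) → ℝ := fun k => θ * α k + θ' * β k +
      (if k = i then θ' * β j - s * κ + κ else 0) - (if k = j then t * κ + θ' * β j else 0)
    have gj : γ j = 0 := by
      simp only [γ, if_neg hij.symm, if_true]; linarith
    have gi : γ i = θ * α i + θ' * β j + κ := by
      simp only [γ, if_neg hij, if_true]; linarith
    have g0 : ∀ k, 0 ≤ γ k := by
      intro k
      by_cases hki : k = i
      · subst hki; rw [gi]
        have := mul_nonneg h0 (a0 k)
        have := mul_nonneg h0' (b0 j)
        linarith
      · by_cases hkj : k = j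
        · subst hkj; rw [gj]
        · have := mul_nonneg h0 (a0 k)
          have := mul_nonneg h0' (b0 k)
          simp only [γ, if_neg hki, if_neg hkj]; linarith
    have g1 : ∑ k, γ k = 1 := by
      simp only [γ, Finset.sum_add_distrib, Finset.sum_sub_distrib, Finset.sum_ite_eq',
            Finset.mem_univ, if_true, ← Finset.mul_sum, a1, b1]
      have : t = 1 - s := by linarith
      subst this
      linarith
    have gv : ∑ k, γ k • Function.update v i q k = x := by
      rw [ve_sum_update, gi]
      simp only [γ, sub_smul, add_smul, Finset.sum_sub_distrib, Finset.sum_add_distrib, ite_smul,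
            zero_smul, Finset.sum_ite_eq', Finset.mem_univ, if_true, mul_smul, ← Finset.smul_sum]
      rw [eq_sub_of_add_eq ha, eq_sub_of_add_eq hb]
      have : θ' = 1 - θ := by linarith
      subst this
      rw [hq]
      module
    have hs1 : ∑ k ∈ ({j}ᶜ : Finset (Fin (n+1))), γ k = 1 := by
      rw [← g1, ← Finset.sum_compl_add_sum {j}]; simp [gj]
    have hs2 : ∑ k ∈ ({j}ᶜ : Finset (Fin (n+1))), γ k • Function.update v i q k = x := by
      rw [← gv, ← Finset.sum_compl_add_sum {j}]; simp [gj]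
    rw [← hs2]
    refine (convex_convexHull ℝ _).sum_mem (fun k _ => g0 k) hs1 (fun k hk => ?_)
    apply subset_convexHull
    exact ⟨k, by simpa using hk, rfl⟩
  · apply subset_inter
    · exact convexHull_mono (image_subset_range _ _)
    · apply convexHull_mono
      rintro _ ⟨k, hk, rfl⟩
      by_cases hki : k = i
      · subst hki; exact ⟨j, by simp⟩
      · refine ⟨k, ?_⟩
        rw [Function.update_of_ne hki, Function.update_of_ne (by simpa using hk)]

theorem ve_compl_range (v : Fin (n + 2) → V) (j : Fin (n + 2)) :
    v '' {j}ᶜ = range (v ∘ j.succAbove) := by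
  rw [range_comp, Fin.range_succAbove]

end

theorem ve_class {N n m : ℕ} (v : Fin (m + 1) → Euc N) {P : Set (Euc N)} (hP : sdim P ≤ n)
    (h : convexHull ℝ (range v) ⊆ P) : convexHull ℝ (range v) ∈ polytopeClass N n := by
  refine Or.inr ⟨⟨Finset.univ.image v, Finset.univ_nonempty.image v, by simp⟩, ?_⟩
  refine le_trans (Submodule.finrank_mono (vectorSpan_mono ℝ h)) hP

theorem ve_uniq {N n : ℕ} (δ : Set (Euc N) → ℝ) (hδ : IsValuation (polytopeClass N n) δ)
    (h0 : ∀ S ∈ simplexClass N n, δ S = 0) (m : ℕ) : ∀ v : Fin (m + 1) → Euc N,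
    sdim (convexHull ℝ (range v)) ≤ n → δ (convexHull ℝ (range v)) = 0 := by
  have hsimp : ∀ m (v : Fin (m + 1) → Euc N), sdim (convexHull ℝ (range v)) ≤ n →
      AffineIndependent ℝ v → δ (convexHull ℝ (range v)) = 0 := by
    intro m v hd hv
    apply h0
    refine Or.inr ⟨m, ?_, v, hv, rfl⟩
    have := IsSimplex.span v hv rfl
    rw [direction_affineSpan] at this
    rw [← this]; exact hd
  induction m with
  | zero =>
    intro v hd
    haveI : Subsingleton (Fin (0 + 1)) := inferInstanceAs (Subsingleton (Fin 1))
    exact hsimp 0 v hd (affineIndependent_of_subsingleton ℝ v)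
  | succ m ih =>
    have inner : ∀ (k : ℕ) (v : Fin (m + 2) → Euc N) (l : Fin (m + 2) → ℝ),
        sdim (convexHull ℝ (range v)) ≤ n → ∑ i, l i = 0 → ∑ i, l i • v i = 0 →
        (∃ i, 0 < l i) → (Finset.univ.filter (fun i => 0 < l i)).card ≤ k →
        δ (convexHull ℝ (range v)) = 0 := by
      intro k
      induction k with
      | zero =>
        rintro v l - - - ⟨i, hi⟩ hc
        rw [Nat.le_zero, Finset.card_eq_zero] at hc
        have : i ∈ Finset.univ.filter (fun i => 0 < l i) := by simp [hi]
        rw [hc] at this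
        simp at this
      | succ k ihk =>
        rintro v l hd hl hlv ⟨i, hi⟩ hc
        by_cases hj : ∃ j, i ≠ j ∧ 0 < l j
        · obtain ⟨j, hij, hj⟩ := hj
          have hpos : 0 < l i + l j := by linarith
          obtain ⟨s, hs⟩ : ∃ s, s = l i / (l i + l j) := ⟨_, rfl⟩
          obtain ⟨t, ht⟩ : ∃ t, t = l j / (l i + l j) := ⟨_, rfl⟩
          have hs0 : 0 < s := by rw [hs]; positivity
          have ht0 : 0 < t := by rw [ht]; positivity
          have hst : s + t = 1 := by rw [hs, ht]; field_simp
          have hls : (l i + l j) * s = l i := by rw [hs]; field_simp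
          have hlt : (l i + l j) * t = l j := by rw [ht]; field_simp
          have hU := ve_union v i j hij s t hs0 ht0 hst
          have hI := ve_inter_gen v i j hij s t hs0 ht0 hst
          set q := s • v i + t • v j with hq
          have hqe : (l i + l j) • q = l i • v i + l j • v j := by
            rw [hq, smul_add, smul_smul, smul_smul, hls, hlt]
          rw [ve_compl_range] at hI
          -- each half has a relation with fewer positive coefficients
          have half : ∀ i j, i ≠ j → 0 < l i → 0 < l j →
              (l i + l j) • q = l i • v i + l j • v j →
              sdim (convexHull ℝ (range (Function.update v i q))) ≤ n →
              δ (convexHull ℝ (range (Function.update v i q))) = 0 := by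
            intro i j hij hi hj hqe hd'
            let l' : Fin (m + 2) → ℝ := fun k => l k + (if k = i then l j else 0) -
              (if k = j then l j else 0)
            have l'i : l' i = l i + l j := by simp [l', hij]
            have l'j : l' j = 0 := by simp [l', hij.symm]
            have l'k : ∀ k, k ≠ i → k ≠ j → l' k = l k := fun k h1 h2 => by simp [l', h1, h2]
            refine ihk _ l' hd' ?_ ?_ ⟨i, by rw [l'i]; linarith⟩ ?_
            · simp [l', Finset.sum_add_distrib, hl]
            · rw [ve_sum_update, l'i, smul_sub, hqe]
              simp only [l', sub_smul, add_smul, Finset.sum_sub_distrib, Finset.sum_add_distrib,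
                ite_smul, zero_smul, Finset.sum_ite_eq', Finset.mem_univ, if_true, hlv]
              module
            · have hss : Finset.univ.filter (fun k => 0 < l' k) ⊂
                  Finset.univ.filter (fun k => 0 < l k) := by
                rw [Finset.ssubset_iff_of_subset]
                · exact ⟨j, by simp [hj], by simp [l'j]⟩
                · intro k hk
                  simp only [Finset.mem_filter, Finset.mem_univ, true_and] at hk ⊢
                  by_cases h1 : k = i
                  · rwa [h1]
                  · by_cases h2 : k = j
                    · rwa [h2]
                    · rwa [l'k k h1 h2] at hk
              have := Finset.card_lt_card hss
              omega
          have sub1 : convexHull ℝ (range (Function.update v i q)) ⊆ convexHull ℝ (range v) := by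
            rw [← hU]; exact subset_union_left
          have sub2 : convexHull ℝ (range (Function.update v j q)) ⊆ convexHull ℝ (range v) := by
            rw [← hU]; exact subset_union_right
          have sub3 : convexHull ℝ (range (Function.update v i q ∘ j.succAbove)) ⊆
              convexHull ℝ (range v) := by
            rw [← hI]; exact inter_subset_left.trans sub1
          have dim : ∀ Q : Set (Euc N), Q ⊆ convexHull ℝ (range v) → sdim Q ≤ n := fun Q hQ =>
            le_trans (Submodule.finrank_mono (vectorSpan_mono ℝ hQ)) hd
          have hval := hδ.2 _ (ve_class _ hd sub1) _ (ve_class _ hd sub2)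
            (by rw [hU]; exact ve_class _ hd Subset.rfl)
            (by rw [hI]; exact ve_class _ hd sub3)
          rw [hU, hI, half i j hij hi hj hqe (dim _ sub1),
            half j i hij.symm hj hi (by rw [add_comm (l j), hqe, add_comm]) (dim _ sub2),
            ih _ (dim _ sub3)] at hval
          linarith
        · push Not at hj
          have hmem : v i ∈ convexHull ℝ (v '' {i}ᶜ) := by
            have e1 : ∑ k ∈ ({i}ᶜ : Finset (Fin (m + 2))), -(l k / l i) = 1 := by
              have := hl
              rw [← Finset.sum_compl_add_sum {i}, Finset.sum_singleton] at this
              rw [Finset.sum_neg_distrib, ← Finset.sum_div, eq_neg_of_add_eq_zero_left this]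
              field_simp
            have e2 : ∑ k ∈ ({i}ᶜ : Finset (Fin (m + 2))), (-(l k / l i)) • v k = v i := by
              have := hlv
              rw [← Finset.sum_compl_add_sum {i}, Finset.sum_singleton] at this
              have e3 : ∀ k, (-(l k / l i)) • v k = (-(l i)⁻¹) • (l k • v k) := by
                intro k; rw [smul_smul]; congr 1; ring
              simp only [e3]
              rw [← Finset.smul_sum, eq_neg_of_add_eq_zero_left this, neg_smul_neg, smul_smul,
                inv_mul_cancel₀ hi.ne', one_smul]
            rw [← e2]
            refine (convex_convexHull ℝ _).sum_mem (fun k hk => ?_) e1 (fun k hk => ?_)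
            · have := hj k (by simpa [eq_comm] using hk)
              have := div_nonpos_of_nonpos_of_nonneg this hi.le
              linarith
            · exact subset_convexHull _ _ ⟨k, by simpa using hk, rfl⟩
          have heq : convexHull ℝ (range v) = convexHull ℝ (range (v ∘ i.succAbove)) := by
            rw [← ve_compl_range]
            apply Subset.antisymm
            · apply convexHull_min _ (convex_convexHull ℝ _)
              rintro _ ⟨k, rfl⟩
              by_cases hk : k = i
              · rwa [hk]
              · exact subset_convexHull _ _ ⟨k, hk, rfl⟩
            · exact convexHull_mono (image_subset_range _ _)
          rw [heq]
          exact ih _ (by rw [← heq]; exact hd)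
    intro v hd
    by_cases hv : AffineIndependent ℝ v
    · exact hsimp _ v hd hv
    · rw [affineIndependent_iff_of_fintype] at hv
      push Not at hv
      obtain ⟨l, hl, hlv, i, hi⟩ := hv
      rw [Finset.univ.weightedVSub_eq_linear_combination hl] at hlv
      refine inner _ v l hd hl hlv ?_ le_rfl
      by_contra hneg
      push Not at hneg
      exact hi ((Finset.sum_eq_zero_iff_of_nonpos (fun k _ => hneg k)).1 hl i (Finset.mem_univ _))

theorem ve_uniq_poly {N n : ℕ} (δ : Set (Euc N) → ℝ) (hδ : IsValuation (polytopeClass N n) δ)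
    (h0 : ∀ S ∈ simplexClass N n, δ S = 0) (A : Set (Euc N)) (hA : A ∈ polytopeClass N n) :
    δ A = 0 := by
  rcases hA with rfl | ⟨⟨t, ht, rfl⟩, hd⟩
  · exact hδ.1
  · obtain ⟨m, hm⟩ : ∃ m, t.card = m + 1 := ⟨t.card - 1, by have := ht.card_pos; omega⟩
    let e := t.equivFinOfCardEq hm
    have hr : (t : Set (Euc N)) = range (fun i => (e.symm i : Euc N)) := by
      have : range (fun i => (e.symm i : Euc N)) = range (Subtype.val : t → Euc N) :=
        e.symm.surjective.range_comp (Subtype.val : t → Euc N)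
      rw [this]; simp
    rw [hr] at hd ⊢
    exact ve_uniq δ hδ h0 m _ hd

/-- every valuation on simplices of dimension at most `n` has a unique
extension to a valuation on polytopes of dimension at most `n`. -/
theorem valuation_extension_polytopes {N n : ℕ} (μ : Set (Euc N) → ℝ)
    (hμ : IsValuation (simplexClass N n) μ) :
    ∃ ν : Set (Euc N) → ℝ, IsValuation (polytopeClass N n) ν ∧
      (∀ A ∈ simplexClass N n, ν A = μ A) ∧
      ∀ ν' : Set (Euc N) → ℝ, IsValuation (polytopeClass N n) ν' →
        (∀ A ∈ simplexClass N n, ν' A = μ A) → ∀ A ∈ polytopeClass N n, ν' A = ν A := by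
  obtain ⟨L, hL⟩ := ve_exists_lin n μ hμ
  have hν : IsValuation (polytopeClass N n) (fun S => L (S.indicator 1)) := by
    refine ⟨?_, fun A _ B _ _ _ => ?_⟩
    · beta_reduce
      rw [indicator_empty]; exact map_zero L
    · beta_reduce
      rw [← map_add, ← map_add, indicator_union_add_inter]
  refine ⟨_, hν, hL, fun ν' hν' he A hA => ?_⟩
  have := ve_uniq_poly (fun S => ν' S - L (S.indicator 1))
    ⟨by have h1 := hν.1; have h2 := hν'.1; simp only at h1 ⊢; linarith, fun A hA B hB hU hI => by
      have h1 := hν.2 A hA B hB hU hI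
      have h2 := hν'.2 A hA B hB hU hI
      simp only at h1 ⊢
      linarith⟩
    (fun S hS => by rw [he S hS, hL S hS, sub_self]) A hA
  exact sub_eq_zero.1 this
end
end
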